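/- Let m ≥ 1 and let χ^{(1)}_1, …, χ^{(1)}_m and χ^{(2)}_1, …, χ^{(2)}_m be primitive Dirichlet characters such that χ^{(1)}_i ≠ χ^{(2)}_j for all 1 ≤ i, j ≤ m. Put L_1(s) = ∏_{i=1}^m L(s, χ^{(1)}_i) and L_2(s) = ∏_{i=1}^m L(s, χ^{(2)}_i), and for a zero σ of L_1·L_2 let m_1(σ) and m_2(σ) be the multiplicities of σ as a zero of L_1 and of L_2 respectively. Then there exists a constant C > 0 such that for all sufficiently large T, ∑ |m_1(σ) − m_2(σ)| > C·(T/2π)·log T, where the sum runs over all σ with 0 < Re σ < 1, 0 < Im σ < T and L_1(σ)L_2(σ) = 0. -/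

import Mathlib

open Filter Topology

namespace DZ

/-- trace inequality for matrices of rank at most `d`. -/
theorem rank_trace {J : ℕ} {ι : Type*} (S : Finset ι) (u v : ι → Fin J → ℂ)
    (M : Fin J → Fin J → ℂ) (hM : ∀ j k, M j k = ∑ r ∈ S, u r j * v r k) :
    ‖∑ j, M j j‖ ^ 2 ≤ S.card * ∑ j, ∑ k, ‖M j k‖ ^ 2 := by
  classical
  let V : Submodule ℂ (EuclideanSpace ℂ (Fin J)) := Submodule.span ℂ ((S.image (fun r => (WithLp.toLp 2 (u r) : EuclideanSpace ℂ (Fin J))) : Finset (EuclideanSpace ℂ (Fin J))) : Set (EuclideanSpace ℂ (Fin J)))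
  have hdim : Module.finrank ℂ V ≤ S.card :=
    (finrank_span_finset_le_card _).trans Finset.card_image_le
  let e := stdOrthonormalBasis ℂ V
  let c : Fin J → EuclideanSpace ℂ (Fin J) := fun k => WithLp.toLp 2 (fun j => M j k)
  have hc : ∀ k, c k ∈ V := by
    intro k
    have : c k = ∑ r ∈ S, v r k • (WithLp.toLp 2 (u r) : EuclideanSpace ℂ (Fin J)) := by
      ext j
      simp [c, hM, mul_comm]
    rw [this]
    refine Submodule.sum_mem _ fun r hr => Submodule.smul_mem _ _ (Submodule.subset_span ?_)
    simp only [Finset.coe_image]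
    exact ⟨r, hr, rfl⟩
  let x : Fin J → V := fun k => ⟨c k, hc k⟩
  have hrep : ∀ k, M k k = ∑ l, e.repr (x k) l * (e l : EuclideanSpace ℂ (Fin J)) k := by
    intro k
    have h1 := e.sum_repr (x k)
    have h2 : c k = ∑ l, e.repr (x k) l • (e l : EuclideanSpace ℂ (Fin J)) := by
      have := congrArg (fun y : V => (y : EuclideanSpace ℂ (Fin J))) h1
      simp only [Submodule.coe_sum, Submodule.coe_smul] at this
      exact this.symm
    have h3 := congrArg (fun y : EuclideanSpace ℂ (Fin J) => y k) h2
    simp only [WithLp.ofLp_sum, Finset.sum_apply, WithLp.ofLp_smul, Pi.smul_apply, smul_eq_mul] at h3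
    exact h3
  have hnorm : ∀ k, ∑ l, ‖e.repr (x k) l‖ ^ 2 = ∑ j, ‖M j k‖ ^ 2 := by
    intro k
    have h1 : ‖e.repr (x k)‖ = ‖x k‖ := e.repr.norm_map _
    have h2 : ‖x k‖ = ‖c k‖ := rfl
    rw [← EuclideanSpace.norm_sq_eq, h1, h2, EuclideanSpace.norm_sq_eq]
  have hone : ∀ l, ∑ k, ‖(e l : EuclideanSpace ℂ (Fin J)) k‖ ^ 2 = 1 := by
    intro l
    rw [← EuclideanSpace.norm_sq_eq]
    have : ‖(e l : EuclideanSpace ℂ (Fin J))‖ = 1 := e.orthonormal.1 l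
    rw [this]; norm_num
  have hsum : ∑ j, M j j = ∑ p : Fin J × Fin (Module.finrank ℂ V), e.repr (x p.1) p.2 * (e p.2 : EuclideanSpace ℂ (Fin J)) p.1 := by
    rw [Fintype.sum_prod_type]
    exact Finset.sum_congr rfl fun k _ => hrep k
  have hb : ‖∑ j, M j j‖ ≤ ∑ p : Fin J × Fin (Module.finrank ℂ V), ‖e.repr (x p.1) p.2‖ * ‖(e p.2 : EuclideanSpace ℂ (Fin J)) p.1‖ := by
    rw [hsum]
    refine (norm_sum_le _ _).trans (le_of_eq ?_)
    simp
  have hcs := Finset.sum_mul_sq_le_sq_mul_sq (Finset.univ : Finset (Fin J × Fin (Module.finrank ℂ V)))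
    (fun p => ‖e.repr (x p.1) p.2‖) (fun p => ‖(e p.2 : EuclideanSpace ℂ (Fin J)) p.1‖)
  have h1 : ∑ p : Fin J × Fin (Module.finrank ℂ V), ‖e.repr (x p.1) p.2‖ ^ 2 = ∑ j, ∑ k, ‖M j k‖ ^ 2 := by
    rw [Fintype.sum_prod_type, Finset.sum_comm (f := fun j k => ‖M j k‖ ^ 2)]
    exact Finset.sum_congr rfl fun k _ => hnorm k
  have h2 : ∑ p : Fin J × Fin (Module.finrank ℂ V), ‖(e p.2 : EuclideanSpace ℂ (Fin J)) p.1‖ ^ 2 = Module.finrank ℂ V := by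
    rw [Fintype.sum_prod_type_right]
    simp [hone]
  rw [h1, h2] at hcs
  have h3 : ‖∑ j, M j j‖ ^ 2 ≤ (∑ p : Fin J × Fin (Module.finrank ℂ V), ‖e.repr (x p.1) p.2‖ * ‖(e p.2 : EuclideanSpace ℂ (Fin J)) p.1‖) ^ 2 := by
    gcongr
  have h4 : (0:ℝ) ≤ ∑ j, ∑ k, ‖M j k‖ ^ 2 := by positivity
  have h5 : (Module.finrank ℂ V : ℝ) ≤ S.card := by exact_mod_cast hdim
  nlinarith

theorem summable_w : Summable (fun l : ℤ => 1 / ((2 * l - 1 : ℝ)) ^ 2) := by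
  have h := (Real.summable_one_div_int_pow (p := 2)).2 (by norm_num)
  refine Summable.of_norm_bounded_eventually h ?_
  have : ({0} : Set ℤ)ᶜ ∈ cofinite := (Set.finite_singleton 0).compl_mem_cofinite
  filter_upwards [this] with l hl
  have hl' : l ≠ 0 := by simpa using hl
  rw [Real.norm_of_nonneg (by positivity)]
  have h1 : (0:ℝ) < (l:ℝ)^2 := by positivity
  apply one_div_le_one_div_of_le h1
  rcases lt_or_gt_of_ne hl' with h | h
  · have : (l:ℝ) ≤ -1 := by exact_mod_cast (by omega : l ≤ -1)
    nlinarith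
  · have : (1:ℝ) ≤ l := by exact_mod_cast (by omega : 1 ≤ l)
    nlinarith

noncomputable def W : ℝ := ∑' l : ℤ, 1 / ((2 * l - 1 : ℝ)) ^ 2

theorem W_nonneg : 0 ≤ W := tsum_nonneg fun l => by positivity

theorem sum_w_right {J : ℕ} (j : Fin J) : ∑ k : Fin J, 1 / (2 * ((j:ℝ) - (k:ℝ)) - 1) ^ 2 ≤ W := by
  have hinj : Function.Injective (fun k : Fin J => ((j:ℤ) - (k:ℤ))) := by
    intro a b h; simp at h; exact Fin.ext (by omega)
  have h := summable_w.sum_le_tsum (Finset.univ.map ⟨_, hinj⟩) (fun l _ => by positivity)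
  rw [Finset.sum_map] at h
  simpa [W] using h

theorem sum_w_left {J : ℕ} (k : Fin J) : ∑ j : Fin J, 1 / (2 * ((j:ℝ) - (k:ℝ)) - 1) ^ 2 ≤ W := by
  have hinj : Function.Injective (fun j : Fin J => ((j:ℤ) - (k:ℤ))) := by
    intro a b h; simp at h; exact Fin.ext (by omega)
  have h := summable_w.sum_le_tsum (Finset.univ.map ⟨_, hinj⟩) (fun l _ => by positivity)
  rw [Finset.sum_map] at h
  simpa [W] using h
end DZ

namespace DZ

set_option maxHeartbeats 1000000 in
theorem matrix_ineq {J : ℕ} {ι : Type*} (S : Finset ι) (u v : ι → Fin J → ℂ)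
    (H E : Fin J → Fin J → ℂ) (hR : ∀ j k, H j k - E j k = ∑ r ∈ S, u r j * v r k)
    (g g' : Fin J → ℂ) (lam K c0 B : ℝ) (hlam : 1 ≤ lam) (hc0 : 0 ≤ c0) (hB : 0 < B)
    (hH : ∀ j k, ‖H j k‖ ^ 2 ≤ lam ^ 2 * ‖g j - g' k‖ ^ 2 * (1 / (2 * ((j:ℝ) - (k:ℝ)) - 1) ^ 2))
    (hHd : ∀ j, lam ^ 2 * ‖g j - g' j‖ ^ 2 ≤ c0 * ‖H j j‖ ^ 2)
    (hE : ∀ j k, ‖E j k‖ ^ 2 ≤ K ^ 2 * lam ^ 4 * (1 / (2 * ((j:ℝ) - (k:ℝ)) - 1) ^ 2 + 1 / J))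
    (hEd : ∀ j, ‖E j j‖ ≤ K) :
    lam ^ 2 * ∑ j, ‖g j - g' j‖ ^ 2 ≤ c0 * (2 * (K ^ 2 * J) + B * lam ^ 4 * S.card +
      (16 * W + 4 * K ^ 2 * (W + 1)) / B * ∑ j, (‖g j‖ ^ 4 + ‖g' j‖ ^ 4 + lam ^ 4)) := by
  set w : Fin J → Fin J → ℝ := fun j k => 1 / (2 * ((j:ℝ) - (k:ℝ)) - 1) ^ 2 with hw
  have hw0 : ∀ j k, 0 ≤ w j k := fun j k => by positivity
  have hW0 := W_nonneg
  have hwjj : ∀ j, w j j = 1 := by intro j; simp [hw]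
  set P := ∑ j, (‖g j‖ ^ 4 + ‖g' j‖ ^ 4 + lam ^ 4) with hP
  have hP0 : 0 ≤ P := by positivity
  set S2 := ∑ j, ‖H j j‖ ^ 2 with hS2
  have hS20 : 0 ≤ S2 := by positivity
  set Y := ∑ j, ∑ k, ‖(starRingEnd ℂ) (H j j) * (H j k - E j k)‖ ^ 2 with hY
  have hsq : ∀ j k, ‖g j - g' k‖ ^ 2 ≤ 2 * (‖g j‖ ^ 2 + ‖g' k‖ ^ 2) := by
    intro j k
    have := norm_sub_le (g j) (g' k)
    nlinarith [norm_nonneg (g j - g' k), sq_nonneg (‖g j‖ - ‖g' k‖)]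
  have hHjj : ∀ j, ‖H j j‖ ^ 2 ≤ 2 * lam ^ 2 * (‖g j‖ ^ 2 + ‖g' j‖ ^ 2) := by
    intro j
    have h1 := hH j j
    have h2 := hwjj j
    simp only [hw] at h2
    rw [h2] at h1
    have := hsq j j
    have : lam ^ 2 * ‖g j - g' j‖ ^ 2 ≤ lam ^ 2 * (2 * (‖g j‖ ^ 2 + ‖g' j‖ ^ 2)) := by gcongr
    linarith
  have hterm : ∀ j k, ‖(starRingEnd ℂ) (H j j) * (H j k - E j k)‖ ^ 2 ≤
      8 * lam ^ 4 * (w j k * (2 * ‖g j‖ ^ 4 + ‖g' j‖ ^ 4)) + 8 * lam ^ 4 * (w j k * ‖g' k‖ ^ 4)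
       + 4 * K ^ 2 * lam ^ 4 * ((‖g j‖ ^ 4 + ‖g' j‖ ^ 4 + lam ^ 4) * (w j k + 1 / J)) := by
    intro j k
    rw [norm_mul, RCLike.norm_conj, mul_pow]
    have h1 : ‖H j k - E j k‖ ^ 2 ≤ 2 * ‖H j k‖ ^ 2 + 2 * ‖E j k‖ ^ 2 := by
      have := norm_sub_le (H j k) (E j k)
      nlinarith [norm_nonneg (H j k - E j k), sq_nonneg (‖H j k‖ - ‖E j k‖)]
    have h2 : ‖H j k‖ ^ 2 ≤ 2 * lam ^ 2 * (‖g j‖ ^ 2 + ‖g' k‖ ^ 2) * w j k := by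
      refine (hH j k).trans ?_
      have h3 := hsq j k
      have : lam ^ 2 * ‖g j - g' k‖ ^ 2 ≤ lam ^ 2 * (2 * (‖g j‖ ^ 2 + ‖g' k‖ ^ 2)) := by gcongr
      have h4 := mul_le_mul_of_nonneg_right this (hw0 j k)
      refine h4.trans (le_of_eq ?_)
      ring
    have h5 : ‖H j j‖ ^ 2 * ‖H j k‖ ^ 2 ≤ (2 * lam ^ 2 * (‖g j‖ ^ 2 + ‖g' j‖ ^ 2)) *
       (2 * lam ^ 2 * (‖g j‖ ^ 2 + ‖g' k‖ ^ 2) * w j k) := by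
      gcongr
      exact hHjj j
    have h6 : (‖g j‖ ^ 2 + ‖g' j‖ ^ 2) * (‖g j‖ ^ 2 + ‖g' k‖ ^ 2) ≤ 2 * ‖g j‖ ^ 4 + ‖g' j‖ ^ 4 + ‖g' k‖ ^ 4 := by
      nlinarith [sq_nonneg (‖g j‖ ^ 2 - ‖g' j‖ ^ 2), sq_nonneg (‖g j‖ ^ 2 - ‖g' k‖ ^ 2), sq_nonneg (‖g' j‖ ^ 2 - ‖g' k‖ ^ 2)]
    have h7 : ‖H j j‖ ^ 2 * ‖H j k‖ ^ 2 ≤ 4 * lam ^ 4 * (w j k * (2 * ‖g j‖ ^ 4 + ‖g' j‖ ^ 4 + ‖g' k‖ ^ 4)) := by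
      refine h5.trans ?_
      have h8 : 4 * lam ^ 4 * (w j k * ((‖g j‖ ^ 2 + ‖g' j‖ ^ 2) * (‖g j‖ ^ 2 + ‖g' k‖ ^ 2)))
        ≤ 4 * lam ^ 4 * (w j k * (2 * ‖g j‖ ^ 4 + ‖g' j‖ ^ 4 + ‖g' k‖ ^ 4)) := by
        gcongr
      refine le_trans (le_of_eq ?_) h8
      ring
    have h9 : ‖H j j‖ ^ 2 * ‖E j k‖ ^ 2 ≤ (2 * lam ^ 2 * (‖g j‖ ^ 2 + ‖g' j‖ ^ 2)) *
       (K ^ 2 * lam ^ 4 * (w j k + 1 / J)) := by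
      gcongr
      · exact hHjj j
      · exact hE j k
    have h10 : lam ^ 2 * (‖g j‖ ^ 2 + ‖g' j‖ ^ 2) ≤ ‖g j‖ ^ 4 + ‖g' j‖ ^ 4 + lam ^ 4 := by
      nlinarith [sq_nonneg (‖g j‖ ^ 2 - lam ^ 2), sq_nonneg (‖g' j‖ ^ 2 - lam ^ 2), sq_nonneg (‖g j‖ ^ 2), sq_nonneg (‖g' j‖ ^ 2)]
    have h11 : ‖H j j‖ ^ 2 * ‖E j k‖ ^ 2 ≤ 2 * K ^ 2 * lam ^ 4 * ((‖g j‖ ^ 4 + ‖g' j‖ ^ 4 + lam ^ 4) * (w j k + 1 / J)) := by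
      refine h9.trans ?_
      have h12 : 2 * K ^ 2 * lam ^ 4 * ((lam ^ 2 * (‖g j‖ ^ 2 + ‖g' j‖ ^ 2)) * (w j k + 1 / J)) ≤ 2 * K ^ 2 * lam ^ 4 * ((‖g j‖ ^ 4 + ‖g' j‖ ^ 4 + lam ^ 4) * (w j k + 1 / J)) := by
        have := hw0 j k
        gcongr
      refine le_trans (le_of_eq ?_) h12
      ring
    have h13 : ‖H j j‖ ^ 2 * ‖H j k - E j k‖ ^ 2 ≤ ‖H j j‖ ^ 2 * (2 * ‖H j k‖ ^ 2 + 2 * ‖E j k‖ ^ 2) := by gcongr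
    linarith
  have hrow : ∀ j, ∑ k, w j k ≤ W := fun j => sum_w_right j
  have hcol : ∀ k, ∑ j, w j k ≤ W := fun k => sum_w_left k
  have hrow1 : ∀ j : Fin J, ∑ k, (w j k + 1 / J) ≤ W + 1 := by
    intro j
    rw [Finset.sum_add_distrib]
    have : ∑ k : Fin J, (1 / J : ℝ) = 1 := by
      have : (J:ℝ) ≠ 0 := by
        have : 0 < J := lt_of_le_of_lt (Nat.zero_le _) j.2
        positivity
      simp [this]
    rw [this]; have := hrow j; linarith
  have hYle : Y ≤ lam ^ 4 * ((16 * W + 4 * K ^ 2 * (W + 1)) * P) := by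
    have h1 : Y ≤ ∑ j, ∑ k, (8 * lam ^ 4 * (w j k * (2 * ‖g j‖ ^ 4 + ‖g' j‖ ^ 4)) + 8 * lam ^ 4 * (w j k * ‖g' k‖ ^ 4)
       + 4 * K ^ 2 * lam ^ 4 * ((‖g j‖ ^ 4 + ‖g' j‖ ^ 4 + lam ^ 4) * (w j k + 1 / J))) :=
      Finset.sum_le_sum fun j _ => Finset.sum_le_sum fun k _ => hterm j k
    refine h1.trans ?_
    simp only [Finset.sum_add_distrib, ← Finset.mul_sum]
    have e1 : ∑ j, ∑ k, w j k * (2 * ‖g j‖ ^ 4 + ‖g' j‖ ^ 4) ≤ ∑ j, W * (2 * ‖g j‖ ^ 4 + ‖g' j‖ ^ 4) := by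
      refine Finset.sum_le_sum fun j _ => ?_
      rw [← Finset.sum_mul]
      exact mul_le_mul_of_nonneg_right (hrow j) (by positivity)
    have e2 : ∑ j, ∑ k, w j k * ‖g' k‖ ^ 4 ≤ ∑ k, W * ‖g' k‖ ^ 4 := by
      rw [Finset.sum_comm]
      refine Finset.sum_le_sum fun j _ => ?_
      rw [← Finset.sum_mul]
      exact mul_le_mul_of_nonneg_right (hcol j) (by positivity)
    have e3 : ∑ j, (‖g j‖ ^ 4 + ‖g' j‖ ^ 4 + lam ^ 4) * ∑ k, (w j k + 1 / J) ≤ P * (W + 1) := by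
      rw [hP, Finset.sum_mul]
      refine Finset.sum_le_sum fun j _ => ?_
      exact mul_le_mul_of_nonneg_left (hrow1 j) (by positivity)
    have e4 : ∑ j, W * (2 * ‖g j‖ ^ 4 + ‖g' j‖ ^ 4) + ∑ k, W * ‖g' k‖ ^ 4 ≤ 2 * W * P := by
      rw [hP, ← Finset.sum_add_distrib, Finset.mul_sum]
      refine Finset.sum_le_sum fun j _ => ?_
      have : 0 ≤ W * lam ^ 4 := by positivity
      nlinarith
    simp only [Finset.sum_add_distrib] at e3
    have hl4 : 0 ≤ lam ^ 4 := by positivity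
    have a1 := mul_le_mul_of_nonneg_left (add_le_add e1 e2) (by positivity : 0 ≤ 8 * lam ^ 4)
    have a2 := mul_le_mul_of_nonneg_left e4 (by positivity : 0 ≤ 8 * lam ^ 4)
    have a3 := mul_le_mul_of_nonneg_left e3 (by positivity : 0 ≤ 4 * K ^ 2 * lam ^ 4)
    linarith
  have hrank := rank_trace S (fun r j => (starRingEnd ℂ) (H j j) * u r j) v
    (fun j k => (starRingEnd ℂ) (H j j) * (H j k - E j k)) (by
      intro j k
      rw [hR, Finset.mul_sum]
      exact Finset.sum_congr rfl fun r _ => by ring)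
  set X := ‖∑ j, (starRingEnd ℂ) (H j j) * (H j j - E j j)‖ with hX
  have hS2X : S2 ≤ X + ∑ j, ‖H j j‖ * K := by
    have h1 : ((S2 : ℝ) : ℂ) = ∑ j, (starRingEnd ℂ) (H j j) * (H j j - E j j) + ∑ j, (starRingEnd ℂ) (H j j) * E j j := by
      rw [← Finset.sum_add_distrib, hS2]
      push_cast
      refine Finset.sum_congr rfl fun j _ => ?_
      rw [← Complex.conj_mul']
      ring
    have h2 : S2 = ‖((S2 : ℝ) : ℂ)‖ := by rw [Complex.norm_real, Real.norm_of_nonneg hS20]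
    rw [h2, h1]
    refine (norm_add_le _ _).trans (add_le_add le_rfl ?_)
    refine (norm_sum_le _ _).trans (Finset.sum_le_sum fun j _ => ?_)
    rw [norm_mul, RCLike.norm_conj]
    exact mul_le_mul_of_nonneg_left (hEd j) (norm_nonneg _)
  have hHK : ∑ j, ‖H j j‖ * K ≤ S2 / 2 + K ^ 2 * J / 2 := by
    have : ∑ j, ‖H j j‖ * K ≤ ∑ j : Fin J, (‖H j j‖ ^ 2 / 2 + K ^ 2 / 2) :=
      Finset.sum_le_sum fun j _ => by nlinarith [sq_nonneg (‖H j j‖ - K)]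
    refine this.trans (le_of_eq ?_)
    rw [Finset.sum_add_distrib, ← Finset.sum_div]
    simp; ring
  set n : ℝ := (S.card : ℝ) with hn
  have hn0 : 0 ≤ n := by positivity
  set C1 := 16 * W + 4 * K ^ 2 * (W + 1) with hC1
  have hC10 : 0 ≤ C1 := by positivity
  have hX2 : X ^ 2 ≤ (B * lam ^ 4 * n) * (C1 / B * P) := by
    refine hrank.trans ?_
    refine (mul_le_mul_of_nonneg_left hYle hn0).trans (le_of_eq ?_)
    field_simp
  have hXle : X ≤ (B * lam ^ 4 * n + C1 / B * P) / 2 := by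
    have q1 : 0 ≤ B * lam ^ 4 * n := by positivity
    have q2 : 0 ≤ C1 / B * P := by positivity
    refine (sq_le_sq₀ (norm_nonneg _) (by positivity)).1 ?_
    generalize B * lam ^ 4 * n = p at *
    generalize C1 / B * P = q at *
    nlinarith [sq_nonneg (p - q)]
  have hfin : lam ^ 2 * ∑ j, ‖g j - g' j‖ ^ 2 ≤ c0 * S2 := by
    rw [hS2, Finset.mul_sum, Finset.mul_sum]
    exact Finset.sum_le_sum fun j _ => hHd j
  refine hfin.trans (mul_le_mul_of_nonneg_left ?_ hc0)
  have : 0 ≤ K ^ 2 * J := by positivity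
  linarith
end DZ

namespace DZ

theorem mv {ι : Type*} (A : Finset ι) (c : ι → ℂ) (ω : ι → ℝ) (δ : ℝ) (hδ : 0 < δ)
    (hgap : ∀ x ∈ A, ∀ y ∈ A, ω x ≠ ω y → δ ≤ |ω x - ω y|) (a b : ℝ) :
    ‖((∫ t in a..b, ‖∑ x ∈ A, c x * Complex.exp (-(ω x * t) * Complex.I)‖ ^ 2 : ℝ) : ℂ) -
      (b - a) * ∑ x ∈ A, ∑ y ∈ A, (if ω x = ω y then c x * (starRingEnd ℂ) (c y) else 0)‖
      ≤ 2 / δ * (∑ x ∈ A, ‖c x‖) ^ 2 := by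
  have h1 : ∀ t : ℝ, ((‖∑ x ∈ A, c x * Complex.exp (-(ω x * t) * Complex.I)‖ ^ 2 : ℝ) : ℂ) =
      ∑ x ∈ A, ∑ y ∈ A, c x * (starRingEnd ℂ) (c y) * Complex.exp ((-(ω x - ω y) * Complex.I) * t) := by
    intro t
    push_cast
    rw [← Complex.mul_conj', map_sum, Finset.sum_mul_sum]
    refine Finset.sum_congr rfl fun x _ => Finset.sum_congr rfl fun y _ => ?_
    rw [map_mul, ← Complex.exp_conj]
    have : Complex.exp (-(↑(ω x) - ↑(ω y)) * Complex.I * ↑t) =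
      Complex.exp (-(ω x * t) * Complex.I) * Complex.exp ((starRingEnd ℂ) (-(ω y * t) * Complex.I)) := by
      rw [← Complex.exp_add]
      congr 1
      simp
      ring
    rw [this]; ring
  rw [← intervalIntegral.integral_ofReal]
  simp only [h1]
  rw [intervalIntegral.integral_finsetSum (fun x _ => by
    apply Continuous.intervalIntegrable; fun_prop)]
  have h2 : ∀ x ∈ A, ∫ t in a..b, ∑ y ∈ A, c x * (starRingEnd ℂ) (c y) * Complex.exp ((-(ω x - ω y) * Complex.I) * t)
      = ∑ y ∈ A, ∫ t in a..b, c x * (starRingEnd ℂ) (c y) * Complex.exp ((-(ω x - ω y) * Complex.I) * t) := by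
    intro x _
    exact intervalIntegral.integral_finsetSum (fun y _ => by
      apply Continuous.intervalIntegrable; fun_prop)
  rw [Finset.sum_congr rfl h2, Finset.mul_sum, ← Finset.sum_sub_distrib]
  have h3 : (2 / δ * (∑ x ∈ A, ‖c x‖) ^ 2) = ∑ x ∈ A, ∑ y ∈ A, 2 / δ * (‖c x‖ * ‖c y‖) := by
    rw [sq, Finset.sum_mul_sum, Finset.mul_sum]
    exact Finset.sum_congr rfl fun x _ => by rw [Finset.mul_sum]
  rw [h3]
  refine (norm_sum_le _ _).trans (Finset.sum_le_sum fun x hx => ?_)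
  rw [Finset.mul_sum, ← Finset.sum_sub_distrib]
  refine (norm_sum_le _ _).trans (Finset.sum_le_sum fun y hy => ?_)
  by_cases hxy : ω x = ω y
  · have : ∀ t : ℝ, c x * (starRingEnd ℂ) (c y) * Complex.exp ((-(ω x - ω y) * Complex.I) * t) = c x * (starRingEnd ℂ) (c y) := by
      intro t; simp [hxy]
    simp only [this, intervalIntegral.integral_const, if_pos hxy]
    have : (b - a) • (c x * (starRingEnd ℂ) (c y)) - (↑b - ↑a) * (c x * (starRingEnd ℂ) (c y)) = 0 := by
      rw [Complex.real_smul]; push_cast; ring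
    rw [this, norm_zero]; positivity
  · simp only [hxy, if_false, mul_zero, sub_zero]
    have hne : (-((ω x : ℂ) - ω y) * Complex.I) ≠ 0 := by
      have : (ω x : ℂ) - ω y ≠ 0 := by
        rw [sub_ne_zero]; exact_mod_cast hxy
      exact mul_ne_zero (neg_ne_zero.2 this) Complex.I_ne_zero
    rw [intervalIntegral.integral_const_mul, integral_exp_mul_complex hne, norm_mul, norm_mul, RCLike.norm_conj, mul_comm]
    gcongr
    have hn1 : ∀ r : ℝ, ‖Complex.exp (-((ω x : ℂ) - ω y) * Complex.I * r)‖ = 1 := by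
      intro r
      have : (-((ω x : ℂ) - ω y) * Complex.I * r) = ((-(ω x - ω y) * r : ℝ) : ℂ) * Complex.I := by push_cast; ring
      rw [this, Complex.norm_exp_ofReal_mul_I]
    rw [norm_div]
    have hn2 : ‖(-((ω x : ℂ) - ω y) * Complex.I)‖ = |ω x - ω y| := by
      rw [norm_mul, Complex.norm_I, mul_one, norm_neg, ← Complex.ofReal_sub, Complex.norm_real, Real.norm_eq_abs]
    rw [hn2]
    have hn3 := norm_sub_le (Complex.exp (-((ω x : ℂ) - ω y) * Complex.I * b)) (Complex.exp (-((ω x : ℂ) - ω y) * Complex.I * a))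
    rw [hn1, hn1] at hn3
    have := hgap x hx y hy hxy
    gcongr
    linarith

/-- Dirichlet polynomial. -/
noncomputable def Gs (N : ℕ) (c : ℕ → ℂ) (t : ℝ) : ℂ :=
  ∑ n ∈ Finset.Icc 1 N, c n * Complex.exp (-(Real.log n * t) * Complex.I)

theorem Gs_cont (N : ℕ) (c : ℕ → ℂ) : Continuous (Gs N c) := by
  unfold Gs; fun_prop

theorem Gs_shift (N : ℕ) (c : ℕ → ℂ) (h t : ℝ) : Gs N c t - Gs N c (t + h) =
    Gs N (fun n => c n * (1 - Complex.exp (-(Real.log n * h) * Complex.I))) t := by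
  unfold Gs
  rw [← Finset.sum_sub_distrib]
  refine Finset.sum_congr rfl fun n _ => ?_
  have : Complex.exp (-(Real.log n * ((t + h : ℝ) : ℂ)) * Complex.I) =
    Complex.exp (-(Real.log n * h) * Complex.I) * Complex.exp (-(Real.log n * t) * Complex.I) := by
    rw [← Complex.exp_add]; congr 1; push_cast; ring
  rw [this]; ring

theorem log_gap {x y M : ℕ} (hx : 1 ≤ x) (hy : 1 ≤ y) (hxM : x ≤ M) (hyM : y ≤ M)
    (hne : Real.log x ≠ Real.log y) : 1 / (M:ℝ) ≤ |Real.log x - Real.log y| := by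
  have key : ∀ x y : ℕ, 1 ≤ y → y < x → x ≤ M → 1 / (M:ℝ) ≤ Real.log x - Real.log y := by
    intro x y hy hxy hxM
    have hy' : (0:ℝ) < y := by exact_mod_cast hy
    have hx' : (0:ℝ) < x := by exact_mod_cast (by omega : 0 < x)
    have h := Real.log_le_sub_one_of_pos (div_pos hy' hx')
    rw [Real.log_div hy'.ne' hx'.ne'] at h
    have h1 : 1 / (x:ℝ) ≤ 1 - y / x := by
      rw [div_le_iff₀ hx']; field_simp
      have : (y:ℝ) + 1 ≤ x := by exact_mod_cast hxy
      linarith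
    have h2 : 1 / (M:ℝ) ≤ 1 / x := one_div_le_one_div_of_le hx' (by exact_mod_cast hxM)
    linarith
  have hxy : x ≠ y := by rintro rfl; exact hne rfl
  rcases lt_or_gt_of_ne hxy with h | h
  · rw [abs_sub_comm]; exact (key y x hx h hyM).trans (le_abs_self _)
  · exact (key x y hy h hxM).trans (le_abs_self _)

theorem log_inj_nat {x y : ℕ} (hx : 1 ≤ x) (hy : 1 ≤ y) : Real.log x = Real.log y ↔ x = y := by
  constructor
  · intro h
    have := Real.log_injOn_pos (Set.mem_Ioi.2 (by exact_mod_cast hx : (0:ℝ) < x)) (Set.mem_Ioi.2 (by exact_mod_cast hy : (0:ℝ) < y)) h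
    exact_mod_cast this
  · rintro rfl; rfl

theorem mv2 (N : ℕ) (hN : 1 ≤ N) (c : ℕ → ℂ) (a b : ℝ) :
    (b - a) * ∑ n ∈ Finset.Icc 1 N, ‖c n‖ ^ 2 - 2 * N * (∑ n ∈ Finset.Icc 1 N, ‖c n‖) ^ 2 ≤
      ∫ t in a..b, ‖Gs N c t‖ ^ 2 := by
  have hN' : (0:ℝ) < N := by exact_mod_cast hN
  have h := mv (Finset.Icc 1 N) c (fun n : ℕ => Real.log n) (1 / N) (by positivity) (by
    intro x hx y hy hne
    rw [Finset.mem_Icc] at hx hy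
    exact log_gap hx.1 hy.1 hx.2 hy.2 hne) a b
  have hdiag : ∑ x ∈ Finset.Icc 1 N, ∑ y ∈ Finset.Icc 1 N, (if Real.log (x:ℕ) = Real.log (y:ℕ) then c x * (starRingEnd ℂ) (c y) else 0)
      = ((∑ n ∈ Finset.Icc 1 N, ‖c n‖ ^ 2 : ℝ) : ℂ) := by
    push_cast
    refine Finset.sum_congr rfl fun x hx => ?_
    rw [Finset.sum_eq_single x]
    · simp [Complex.mul_conj']
    · intro y hy hyx
      rw [Finset.mem_Icc] at hx hy
      rw [if_neg]
      rw [log_inj_nat hx.1 hy.1]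
      exact fun h => hyx h.symm
    · intro h; exact absurd hx h
  rw [hdiag] at h
  have h2 : ((b:ℂ) - a) * ((∑ n ∈ Finset.Icc 1 N, ‖c n‖ ^ 2 : ℝ) : ℂ) = (((b - a) * ∑ n ∈ Finset.Icc 1 N, ‖c n‖ ^ 2 : ℝ) : ℂ) := by
    push_cast; ring
  rw [h2, ← Complex.ofReal_sub, Complex.norm_real, Real.norm_eq_abs, abs_le] at h
  have h3 := h.1
  have h4 : (2:ℝ) / (1 / N) = 2 * N := by field_simp
  rw [h4] at h3
  unfold Gs
  linarith

theorem mv4 (N : ℕ) (hN : 1 ≤ N) (c : ℕ → ℂ) (a b : ℝ) (hab : a ≤ b) :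
    ∫ t in a..b, ‖Gs N c t‖ ^ 4 ≤ (b - a) * ∑ x ∈ Finset.Icc 1 N ×ˢ Finset.Icc 1 N, ∑ y ∈ Finset.Icc 1 N ×ˢ Finset.Icc 1 N,
      (if x.1 * x.2 = y.1 * y.2 then ‖c x.1‖ * ‖c x.2‖ * (‖c y.1‖ * ‖c y.2‖) else 0)
      + 2 * N ^ 2 * (∑ n ∈ Finset.Icc 1 N, ‖c n‖) ^ 4 := by
  have hN' : (0:ℝ) < N := by exact_mod_cast hN
  have hmem : ∀ x ∈ Finset.Icc 1 N ×ˢ Finset.Icc 1 N, 1 ≤ x.1 * x.2 ∧ x.1 * x.2 ≤ N ^ 2 := by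
    intro x hx
    rw [Finset.mem_product, Finset.mem_Icc, Finset.mem_Icc] at hx
    exact ⟨Nat.one_le_iff_ne_zero.2 (Nat.mul_ne_zero (by omega) (by omega)), by rw [sq]; exact Nat.mul_le_mul hx.1.2 hx.2.2⟩
  have h := mv (Finset.Icc 1 N ×ˢ Finset.Icc 1 N) (fun x => c x.1 * c x.2) (fun x => Real.log ((x.1 * x.2 : ℕ) : ℝ)) (1 / ((N ^ 2 : ℕ) : ℝ)) (by positivity) (by
    intro x hx y hy hne
    exact log_gap (hmem x hx).1 (hmem y hy).1 (hmem x hx).2 (hmem y hy).2 hne) a b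
  have hsq : ∀ t : ℝ, ‖∑ x ∈ Finset.Icc 1 N ×ˢ Finset.Icc 1 N, (c x.1 * c x.2) * Complex.exp (-(Real.log ((x.1 * x.2 : ℕ) : ℝ) * t) * Complex.I)‖ ^ 2 = ‖Gs N c t‖ ^ 4 := by
    intro t
    have : ∑ x ∈ Finset.Icc 1 N ×ˢ Finset.Icc 1 N, (c x.1 * c x.2) * Complex.exp (-(Real.log ((x.1 * x.2 : ℕ) : ℝ) * t) * Complex.I) = Gs N c t * Gs N c t := by
      unfold Gs
      rw [Finset.sum_mul_sum, Finset.sum_product]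
      refine Finset.sum_congr rfl fun x hx => Finset.sum_congr rfl fun y hy => ?_
      rw [Finset.mem_Icc] at hx hy
      have hx0 : (x:ℝ) ≠ 0 := by exact_mod_cast (by omega : x ≠ 0)
      have hy0 : (y:ℝ) ≠ 0 := by exact_mod_cast (by omega : y ≠ 0)
      have : Complex.exp (-(Real.log ((x * y : ℕ) : ℝ) * t) * Complex.I) = Complex.exp (-(Real.log x * t) * Complex.I) * Complex.exp (-(Real.log y * t) * Complex.I) := by
        rw [← Complex.exp_add]; congr 1
        push_cast [Real.log_mul hx0 hy0]; ring
      rw [this]; ring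
    rw [this, norm_mul]; ring
  simp only [hsq] at h
  set Dg := ∑ x ∈ Finset.Icc 1 N ×ˢ Finset.Icc 1 N, ∑ y ∈ Finset.Icc 1 N ×ˢ Finset.Icc 1 N,
      (if x.1 * x.2 = y.1 * y.2 then ‖c x.1‖ * ‖c x.2‖ * (‖c y.1‖ * ‖c y.2‖) else 0) with hDg
  have hdiag : ‖∑ x ∈ Finset.Icc 1 N ×ˢ Finset.Icc 1 N, ∑ y ∈ Finset.Icc 1 N ×ˢ Finset.Icc 1 N,
      (if Real.log ((x.1 * x.2 : ℕ) : ℝ) = Real.log ((y.1 * y.2 : ℕ) : ℝ) then c x.1 * c x.2 * (starRingEnd ℂ) (c y.1 * c y.2) else 0)‖ ≤ Dg := by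
    refine (norm_sum_le _ _).trans (Finset.sum_le_sum fun x hx => ?_)
    refine (norm_sum_le _ _).trans (Finset.sum_le_sum fun y hy => ?_)
    simp only [log_inj_nat (hmem x hx).1 (hmem y hy).1]
    split_ifs
    · rw [norm_mul, RCLike.norm_conj, norm_mul, norm_mul]
    · simp
  have hl1 : ∑ x ∈ Finset.Icc 1 N ×ˢ Finset.Icc 1 N, ‖c x.1 * c x.2‖ = (∑ n ∈ Finset.Icc 1 N, ‖c n‖) ^ 2 := by
    rw [sq, Finset.sum_mul_sum, Finset.sum_product]
    simp
  rw [hl1] at h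
  have h4 : (2:ℝ) / (1 / ((N ^ 2 : ℕ) : ℝ)) = 2 * N ^ 2 := by push_cast; field_simp
  rw [h4, ← pow_mul, show 2 * 2 = 4 from rfl] at h
  have h5 := norm_sub_norm_le (((∫ t in a..b, ‖Gs N c t‖ ^ 4 : ℝ)) : ℂ) ((b - a) * ∑ x ∈ Finset.Icc 1 N ×ˢ Finset.Icc 1 N, ∑ y ∈ Finset.Icc 1 N ×ˢ Finset.Icc 1 N,
      (if Real.log ((x.1 * x.2 : ℕ) : ℝ) = Real.log ((y.1 * y.2 : ℕ) : ℝ) then c x.1 * c x.2 * (starRingEnd ℂ) (c y.1 * c y.2) else 0))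
  have h6 := h5.trans h
  rw [norm_mul, Complex.norm_real, Real.norm_eq_abs, ← Complex.ofReal_sub, Complex.norm_real, Real.norm_eq_abs, abs_of_nonneg (sub_nonneg.2 hab)] at h6
  have h7 := le_abs_self (∫ t in a..b, ‖Gs N c t‖ ^ 4)
  have h8 := mul_le_mul_of_nonneg_left hdiag (sub_nonneg.2 hab)
  linarith
end DZ

namespace DZ
open ArithmeticFunction ArithmeticFunction.vonMangoldt

theorem resid_one (n : ℕ) : residueClass (1 : ZMod 1) n = vonMangoldt n := by
  unfold residueClass
  rw [Set.indicator_of_mem]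
  exact Subsingleton.elim _ _

theorem resid_summable {q : ℕ} [NeZero q] (a : ZMod q) {x : ℝ} (hx : 1 < x) :
    Summable (fun n : ℕ => residueClass a n / (n:ℝ) ^ x) := by
  have h := LSeriesSummable_of_abscissaOfAbsConv_lt_re (f := fun n => (residueClass a n : ℂ)) (s := (x:ℂ))
    ((abscissaOfAbsConv_residueClass_le_one a).trans_lt <| by norm_cast)
  have h2 := h.norm
  refine h2.congr fun n => ?_
  rw [LSeries.norm_term_eq]
  split_ifs with hn
  · simp [hn]
  · rw [Complex.norm_real, Real.norm_of_nonneg (residueClass_nonneg a n)]; simp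

theorem resid_tsum {q : ℕ} [NeZero q] {a : ZMod q} (ha : IsUnit a) {x : ℝ} (hx : 1 < x) :
      ∑' n, residueClass a n / (n : ℝ) ^ x =
        (LFunctionResidueClassAux a x).re + (q.totient : ℝ)⁻¹ / (x - 1) := by
    refine Complex.ofReal_injective ?_
    simp only [Complex.ofReal_tsum, Complex.ofReal_div, Complex.ofReal_cpow (Nat.cast_nonneg _), Complex.ofReal_natCast,
      Complex.ofReal_add, Complex.ofReal_inv, Complex.ofReal_sub, Complex.ofReal_one]
    simp_rw [← LFunctionResidueClassAux_real ha hx,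
      eqOn_LFunctionResidueClassAux ha <| Set.mem_ofPred.mpr (Complex.ofReal_re x ▸ hx), sub_add_cancel,
      LSeries, LSeries.term]
    refine tsum_congr fun n ↦ ?_
    split_ifs with hn
    · simp only [hn, residueClass_apply_zero, Complex.ofReal_zero, zero_div]
    · rfl

theorem lam_upper : ∃ C : ℝ, 0 ≤ C ∧ ∀ x : ℝ, 1 < x → x ≤ 2 →
    Summable (fun n : ℕ => vonMangoldt n / (n:ℝ) ^ x) ∧ ∑' n : ℕ, vonMangoldt n / (n:ℝ) ^ x ≤ 1 / (x - 1) + C := by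
  have : ContinuousOn (fun x : ℝ ↦ (LFunctionResidueClassAux (1 : ZMod 1) x).re) (Set.Icc 1 2) :=
    Complex.continuous_re.continuousOn.comp (t := Set.univ) (continuousOn_LFunctionResidueClassAux (1 : ZMod 1))
      (fun ⦃x⦄ a ↦ trivial) |>.comp Complex.continuous_ofReal.continuousOn fun x hx ↦ by
        simpa only [Set.mem_ofPred_eq, Complex.ofReal_re] using hx.1
  obtain ⟨C, hC⟩ := bddAbove_def.mp <| IsCompact.bddAbove_image isCompact_Icc this
  refine ⟨max C 0, le_max_right _ _, fun x hx hx2 => ?_⟩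
  have h1 := resid_summable (1 : ZMod 1) hx
  have h2 := resid_tsum (a := (1 : ZMod 1)) isUnit_one hx
  simp only [resid_one] at h1 h2
  refine ⟨h1, ?_⟩
  rw [h2]
  have := hC _ (Set.mem_image_of_mem (fun x : ℝ ↦ (LFunctionResidueClassAux (1 : ZMod 1) x).re) (⟨hx.le, hx2⟩ : x ∈ Set.Icc (1:ℝ) 2))
  have h3 := le_max_left C 0
  simp only [Nat.totient_one, Nat.cast_one, inv_one]
  linarith

/-- comparison of `1/n` with `e / n^(1+1/V)` when `log n ≤ V`. -/
theorem inv_le_rpow {n : ℕ} (hn : 1 ≤ n) {V : ℝ} (hV : 0 < V) (h : Real.log n ≤ V) :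
    1 / (n:ℝ) ≤ Real.exp 1 / (n:ℝ) ^ (1 + 1 / V) := by
  have hn' : (0:ℝ) < n := by exact_mod_cast hn
  rw [Real.rpow_add hn', Real.rpow_one]
  have h1 : (n:ℝ) ^ (1 / V) ≤ Real.exp 1 := by
    rw [Real.rpow_def_of_pos hn']
    apply Real.exp_le_exp.2
    rw [mul_one_div, div_le_one hV]; exact h
  have h2 : (0:ℝ) < (n:ℝ) ^ (1 / V) := by positivity
  rw [div_le_div_iff₀ hn' (by positivity)]
  nlinarith

theorem sum_lam_le : ∃ C : ℝ, 0 ≤ C ∧ ∀ N : ℕ, 1 ≤ Real.log N →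
    ∑ n ∈ Finset.Icc 1 N, vonMangoldt n / n ≤ C * Real.log N := by
  obtain ⟨C, hC0, hC⟩ := lam_upper
  refine ⟨Real.exp 1 * (1 + C), by positivity, fun N hN => ?_⟩
  set V := Real.log N with hV
  have hV0 : 0 < V := by linarith
  obtain ⟨hs, hle⟩ := hC (1 + 1 / V) (by have : 0 < 1 / V := by positivity
                                         linarith) (by
      have : 1 / V ≤ 1 := by rw [div_le_one hV0]; exact hN
      linarith)
  have h1 : ∑ n ∈ Finset.Icc 1 N, vonMangoldt n / n ≤ ∑ n ∈ Finset.Icc 1 N, Real.exp 1 * (vonMangoldt n / (n:ℝ) ^ (1 + 1 / V)) := by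
    refine Finset.sum_le_sum fun n hn => ?_
    rw [Finset.mem_Icc] at hn
    have := inv_le_rpow hn.1 hV0 (Real.log_le_log (by exact_mod_cast hn.1) (by exact_mod_cast hn.2))
    have h2 := mul_le_mul_of_nonneg_left this (vonMangoldt_nonneg (n := n))
    calc vonMangoldt n / n = vonMangoldt n * (1 / n) := by ring
      _ ≤ _ := h2
      _ = _ := by ring
  rw [← Finset.mul_sum] at h1
  have h2 := hs.sum_le_tsum (Finset.Icc 1 N) (fun n _ => by
    have := vonMangoldt_nonneg (n := n); positivity)
  have h3 : 1 / (1 + 1 / V - 1) = V := by rw [add_sub_cancel_left, one_div_one_div]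
  rw [h3] at hle
  calc _ ≤ _ := h1
    _ ≤ Real.exp 1 * (V + C) := by gcongr; linarith
    _ ≤ Real.exp 1 * (1 + C) * V := by
      rw [mul_assoc]; gcongr; nlinarith

set_option maxHeartbeats 2000000 in
theorem primes_mid {q : ℕ} [NeZero q] {a : ZMod q} (ha : IsUnit a) :
    ∃ η c lam0 : ℝ, 0 < η ∧ η < 1 / 2 ∧ 0 < c ∧ 1 ≤ lam0 ∧ ∀ N : ℕ, lam0 ≤ Real.log N →
      c * Real.log N ≤ ∑ n ∈ (Finset.Icc 1 N).filter (fun n : ℕ => n.Prime ∧ (n : ZMod q) = a ∧ η * Real.log N ≤ Real.log n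
        ∧ Real.log n ≤ Real.log N / 2), Real.log n / n := by
  classical
  obtain ⟨C, hC0, hC⟩ := lam_upper
  obtain ⟨C1, hC1⟩ := LSeries_residueClass_lower_bound ha
  set φ : ℝ := (q.totient : ℝ)⁻¹ with hφ
  have hφ0 : 0 < φ := by
    have := Nat.totient_pos.mpr q.pos_of_neZero
    rw [hφ]; positivity
  have hnp := summable_residueClass_non_primes_div a
  set Cnp := ∑' n : ℕ, (if n.Prime then 0 else residueClass a n) / (n:ℝ) with hCnp
  -- choose K
  obtain ⟨K, hK1, hK2, hK3⟩ : ∃ K : ℝ, 2 ≤ K ∧ Real.exp 1 / K ≤ φ / 8 ∧ 2 * Real.exp (-(K / 2)) ≤ φ / 8 := by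
    have t1 : Tendsto (fun K : ℝ => Real.exp 1 / K) atTop (𝓝 0) := tendsto_const_nhds.div_atTop tendsto_id
    have t2 : Tendsto (fun K : ℝ => 2 * Real.exp (-(K / 2))) atTop (𝓝 0) := by
      have : Tendsto (fun K : ℝ => K / 2) atTop atTop := tendsto_id.atTop_div_const (by norm_num)
      have := (Real.tendsto_exp_neg_atTop_nhds_zero.comp this).const_mul 2
      simpa using this
    have e := ((eventually_ge_atTop (2:ℝ)).and ((t1.eventually_le_const (by positivity : (0:ℝ) < φ / 8)).and (t2.eventually_le_const (by positivity : (0:ℝ) < φ / 8)))).exists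
    obtain ⟨K, h1, h2, h3⟩ := e
    exact ⟨K, h1, h2, h3⟩
  have hK0 : 0 < K := by linarith
  set CC := |C1| + Real.exp 1 * C + C + Cnp with hCC
  refine ⟨1 / (2 * K ^ 2), φ / (8 * K), max (2 * K ^ 2) (8 * K / φ * |CC|), by positivity, ?_, by positivity, ?_, ?_⟩
  · rw [div_lt_div_iff₀ (by positivity) (by norm_num)]; nlinarith
  · refine le_trans ?_ (le_max_left _ _); nlinarith
  intro N hN
  set lam := Real.log N with hlam
  have hl1 : 2 * K ^ 2 ≤ lam := (le_max_left _ _).trans hN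
  have hl2 : 8 * K / φ * |CC| ≤ lam := (le_max_right _ _).trans hN
  set V := lam / (2 * K) with hV
  have hVK : K ≤ V := by rw [hV, le_div_iff₀ (by positivity)]; nlinarith
  have hV0 : 0 < V := by linarith
  have hlamV : lam = 2 * K * V := by rw [hV]; field_simp
  set S := (Finset.Icc 1 N).filter (fun n : ℕ => n.Prime ∧ (n : ZMod q) = a ∧ 1 / (2 * K ^ 2) * lam ≤ Real.log n
        ∧ Real.log n ≤ lam / 2) with hS
  have hx : (1 + 1 / V) ∈ Set.Ioc (1:ℝ) 2 := by
    have h1 : 0 < 1 / V := by positivity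
    have h2 : 1 / V ≤ 1 := by rw [div_le_one hV0]; linarith
    constructor <;> linarith
  have hx1 : (1 + 1 / (V / K)) ∈ Set.Ioc (1:ℝ) 2 := by
    have h1 : 0 < 1 / (V / K) := by positivity
    have h2 : 1 / (V / K) ≤ 1 := by rw [div_le_one (by positivity), le_div_iff₀ hK0]; linarith
    constructor <;> linarith
  have hx2 : (1 + 1 / (2 * V)) ∈ Set.Ioc (1:ℝ) 2 := by
    have h1 : 0 < 1 / (2 * V) := by positivity
    have h2 : 1 / (2 * V) ≤ 1 := by rw [div_le_one (by positivity)]; linarith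
    constructor <;> linarith
  have hlow := hC1 hx
  obtain ⟨hs1, hle1⟩ := hC _ hx1.1 hx1.2
  obtain ⟨hs2, hle2⟩ := hC _ hx2.1 hx2.2
  have hmid : Summable (fun n : ℕ => if n ∈ S then Real.log n / (n:ℝ) else 0) :=
    summable_of_ne_finset_zero (s := S) (fun n hn => by simp [hn])
  have hmids : ∑' n : ℕ, (if n ∈ S then Real.log n / (n:ℝ) else 0) = ∑ n ∈ S, Real.log n / (n:ℝ) := by
    rw [tsum_eq_sum (s := S) (fun n hn => by simp [hn])]
    exact Finset.sum_congr rfl fun n hn => by simp [hn]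
  have hpt : ∀ n : ℕ, residueClass a n / (n:ℝ) ^ (1 + 1 / V) ≤
      Real.exp 1 * (vonMangoldt n / (n:ℝ) ^ (1 + 1 / (V / K))) + Real.exp (-(K / 2)) * (vonMangoldt n / (n:ℝ) ^ (1 + 1 / (2 * V)))
       + (if n.Prime then 0 else residueClass a n) / (n:ℝ) + (if n ∈ S then Real.log n / (n:ℝ) else 0) := by
    intro n
    have hL0 := vonMangoldt_nonneg (n := n)
    have hr0 := residueClass_nonneg a n
    have hrL := residueClass_le a n
    have p1 : 0 ≤ Real.exp 1 * (vonMangoldt n / (n:ℝ) ^ (1 + 1 / (V / K))) := by positivity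
    have p2 : 0 ≤ Real.exp (-(K / 2)) * (vonMangoldt n / (n:ℝ) ^ (1 + 1 / (2 * V))) := by positivity
    have p3 : 0 ≤ (if n.Prime then 0 else residueClass a n) / (n:ℝ) := by
      split_ifs <;> positivity
    have p4 : 0 ≤ (if n ∈ S then Real.log n / (n:ℝ) else 0) := by
      split_ifs
      · exact div_nonneg (Real.log_natCast_nonneg n) (by positivity)
      · exact le_rfl
    rcases Nat.eq_zero_or_pos n with rfl | hn
    · have : residueClass a 0 = 0 := residueClass_apply_zero a
      have h0 : residueClass a 0 / ((0:ℕ):ℝ) ^ (1 + 1 / V) = 0 := by rw [this, zero_div]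
      rw [h0]; exact add_nonneg (add_nonneg (add_nonneg p1 p2) p3) p4
    have hn' : (0:ℝ) < n := by exact_mod_cast hn
    have hn1 : (1:ℝ) ≤ n := by exact_mod_cast hn
    have hle : residueClass a n / (n:ℝ) ^ (1 + 1 / V) ≤ residueClass a n / n := by
      apply div_le_div_of_nonneg_left hr0 hn'
      calc (n:ℝ) = (n:ℝ) ^ (1:ℝ) := (Real.rpow_one _).symm
        _ ≤ _ := Real.rpow_le_rpow_of_exponent_le hn1 hx.1.le
    by_cases c1 : Real.log n < V / K
    · have h1 := inv_le_rpow hn (by positivity : 0 < V / K) c1.le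
      have h2 : residueClass a n / n ≤ Real.exp 1 * (vonMangoldt n / (n:ℝ) ^ (1 + 1 / (V / K))) := by
        calc residueClass a n / n = residueClass a n * (1 / n) := by ring
          _ ≤ vonMangoldt n * (Real.exp 1 / (n:ℝ) ^ (1 + 1 / (V / K))) := by gcongr
          _ = _ := by ring
      linarith
    by_cases c2 : K * V < Real.log n
    · have h2 : residueClass a n / (n:ℝ) ^ (1 + 1 / V) ≤ Real.exp (-(K / 2)) * (vonMangoldt n / (n:ℝ) ^ (1 + 1 / (2 * V))) := by
        have e1 : 1 + 1 / V = (1 + 1 / (2 * V)) + 1 / (2 * V) := by field_simp; ring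
        rw [e1, Real.rpow_add hn']
        have e2 : Real.exp (K / 2) ≤ (n:ℝ) ^ (1 / (2 * V)) := by
          rw [Real.rpow_def_of_pos hn']
          apply Real.exp_le_exp.2
          rw [mul_one_div, div_le_div_iff₀ (by norm_num) (by positivity)]
          nlinarith
        rw [Real.exp_neg]
        calc residueClass a n / ((n:ℝ) ^ (1 + 1 / (2 * V)) * (n:ℝ) ^ (1 / (2 * V))) ≤ vonMangoldt n / ((n:ℝ) ^ (1 + 1 / (2 * V)) * Real.exp (K / 2)) := by gcongr
          _ = _ := by field_simp
      linarith
    by_cases c3 : n.Prime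
    · by_cases c4 : (n : ZMod q) = a
      · have hmem : n ∈ S := by
          rw [hS, Finset.mem_filter, Finset.mem_Icc]
          have q1 : Real.log n ≤ lam / 2 := by rw [hlamV]; push Not at c2; linarith
          refine ⟨⟨hn, ?_⟩, c3, c4, ?_, q1⟩
          · have : Real.log n ≤ Real.log N := by rw [← hlam]; nlinarith
            have hN0 : (0:ℝ) < N := by
              by_contra hcon
              have : (N:ℝ) = 0 := le_antisymm (not_lt.1 hcon) (by positivity)
              rw [hlam, this, Real.log_zero] at hl1
              nlinarith
            exact_mod_cast (Real.log_le_log_iff hn' hN0).1 this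
          · push Not at c1
            refine le_trans (le_of_eq ?_) c1
            rw [hlamV]; field_simp
        rw [if_pos hmem]
        have : residueClass a n ≤ Real.log n := hrL.trans vonMangoldt_le_log
        have : residueClass a n / n ≤ Real.log n / n := by gcongr
        linarith
      · have : residueClass a n = 0 := by
          unfold residueClass
          exact Set.indicator_of_notMem (s := {n : ℕ | (n : ZMod q) = a}) c4 _
        have h0 : residueClass a n / (n:ℝ) ^ (1 + 1 / V) = 0 := by rw [this, zero_div]
        rw [h0]; exact add_nonneg (add_nonneg (add_nonneg p1 p2) p3) p4
    · have : (if n.Prime then 0 else residueClass a n) / (n:ℝ) = residueClass a n / n := by rw [if_neg c3]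
      linarith
  have hsum := (resid_summable a hx.1).tsum_le_tsum hpt ((((hs1.mul_left _).add (hs2.mul_left _)).add hnp).add hmid)
  rw [Summable.tsum_add (((hs1.mul_left _).add (hs2.mul_left _)).add hnp) hmid, Summable.tsum_add ((hs1.mul_left _).add (hs2.mul_left _)) hnp,
    Summable.tsum_add (hs1.mul_left _) (hs2.mul_left _), tsum_mul_left, tsum_mul_left, hmids, ← hCnp] at hsum
  have e1 : φ / (1 + 1 / V - 1) = φ * V := by rw [add_sub_cancel_left]; field_simp
  have e2 : 1 / (1 + 1 / (V / K) - 1) = V / K := by rw [add_sub_cancel_left, one_div_one_div]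
  have e3 : 1 / (1 + 1 / (2 * V) - 1) = 2 * V := by rw [add_sub_cancel_left, one_div_one_div]
  rw [e1] at hlow
  rw [e2] at hle1
  rw [e3] at hle2
  have f1 : Real.exp 1 * ∑' n : ℕ, vonMangoldt n / (n:ℝ) ^ (1 + 1 / (V / K)) ≤ φ / 8 * V + Real.exp 1 * C := by
    calc _ ≤ Real.exp 1 * (V / K + C) := by gcongr
      _ = Real.exp 1 / K * V + Real.exp 1 * C := by ring
      _ ≤ _ := by gcongr
  have f2 : Real.exp (-(K / 2)) * ∑' n : ℕ, vonMangoldt n / (n:ℝ) ^ (1 + 1 / (2 * V)) ≤ φ / 8 * V + C := by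
    have g1 : Real.exp (-(K / 2)) ≤ 1 := by
      rw [Real.exp_le_one_iff]; linarith
    calc _ ≤ Real.exp (-(K / 2)) * (2 * V + C) := by gcongr
      _ = 2 * Real.exp (-(K / 2)) * V + Real.exp (-(K / 2)) * C := by ring
      _ ≤ φ / 8 * V + 1 * C := by gcongr
      _ = _ := by ring
  have g2 : C1 ≤ |C1| := le_abs_self _
  have g3 : φ * V * (3 / 4) - CC ≤ ∑ n ∈ S, Real.log n / (n:ℝ) := by
    linarith
  have g4 : CC ≤ φ / 4 * V := by
    refine (le_abs_self CC).trans ?_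
    have : 8 * K / φ * |CC| ≤ 2 * K * V := by rw [← hlamV]; exact hl2
    rw [div_mul_eq_mul_div, div_le_iff₀ hφ0] at this
    have : K * (8 * |CC|) ≤ K * (2 * V * φ) := by linarith
    have := le_of_mul_le_mul_left this hK0
    linarith
  calc φ / (8 * K) * lam = φ / 4 * V := by rw [hlamV]; field_simp; ring
    _ ≤ _ := by nlinarith
end DZ

namespace DZ
open ArithmeticFunction ArithmeticFunction.vonMangoldt

noncomputable def cf (a : ℕ → ℂ) (n : ℕ) : ℂ := ((vonMangoldt n / Real.sqrt n : ℝ) : ℂ) * a n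

theorem norm_cf (a : ℕ → ℂ) (n : ℕ) : ‖cf a n‖ = vonMangoldt n / Real.sqrt n * ‖a n‖ := by
  unfold cf
  rw [norm_mul, Complex.norm_real, Real.norm_of_nonneg]
  have := vonMangoldt_nonneg (n := n); positivity

theorem sum_norm_cf (a : ℕ → ℂ) (A0 : ℝ) (ha : ∀ n, ‖a n‖ ≤ A0) (N : ℕ) :
    ∑ n ∈ Finset.Icc 1 N, ‖cf a n‖ ≤ A0 * (N:ℝ) ^ 2 := by
  have hA : 0 ≤ A0 := (norm_nonneg _).trans (ha 0)
  have : ∀ n ∈ Finset.Icc 1 N, ‖cf a n‖ ≤ A0 * N := by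
    intro n hn
    rw [Finset.mem_Icc] at hn
    have hn1 : (1:ℝ) ≤ n := by exact_mod_cast hn.1
    rw [norm_cf, mul_comm]
    have h1 : vonMangoldt n / Real.sqrt n ≤ N := by
      have h2 : vonMangoldt n ≤ N := vonMangoldt_le_log.trans ((Real.log_le_self (by positivity)).trans (by exact_mod_cast hn.2))
      have h3 : 1 ≤ Real.sqrt n := by rw [Real.one_le_sqrt]; exact hn1
      exact (div_le_self vonMangoldt_nonneg h3).trans h2
    have h0 : 0 ≤ vonMangoldt n / Real.sqrt n := by
      have := vonMangoldt_nonneg (n := n); positivity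
    exact mul_le_mul (ha n) h1 h0 hA
  refine (Finset.sum_le_sum this).trans (le_of_eq ?_)
  simp; ring

theorem diag4 (N : ℕ) (x : ℕ × ℕ) (hx : x ∈ Finset.Icc 1 N ×ˢ Finset.Icc 1 N) :
    ∑ y ∈ Finset.Icc 1 N ×ˢ Finset.Icc 1 N, (if x.1 * x.2 = y.1 * y.2 then vonMangoldt y.1 * vonMangoldt y.2 else 0)
      ≤ 4 * Real.log N ^ 2 := by
  rw [Finset.mem_product, Finset.mem_Icc, Finset.mem_Icc] at hx
  set M := x.1 * x.2 with hM
  have hM0 : M ≠ 0 := Nat.mul_ne_zero (by omega) (by omega)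
  rw [← Finset.sum_filter]
  have hsub : (Finset.Icc 1 N ×ˢ Finset.Icc 1 N).filter (fun y => M = y.1 * y.2) ⊆ M.divisorsAntidiagonal := by
    intro y hy
    rw [Finset.mem_filter] at hy
    rw [Nat.mem_divisorsAntidiagonal]
    exact ⟨hy.2.symm, hM0⟩
  have h1 := Finset.sum_le_sum_of_subset_of_nonneg hsub (f := fun y => vonMangoldt y.1 * vonMangoldt y.2)
    (fun y _ _ => mul_nonneg vonMangoldt_nonneg vonMangoldt_nonneg)
  refine h1.trans ?_
  have hlogM : Real.log M ≤ 2 * Real.log N := by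
    have h1 : (0:ℝ) < x.1 := by exact_mod_cast hx.1.1
    have h2 : (0:ℝ) < x.2 := by exact_mod_cast hx.2.1
    rw [hM]; push_cast
    rw [Real.log_mul h1.ne' h2.ne']
    have := Real.log_le_log h1 (by exact_mod_cast hx.1.2 : (x.1:ℝ) ≤ N)
    have := Real.log_le_log h2 (by exact_mod_cast hx.2.2 : (x.2:ℝ) ≤ N)
    linarith
  have hlogM0 : 0 ≤ Real.log M := Real.log_natCast_nonneg _
  have h2 : ∑ y ∈ M.divisorsAntidiagonal, vonMangoldt y.1 * vonMangoldt y.2 ≤ ∑ y ∈ M.divisorsAntidiagonal, vonMangoldt y.1 * Real.log M := by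
    refine Finset.sum_le_sum fun y hy => mul_le_mul_of_nonneg_left ?_ vonMangoldt_nonneg
    rw [Nat.mem_divisorsAntidiagonal] at hy
    refine vonMangoldt_le_log.trans ?_
    have hy2 : y.2 ≠ 0 := by rintro h; rw [h, mul_zero] at hy; exact hy.2 hy.1.symm
    apply Real.log_le_log (by exact_mod_cast Nat.pos_of_ne_zero hy2)
    exact_mod_cast Nat.le_of_dvd (Nat.pos_of_ne_zero hM0) ⟨y.1, by rw [mul_comm, hy.1]⟩
  refine h2.trans ?_
  rw [← Finset.sum_mul, Nat.sum_divisorsAntidiagonal (f := fun a _ => vonMangoldt a), vonMangoldt_sum]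
  nlinarith

theorem fourth (a : ℕ → ℂ) (A0 : ℝ) (ha : ∀ n, ‖a n‖ ≤ A0) : ∃ C : ℝ, 0 ≤ C ∧ ∀ N : ℕ, 1 ≤ Real.log N →
    ∀ x y : ℝ, x ≤ y → ∫ t in x..y, ‖Gs N (cf a) t‖ ^ 4 ≤ C * ((y - x) * Real.log N ^ 4 + (N:ℝ) ^ 10) := by
  obtain ⟨C, hC0, hC⟩ := sum_lam_le
  have hA : 0 ≤ A0 := (norm_nonneg _).trans (ha 0)
  refine ⟨A0 ^ 4 * (4 * C ^ 2 + 2), by positivity, fun N hN x y hxy => ?_⟩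
  have hN1 : 1 ≤ N := by
    rcases Nat.eq_zero_or_pos N with h | h
    · subst h; norm_num at hN
    · exact h
  refine (mv4 N hN1 (cf a) x y hxy).trans ?_
  have h1 := sum_norm_cf a A0 ha N
  have h2 : (∑ n ∈ Finset.Icc 1 N, ‖cf a n‖) ^ 4 ≤ (A0 * (N:ℝ) ^ 2) ^ 4 := by
    gcongr
  have hd : ∀ p ∈ Finset.Icc 1 N ×ˢ Finset.Icc 1 N, ∑ r ∈ Finset.Icc 1 N ×ˢ Finset.Icc 1 N,
      (if p.1 * p.2 = r.1 * r.2 then ‖cf a p.1‖ * ‖cf a p.2‖ * (‖cf a r.1‖ * ‖cf a r.2‖) else 0)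
      ≤ A0 ^ 4 * (4 * Real.log N ^ 2) * ((vonMangoldt p.1 / p.1) * (vonMangoldt p.2 / p.2)) := by
    intro p hp
    have hp' := hp
    rw [Finset.mem_product, Finset.mem_Icc, Finset.mem_Icc] at hp'
    have hb : ∀ n, ‖cf a n‖ ≤ A0 * (vonMangoldt n / Real.sqrt n) := by
      intro n; rw [norm_cf, mul_comm]
      have := vonMangoldt_nonneg (n := n)
      gcongr; exact ha n
    have hpos : ∀ n : ℕ, 0 ≤ vonMangoldt n / Real.sqrt n := fun n => by
      have := vonMangoldt_nonneg (n := n); positivity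
    have key : ∀ r ∈ Finset.Icc 1 N ×ˢ Finset.Icc 1 N, (if p.1 * p.2 = r.1 * r.2 then ‖cf a p.1‖ * ‖cf a p.2‖ * (‖cf a r.1‖ * ‖cf a r.2‖) else 0)
      ≤ A0 ^ 4 * ((vonMangoldt p.1 / p.1) * (vonMangoldt p.2 / p.2)) * (if p.1 * p.2 = r.1 * r.2 then vonMangoldt r.1 * vonMangoldt r.2 else 0) := by
      intro r hr
      split_ifs with heq
      · have e1 : ‖cf a p.1‖ * ‖cf a p.2‖ * (‖cf a r.1‖ * ‖cf a r.2‖) ≤ (A0 * (vonMangoldt p.1 / Real.sqrt p.1)) * (A0 * (vonMangoldt p.2 / Real.sqrt p.2)) *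
            ((A0 * (vonMangoldt r.1 / Real.sqrt r.1)) * (A0 * (vonMangoldt r.2 / Real.sqrt r.2))) := by
          have := hpos p.1; have := hpos p.2; have := hpos r.1; have := hpos r.2
          gcongr <;> apply hb
        refine e1.trans (le_of_eq ?_)
        have hr' := hr
        rw [Finset.mem_product, Finset.mem_Icc, Finset.mem_Icc] at hr'
        have e2 : Real.sqrt r.1 * Real.sqrt r.2 = Real.sqrt p.1 * Real.sqrt p.2 := by
          rw [← Real.sqrt_mul (by positivity), ← Real.sqrt_mul (by positivity)]
          congr 1
          exact_mod_cast heq.symm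
        have n1 : (0:ℝ) < p.1 := by exact_mod_cast hp'.1.1
        have n2 : (0:ℝ) < p.2 := by exact_mod_cast hp'.2.1
        have n3 : (0:ℝ) < r.1 := by exact_mod_cast hr'.1.1
        have n4 : (0:ℝ) < r.2 := by exact_mod_cast hr'.2.1
        have e3 : Real.sqrt p.1 * Real.sqrt p.1 = p.1 := Real.mul_self_sqrt n1.le
        have e4 : Real.sqrt p.2 * Real.sqrt p.2 = p.2 := Real.mul_self_sqrt n2.le
        calc _ = A0 ^ 4 * (vonMangoldt p.1 * vonMangoldt p.2 * vonMangoldt r.1 * vonMangoldt r.2) / ((Real.sqrt p.1 * Real.sqrt p.2) * (Real.sqrt r.1 * Real.sqrt r.2)) := by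
              field_simp
          _ = A0 ^ 4 * (vonMangoldt p.1 * vonMangoldt p.2 * vonMangoldt r.1 * vonMangoldt r.2) / ((Real.sqrt p.1 * Real.sqrt p.1) * (Real.sqrt p.2 * Real.sqrt p.2)) := by
              rw [e2]; ring_nf
          _ = _ := by rw [e3, e4]; field_simp
      · simp
    refine (Finset.sum_le_sum key).trans ?_
    rw [← Finset.mul_sum]
    have h5 := diag4 N p hp
    have h6 : 0 ≤ A0 ^ 4 * ((vonMangoldt p.1 / p.1) * (vonMangoldt p.2 / p.2)) := by
      have := vonMangoldt_nonneg (n := p.1); have := vonMangoldt_nonneg (n := p.2); positivity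
    refine (mul_le_mul_of_nonneg_left h5 h6).trans (le_of_eq ?_)
    ring
  have h3 := Finset.sum_le_sum hd
  have h4 : ∑ i ∈ Finset.Icc 1 N ×ˢ Finset.Icc 1 N, (vonMangoldt i.1 / (i.1:ℝ)) * (vonMangoldt i.2 / (i.2:ℝ)) = (∑ u ∈ Finset.Icc 1 N, vonMangoldt u / (u:ℝ)) ^ 2 := by
    rw [sq, Finset.sum_mul_sum, Finset.sum_product]
  rw [← Finset.mul_sum, h4] at h3
  have h5 : (∑ u ∈ Finset.Icc 1 N, vonMangoldt u / (u:ℝ)) ^ 2 ≤ (C * Real.log N) ^ 2 := by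
    have : 0 ≤ ∑ u ∈ Finset.Icc 1 N, vonMangoldt u / (u:ℝ) := Finset.sum_nonneg fun u _ => by
      have := vonMangoldt_nonneg (n := u); positivity
    gcongr
    exact hC N hN
  have h6 := h3.trans (mul_le_mul_of_nonneg_left h5 (by positivity))
  have h7 := mul_le_mul_of_nonneg_left h6 (sub_nonneg.2 hxy)
  have h8 : 2 * (N:ℝ) ^ 2 * (∑ n ∈ Finset.Icc 1 N, ‖cf a n‖) ^ 4 ≤ 2 * (N:ℝ) ^ 2 * (A0 * (N:ℝ) ^ 2) ^ 4 := by gcongr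
  refine (add_le_add h7 h8).trans ?_
  have h9 : 0 ≤ (y - x) * Real.log N ^ 4 := mul_nonneg (sub_nonneg.2 hxy) (by positivity)
  have h10 : 0 ≤ (N:ℝ) ^ 10 := by positivity
  have h11 : 0 ≤ A0 ^ 4 * 4 * C ^ 2 := by positivity
  have h12 : 0 ≤ A0 ^ 4 * 2 := by positivity
  have e : (y - x) * (A0 ^ 4 * (4 * Real.log N ^ 2) * (C * Real.log N) ^ 2) + 2 * (N:ℝ) ^ 2 * (A0 * (N:ℝ) ^ 2) ^ 4
    = (A0 ^ 4 * 4 * C ^ 2) * ((y - x) * Real.log N ^ 4) + (A0 ^ 4 * 2) * (N:ℝ) ^ 10 := by ring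
  rw [e]
  nlinarith [mul_nonneg h11 h10, mul_nonneg h12 h9]

theorem second (a : ℕ → ℂ) (A0 : ℝ) (ha : ∀ n, ‖a n‖ ≤ A0) (q : ℕ) [NeZero q] (r : ZMod q) (hr : IsUnit r)
    (κ : ℝ) (hκ : 0 < κ) (har : ∀ n : ℕ, (n : ZMod q) = r → κ ≤ ‖a n‖) :
    ∃ c C lam0 : ℝ, 0 < c ∧ 0 ≤ C ∧ 1 ≤ lam0 ∧ ∀ N : ℕ, lam0 ≤ Real.log N →
    ∀ x y : ℝ, x ≤ y → c * ((y - x) * Real.log N ^ 2) - C * (N:ℝ) ^ 5 ≤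
      ∫ t in x..y, ‖Gs N (cf a) t - Gs N (cf a) (t + 2 * Real.pi / Real.log N)‖ ^ 2 := by
  obtain ⟨η, c, lam0, hη0, hη1, hc, hl0, h⟩ := primes_mid hr
  have hA : 0 ≤ A0 := (norm_nonneg _).trans (ha 0)
  refine ⟨16 * κ ^ 2 * η ^ 3 * c, 8 * A0 ^ 2, lam0, by positivity, by positivity, hl0, fun N hN x y hxy => ?_⟩
  have hN1 : 1 ≤ N := by
    rcases Nat.eq_zero_or_pos N with h | h
    · subst h; norm_num at hN; linarith
    · exact h
  set lam := Real.log N with hlam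
  have hlam0 : 0 < lam := by linarith
  simp only [Gs_shift]
  set d : ℕ → ℂ := fun n => cf a n * (1 - Complex.exp (-(Real.log n * (2 * Real.pi / lam : ℝ)) * Complex.I)) with hd
  have hexp : ∀ n : ℕ, ‖1 - Complex.exp (-(Real.log n * (2 * Real.pi / lam : ℝ)) * Complex.I)‖ = ‖2 * Real.sin (Real.log n * (2 * Real.pi / lam) / 2)‖ := by
    intro n
    rw [norm_sub_rev]
    have := Complex.norm_exp_I_mul_ofReal_sub_one (-(Real.log n * (2 * Real.pi / lam)))
    rw [show -(Real.log n * (2 * Real.pi / lam)) / 2 = -(Real.log n * (2 * Real.pi / lam) / 2) by ring, Real.sin_neg, mul_neg, norm_neg] at this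
    rw [← this]
    congr 3
    push_cast; ring
  refine le_trans ?_ (mv2 N hN1 d x y)
  have h1 : ∑ n ∈ Finset.Icc 1 N, ‖d n‖ ≤ 2 * (A0 * (N:ℝ) ^ 2) := by
    calc ∑ n ∈ Finset.Icc 1 N, ‖d n‖ ≤ ∑ n ∈ Finset.Icc 1 N, 2 * ‖cf a n‖ := by
          refine Finset.sum_le_sum fun n _ => ?_
          rw [hd]; dsimp only
          rw [norm_mul, hexp, mul_comm]
          gcongr
          rw [Real.norm_eq_abs, abs_mul, abs_two]
          have := Real.abs_sin_le_one (Real.log n * (2 * Real.pi / lam) / 2)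
          linarith
      _ = 2 * ∑ n ∈ Finset.Icc 1 N, ‖cf a n‖ := by rw [Finset.mul_sum]
      _ ≤ _ := by gcongr; exact sum_norm_cf a A0 ha N
  have h2 : 2 * (N:ℝ) * (∑ n ∈ Finset.Icc 1 N, ‖d n‖) ^ 2 ≤ 2 * (N:ℝ) * (2 * (A0 * (N:ℝ) ^ 2)) ^ 2 := by
    gcongr
  have h3 : 16 * κ ^ 2 * η ^ 3 * c * lam ^ 2 ≤ ∑ n ∈ Finset.Icc 1 N, ‖d n‖ ^ 2 := by
    have h4 := h N hN
    set S := (Finset.Icc 1 N).filter (fun n : ℕ => n.Prime ∧ (n : ZMod q) = r ∧ η * lam ≤ Real.log n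
        ∧ Real.log n ≤ lam / 2) with hS
    have h5 : ∑ n ∈ S, ‖d n‖ ^ 2 ≤ ∑ n ∈ Finset.Icc 1 N, ‖d n‖ ^ 2 :=
      Finset.sum_le_sum_of_subset_of_nonneg (Finset.filter_subset _ _) (fun n _ _ => by positivity)
    refine le_trans ?_ h5
    have h6 : ∀ n ∈ S, 16 * κ ^ 2 * η ^ 3 * lam * (Real.log n / n) ≤ ‖d n‖ ^ 2 := by
      intro n hn
      rw [hS, Finset.mem_filter, Finset.mem_Icc] at hn
      obtain ⟨⟨hn1, hn2⟩, hp, hnr, hlo, hhi⟩ := hn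
      have hn0 : (0:ℝ) < n := by exact_mod_cast hn1
      have hlogn : 0 ≤ Real.log n := Real.log_natCast_nonneg n
      have hsin : 2 * η ≤ Real.sin (Real.log n * (2 * Real.pi / lam) / 2) := by
        have e0 : Real.log n * (2 * Real.pi / lam) / 2 = Real.pi * (Real.log n / lam) := by ring
        rw [e0]
        have e1 : η ≤ Real.log n / lam := by rw [le_div_iff₀ hlam0]; exact hlo
        have e2 : Real.log n / lam ≤ 1 / 2 := by rw [div_le_iff₀ hlam0]; linarith
        have := Real.mul_le_sin (x := Real.pi * (Real.log n / lam)) (by positivity) (by nlinarith [Real.pi_pos])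
        refine le_trans ?_ this
        have : 2 / Real.pi * (Real.pi * (Real.log n / lam)) = 2 * (Real.log n / lam) := by
          field_simp
        rw [this]; linarith
      have hdn : ‖d n‖ ^ 2 = (Real.log n) ^ 2 / n * ‖a n‖ ^ 2 * (2 * Real.sin (Real.log n * (2 * Real.pi / lam) / 2)) ^ 2 := by
        rw [hd]; dsimp only
        rw [norm_mul, hexp, norm_cf, vonMangoldt_apply_prime hp, mul_pow, mul_pow, div_pow, Real.sq_sqrt hn0.le, Real.norm_eq_abs, sq_abs]
      rw [hdn]
      have hκa := har n hnr
      have q1 : (η * lam) * Real.log n / n ≤ (Real.log n) ^ 2 / n := by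
        rw [sq]; gcongr
      have q2 : (2 * (2 * η)) ^ 2 ≤ (2 * Real.sin (Real.log n * (2 * Real.pi / lam) / 2)) ^ 2 := by gcongr
      calc 16 * κ ^ 2 * η ^ 3 * lam * (Real.log n / n) = (η * lam) * Real.log n / n * κ ^ 2 * (2 * (2 * η)) ^ 2 := by ring
        _ ≤ _ := by gcongr
    have h7 := Finset.sum_le_sum h6
    rw [← Finset.mul_sum] at h7
    refine le_trans ?_ h7
    calc 16 * κ ^ 2 * η ^ 3 * c * lam ^ 2 = 16 * κ ^ 2 * η ^ 3 * lam * (c * lam) := by ring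
      _ ≤ _ := by gcongr
  have h8 := mul_le_mul_of_nonneg_left h3 (sub_nonneg.2 hxy)
  have e : 8 * A0 ^ 2 * (N:ℝ) ^ 5 = 2 * (N:ℝ) * (2 * (A0 * (N:ℝ) ^ 2)) ^ 2 := by ring
  rw [e]
  linarith
end DZ

namespace DZ

theorem lift_ne (x y : Σ n : ℕ, DirichletCharacter ℂ n) (hx : x.2.IsPrimitive) (hy : y.2.IsPrimitive)
    (hxy : x ≠ y) (q : ℕ) [NeZero q] (h1 : x.1 ∣ q) (h2 : y.1 ∣ q) :
    DirichletCharacter.changeLevel h1 x.2 ≠ DirichletCharacter.changeLevel h2 y.2 := by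
  intro h
  have hc := congrArg DirichletCharacter.conductor h
  rw [DirichletCharacter.conductor_changeLevel, DirichletCharacter.conductor_changeLevel] at hc
  rw [DirichletCharacter.IsPrimitive] at hx hy
  rw [hx, hy] at hc
  obtain ⟨n, χ⟩ := x
  obtain ⟨k, ψ⟩ := y
  dsimp at hc
  subst hc
  have e : χ = ψ := DirichletCharacter.changeLevel_injective h1 h
  exact hxy (by rw [e])

theorem char_fact (m : ℕ) (hm : 1 ≤ m)
    (χ₁ χ₂ : Fin m → Σ n : ℕ, DirichletCharacter ℂ n)
    (hmod₁ : ∀ i, (χ₁ i).1 ≠ 0) (hmod₂ : ∀ i, (χ₂ i).1 ≠ 0)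
    (hprim₁ : ∀ i, (χ₁ i).2.IsPrimitive) (hprim₂ : ∀ i, (χ₂ i).2.IsPrimitive)
    (hne : ∀ i j, χ₁ i ≠ χ₂ j) :
    ∃ (q : ℕ) (_ : NeZero q) (r : ZMod q) (κ : ℝ), IsUnit r ∧ 0 < κ ∧
      ∀ n : ℕ, (n : ZMod q) = r → κ ≤ ‖∑ i, ((χ₁ i).2 (n : ZMod (χ₁ i).1) - (χ₂ i).2 (n : ZMod (χ₂ i).1))‖ := by
  classical
  let q := (∏ i, (χ₁ i).1) * ∏ i, (χ₂ i).1
  have hq : q ≠ 0 := mul_ne_zero (Finset.prod_ne_zero_iff.2 fun i _ => hmod₁ i) (Finset.prod_ne_zero_iff.2 fun i _ => hmod₂ i)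
  haveI : NeZero q := ⟨hq⟩
  have d1 : ∀ i, (χ₁ i).1 ∣ q := fun i => (Finset.dvd_prod_of_mem (fun i => (χ₁ i).1) (Finset.mem_univ i)).trans (dvd_mul_right _ _)
  have d2 : ∀ i, (χ₂ i).1 ∣ q := fun i => (Finset.dvd_prod_of_mem (fun i => (χ₂ i).1) (Finset.mem_univ i)).trans (dvd_mul_left _ _)
  let ψ₁ : Fin m → DirichletCharacter ℂ q := fun i => DirichletCharacter.changeLevel (d1 i) (χ₁ i).2
  let ψ₂ : Fin m → DirichletCharacter ℂ q := fun i => DirichletCharacter.changeLevel (d2 i) (χ₂ i).2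
  have hψ : ∀ i j, ψ₁ i ≠ ψ₂ j := fun i j => lift_ne _ _ (hprim₁ i) (hprim₂ j) (hne i j) q _ _
  let i0 : Fin m := ⟨0, hm⟩
  have orth : ∀ φ : DirichletCharacter ℂ q, ∑ x, φ x * (ψ₁ i0)⁻¹ x = if φ = ψ₁ i0 then (Fintype.card (ZMod q)ˣ : ℂ) else 0 := by
    intro φ
    have : ∑ x, φ x * (ψ₁ i0)⁻¹ x = ∑ x, (φ * (ψ₁ i0)⁻¹) x := by simp
    rw [this]
    split_ifs with h
    · rw [h, mul_inv_cancel, MulChar.sum_one_eq_card_units]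
    · exact MulChar.sum_eq_zero_of_ne_one (fun h' => h (mul_inv_eq_one.1 h'))
  have hex : ∃ r : ZMod q, IsUnit r ∧ ∑ i, (ψ₁ i r - ψ₂ i r) ≠ 0 := by
    by_contra hcon
    push Not at hcon
    have h0 : ∀ x : ZMod q, ∑ i, (ψ₁ i x - ψ₂ i x) = 0 := by
      intro x
      by_cases hx : IsUnit x
      · exact hcon x hx
      · simp [MulChar.map_nonunit _ hx]
    have h1 : ∑ x, (∑ i, (ψ₁ i x - ψ₂ i x)) * (ψ₁ i0)⁻¹ x = 0 := by simp [h0]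
    simp_rw [Finset.sum_mul, sub_mul] at h1
    rw [Finset.sum_comm] at h1
    simp_rw [Finset.sum_sub_distrib] at h1
    simp_rw [orth] at h1
    have h2 : ∀ i, ψ₂ i ≠ ψ₁ i0 := fun i => (hψ i0 i).symm
    simp only [h2, if_false, Finset.sum_const_zero, sub_zero] at h1
    rw [← Finset.sum_filter, Finset.sum_const, nsmul_eq_mul] at h1
    rcases mul_eq_zero.1 h1 with h | h
    · rw [Nat.cast_eq_zero, Finset.card_eq_zero] at h
      have : i0 ∈ (Finset.univ.filter fun i => ψ₁ i = ψ₁ i0) := by simp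
      rw [h] at this; simp at this
    · have := Fintype.card_pos (α := (ZMod q)ˣ)
      rw [Nat.cast_eq_zero] at h; omega
  obtain ⟨r, hr, hr0⟩ := hex
  refine ⟨q, ⟨hq⟩, r, ‖∑ i, (ψ₁ i r - ψ₂ i r)‖, hr, norm_pos_iff.2 hr0, fun n hn => le_of_eq ?_⟩
  have hc : IsCoprime (n:ℤ) q := by
    rw [Nat.isCoprime_iff_coprime]
    rw [← hn] at hr
    exact (ZMod.isUnit_iff_coprime n q).1 hr
  congr 1
  refine Finset.sum_congr rfl fun i _ => ?_
  have e1 := DirichletCharacter.changeLevel_eq_cast_of_dvd' (χ₁ i).2 (d1 i) hc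
  have e2 := DirichletCharacter.changeLevel_eq_cast_of_dvd' (χ₂ i).2 (d2 i) hc
  rw [← hn]
  push_cast at e1 e2
  rw [← e1, ← e2]

end DZ

namespace DZ
open MeasureTheory

noncomputable def Q (lam : ℝ) (z : ℂ) : ℂ := dslope (fun z : ℂ => Complex.exp ((lam / 2 : ℝ) * z)) 0 z

theorem Q_diff (lam : ℝ) : Differentiable ℂ (Q lam) := by
  have h : DifferentiableOn ℂ (fun z : ℂ => Complex.exp ((lam / 2 : ℝ) * z)) Set.univ := by fun_prop
  have := (Complex.differentiableOn_dslope (c := 0) Filter.univ_mem).2 h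
  exact differentiableOn_univ.1 this

theorem Q_of_ne (lam : ℝ) {z : ℂ} (hz : z ≠ 0) : Q lam z = (Complex.exp ((lam / 2 : ℝ) * z) - 1) / z := by
  unfold Q
  rw [dslope_of_ne _ hz, slope_def_field]
  simp

theorem Q_norm (lam : ℝ) {z : ℂ} (hz : z ≠ 0) : ‖Q lam z‖ ≤ (Real.exp (lam / 2 * z.re) + 1) / ‖z‖ := by
  rw [Q_of_ne lam hz, norm_div]
  gcongr
  refine (norm_sub_le _ _).trans ?_
  rw [Complex.norm_exp]
  simp

/-- product of two kernels for half-odd separated points -/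
theorem QQ_eq (lam : ℝ) (hlam : 0 < lam) (al be : ℝ) (l : ℤ) (hab : al - be = 2 * Real.pi / lam * (2 * l - 1))
    (z : ℂ) (hz : z.re ≠ 0) : Q lam (z - al * Complex.I) * Q lam (z - be * Complex.I) =
      -(Complex.exp (lam * (z - al * Complex.I)) - 1) / ((z - al * Complex.I) * (z - be * Complex.I)) := by
  have h1 : z - al * Complex.I ≠ 0 := fun h => hz (by simpa using congrArg Complex.re h)
  have h2 : z - be * Complex.I ≠ 0 := fun h => hz (by simpa using congrArg Complex.re h)
  rw [Q_of_ne lam h1, Q_of_ne lam h2]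
  have e1 : Complex.exp ((lam / 2 : ℝ) * (z - be * Complex.I)) = - Complex.exp ((lam / 2 : ℝ) * (z - al * Complex.I)) := by
    have : ((lam / 2 : ℝ) : ℂ) * (z - be * Complex.I) = ((lam / 2 : ℝ) : ℂ) * (z - al * Complex.I) + (l * (2 * Real.pi * Complex.I) - Real.pi * Complex.I) := by
      have h3 : (lam / 2) * (al - be) = l * (2 * Real.pi) - Real.pi := by
        rw [hab]; field_simp
      have h4 : ((lam / 2 : ℝ) : ℂ) * (al - be) = l * (2 * Real.pi) - Real.pi := by exact_mod_cast h3
      linear_combination Complex.I * h4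
    rw [this, Complex.exp_add, Complex.exp_sub, Complex.exp_int_mul_two_pi_mul_I, Complex.exp_pi_mul_I]
    ring
  have e2 : Complex.exp (lam * (z - al * Complex.I)) = Complex.exp ((lam / 2 : ℝ) * (z - al * Complex.I)) ^ 2 := by
    rw [← Complex.exp_nat_mul]; congr 1; push_cast; ring
  rw [e1, e2]
  field_simp
  ring

noncomputable def kk (al be : ℝ) (v : ℝ) : ℂ :=
  (Complex.exp (-(v * be) * Complex.I) - Complex.exp (-(v * al) * Complex.I)) / (Complex.I * (al - be))

noncomputable def kap (N : ℕ) (al be : ℝ) (t : ℝ) : ℂ := kk al be (Real.log (max 1 (min t N)))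

theorem kap_cont (N : ℕ) (al be : ℝ) : Continuous (kap N al be) := by
  unfold kap
  have h1 : Continuous (kk al be) := by unfold kk; fun_prop
  refine h1.comp ?_
  refine Continuous.log (by fun_prop) fun x => ?_
  have : (1:ℝ) ≤ max 1 (min x N) := le_max_left _ _
  linarith

theorem kk_end (lam : ℝ) (hlam : 0 < lam) (al be : ℝ) (l : ℤ) (hab : al - be = 2 * Real.pi / lam * (2 * l - 1)) :
    kk al be lam = 0 := by
  unfold kk
  have : (-(lam * be) * Complex.I : ℂ) = -(lam * al) * Complex.I + ((2 * l - 1 : ℤ) : ℂ) * (2 * Real.pi * Complex.I) := by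
    have h3 : lam * (al - be) = (2 * l - 1) * (2 * Real.pi) := by
      rw [hab]; field_simp
    have h4 : (lam : ℂ) * (al - be) = (2 * l - 1) * (2 * Real.pi) := by exact_mod_cast h3
    push_cast
    linear_combination Complex.I * h4
  rw [this, Complex.exp_add, Complex.exp_int_mul_two_pi_mul_I]
  simp

theorem kap_out (N : ℕ) (hN : 2 ≤ N) (al be : ℝ) (l : ℤ) (hab : al - be = 2 * Real.pi / Real.log N * (2 * l - 1))
    (t : ℝ) (ht : t ∉ Set.Ioc (1:ℝ) N) : kap N al be t = 0 := by
  have hN' : (2:ℝ) ≤ N := by exact_mod_cast hN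
  unfold kap
  by_cases h : t ≤ 1
  · rw [min_eq_left (by linarith), max_eq_left h]
    simp [kk]
  · have : (N:ℝ) < t := by
      by_contra h'
      exact ht ⟨by linarith, by linarith⟩
    rw [min_eq_right this.le, max_eq_right (by linarith)]
    exact kk_end _ (Real.log_pos (by linarith)) al be l hab

theorem kap_in (N : ℕ) (al be : ℝ) (t : ℝ) (ht : t ∈ Set.Icc (1:ℝ) N) : kap N al be t = kk al be (Real.log t) := by
  unfold kap
  rw [min_eq_left ht.2, max_eq_right ht.1]

theorem mellin_kap (N : ℕ) (hN : 2 ≤ N) (al be : ℝ) (l : ℤ) (hab : al - be = 2 * Real.pi / Real.log N * (2 * l - 1))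
    (z : ℂ) (hz : 0 < z.re) : MellinConvergent (kap N al be) z ∧ mellin (kap N al be) z =
      Q (Real.log N) (z - al * Complex.I) * Q (Real.log N) (z - be * Complex.I) := by
  have hN' : (2:ℝ) ≤ N := by exact_mod_cast hN
  have hl : 0 < Real.log N := Real.log_pos (by linarith)
  have hab0 : (al - be : ℂ) ≠ 0 := by
    have : al - be ≠ 0 := by
      rw [hab]
      have : (2 * (l:ℝ) - 1) ≠ 0 := by
        intro h
        have : 2 * l - 1 = 0 := by exact_mod_cast h
        omega
      have := Real.pi_pos
      positivity
    exact_mod_cast this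
  have hind : ∀ t : ℝ, (t:ℂ) ^ (z - 1) • kap N al be t = (Set.Ioc (1:ℝ) N).indicator (fun t : ℝ => (t:ℂ) ^ (z - 1) • kap N al be t) t := by
    intro t
    by_cases ht : t ∈ Set.Ioc (1:ℝ) N
    · rw [Set.indicator_of_mem ht]
    · rw [Set.indicator_of_notMem ht, kap_out N hN al be l hab t ht, smul_zero]
  have hfun : (fun t : ℝ => (t:ℂ) ^ (z - 1) • kap N al be t) = (Set.Ioc (1:ℝ) N).indicator (fun t : ℝ => (t:ℂ) ^ (z - 1) • kap N al be t) := funext hind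
  have hci : ∀ w : ℂ, IntervalIntegrable (fun t : ℝ => (t:ℂ) ^ w) volume 1 N := fun w => by
    apply ContinuousOn.intervalIntegrable
    rw [Set.uIcc_of_le (by linarith)]
    intro t ht
    have : (t:ℂ) ∈ Complex.slitPlane := by left; simp; linarith [ht.1]
    exact ((Complex.continuous_ofReal.continuousAt).cpow continuousAt_const this).continuousWithinAt
  have hpt : ∀ t ∈ Set.uIcc (1:ℝ) N, (t:ℂ) ^ (z - 1) • kap N al be t =
      (1 / (Complex.I * (al - be))) * ((t:ℂ) ^ (z - be * Complex.I - 1) - (t:ℂ) ^ (z - al * Complex.I - 1)) := by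
    intro t ht
    rw [Set.uIcc_of_le (by linarith)] at ht
    rw [kap_in N al be t ht]
    have ht0 : (t:ℂ) ≠ 0 := by
      have : t ≠ 0 := by linarith [ht.1]
      exact_mod_cast this
    have e : ∀ b : ℝ, (t:ℂ) ^ (z - b * Complex.I - 1) = (t:ℂ) ^ (z - 1) * Complex.exp (-(Real.log t * b) * Complex.I) := by
      intro b
      rw [show z - b * Complex.I - 1 = (z - 1) + (-(b * Complex.I)) by ring, Complex.cpow_add _ _ ht0,
        Complex.cpow_def_of_ne_zero ht0 (-(b * Complex.I)), Complex.ofReal_log (by linarith [ht.1])]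
      congr 2; ring
    rw [e, e, kk, smul_eq_mul]
    ring
  constructor
  · rw [MellinConvergent, hfun]
    refine Integrable.integrableOn ?_
    rw [integrable_indicator_iff measurableSet_Ioc, ← intervalIntegrable_iff_integrableOn_Ioc_of_le (by linarith)]
    refine (((hci (z - be * Complex.I - 1)).sub (hci (z - al * Complex.I - 1))).const_mul (1 / (Complex.I * (al - be)))).congr ?_
    intro t ht
    exact (hpt t (Set.uIoc_subset_uIcc ht)).symm
  · rw [mellin, hfun, setIntegral_indicator measurableSet_Ioc,
      show Set.Ioi (0:ℝ) ∩ Set.Ioc (1:ℝ) N = Set.Ioc (1:ℝ) N from Set.inter_eq_right.2 fun t ht => by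
        simp only [Set.mem_Ioi]; linarith [ht.1], ← intervalIntegral.integral_of_le (by linarith),
      intervalIntegral.integral_congr hpt, intervalIntegral.integral_const_mul,
      intervalIntegral.integral_sub (hci _) (hci _), integral_cpow (Or.inl (by simp; linarith)), integral_cpow (Or.inl (by simp; linarith)),
      QQ_eq _ hl al be l hab z hz.ne']
    have hNc : ((N:ℝ):ℂ) ≠ 0 := by
      have : (N:ℝ) ≠ 0 := by linarith
      exact_mod_cast this
    have e : ∀ b : ℝ, ((N:ℝ):ℂ) ^ (z - b * Complex.I - 1 + 1) = Complex.exp (Real.log N * (z - b * Complex.I)) := by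
      intro b
      rw [Complex.cpow_def_of_ne_zero hNc, Complex.ofReal_log (by linarith)]
      congr 1; ring
    have e3 : Complex.exp (Real.log N * (z - be * Complex.I)) = Complex.exp (Real.log N * (z - al * Complex.I)) := by
      have : (Real.log N * (z - be * Complex.I) : ℂ) = Real.log N * (z - al * Complex.I) + ((2 * l - 1 : ℤ) : ℂ) * (2 * Real.pi * Complex.I) := by
        have h3 : Real.log N * (al - be) = (2 * l - 1) * (2 * Real.pi) := by
          rw [hab]; field_simp
        have h4 : (Real.log N : ℂ) * (al - be) = (2 * l - 1) * (2 * Real.pi) := by exact_mod_cast h3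
        rw [show (((2 * l - 1 : ℤ) : ℂ)) = 2 * l - 1 by push_cast; rfl]
        linear_combination Complex.I * h4
      rw [this, Complex.exp_add, Complex.exp_int_mul_two_pi_mul_I, mul_one]
    rw [e, e, e3]
    have h1 : z - al * Complex.I ≠ 0 := fun h => hz.ne' (by simpa using congrArg Complex.re h)
    have h2 : z - be * Complex.I ≠ 0 := fun h => hz.ne' (by simpa using congrArg Complex.re h)
    simp only [Complex.ofReal_one, Complex.one_cpow, sub_add_cancel]
    have h5 : Complex.I * (al - be) = (z - be * Complex.I) - (z - al * Complex.I) := by ring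
    have h6 : Complex.I * (al - be) ≠ 0 := mul_ne_zero Complex.I_ne_zero hab0
    rw [h5] at h6 ⊢
    generalize Complex.exp (Real.log N * (z - al * Complex.I)) = X
    generalize z - al * Complex.I = A at *
    generalize z - be * Complex.I = B at *
    field_simp
    ring

end DZ

namespace DZ
open MeasureTheory

theorem norm_line (x y al : ℝ) : ‖((x:ℂ) + y * Complex.I) - al * Complex.I‖ ^ 2 = x ^ 2 + (y - al) ^ 2 := by
  rw [← Complex.normSq_eq_norm_sq, Complex.normSq_apply]; simp; ring

theorem QQ_bound (lam x al be y : ℝ) (hx : 1 ≤ x ^ 2) :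
    ‖Q lam (((x:ℂ) + y * Complex.I) - al * Complex.I) * Q lam (((x:ℂ) + y * Complex.I) - be * Complex.I)‖ ≤
      (Real.exp (lam / 2 * x) + 1) ^ 2 * ((1 + (y - al) ^ 2)⁻¹ + (1 + (y - be) ^ 2)⁻¹) := by
  have key : ∀ a : ℝ, ‖Q lam (((x:ℂ) + y * Complex.I) - a * Complex.I)‖ ≤ (Real.exp (lam / 2 * x) + 1) * (Real.sqrt (1 + (y - a) ^ 2))⁻¹ := by
    intro a
    have h0 : 1 + (y - a) ^ 2 ≤ ‖((x:ℂ) + y * Complex.I) - a * Complex.I‖ ^ 2 := by rw [norm_line]; linarith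
    have h1 : Real.sqrt (1 + (y - a) ^ 2) ≤ ‖((x:ℂ) + y * Complex.I) - a * Complex.I‖ :=
      Real.sqrt_le_iff.2 ⟨norm_nonneg _, h0⟩
    have h2 : 0 < Real.sqrt (1 + (y - a) ^ 2) := Real.sqrt_pos.2 (by positivity)
    refine (Q_norm lam (norm_pos_iff.1 (h2.trans_le h1))).trans ?_
    rw [div_eq_mul_inv]
    simp only [Complex.sub_re, Complex.add_re, Complex.ofReal_re, Complex.mul_re, Complex.I_re, mul_zero, Complex.ofReal_im, Complex.I_im, mul_one, sub_self, add_zero, sub_zero]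
    gcongr
  rw [norm_mul]
  refine (mul_le_mul (key al) (key be) (norm_nonneg _) (by positivity)).trans ?_
  have e : ∀ a : ℝ, (1 + (y - a) ^ 2)⁻¹ = ((Real.sqrt (1 + (y - a) ^ 2))⁻¹) ^ 2 := by
    intro a; rw [inv_pow, Real.sq_sqrt (by positivity)]
  rw [e al, e be]
  generalize (Real.sqrt (1 + (y - al) ^ 2))⁻¹ = A
  generalize (Real.sqrt (1 + (y - be) ^ 2))⁻¹ = B
  nlinarith [mul_nonneg (sq_nonneg (Real.exp (lam / 2 * x) + 1)) (add_nonneg (sq_nonneg (A - B)) (add_nonneg (sq_nonneg A) (sq_nonneg B)))]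

theorem int_inv (al : ℝ) : Integrable (fun y : ℝ => (1 + (y - al) ^ 2)⁻¹) :=
  integrable_inv_one_add_sq.comp_sub_right al

theorem QQ_integrable (lam x al be : ℝ) (hx : 1 ≤ x ^ 2) : Integrable (fun y : ℝ =>
    Q lam (((x:ℂ) + y * Complex.I) - al * Complex.I) * Q lam (((x:ℂ) + y * Complex.I) - be * Complex.I)) := by
  refine Integrable.mono' (((int_inv al).add (int_inv be)).const_mul ((Real.exp (lam / 2 * x) + 1) ^ 2)) ?_ ?_
  · have := (Q_diff lam).continuous
    exact Continuous.aestronglyMeasurable (by fun_prop)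
  · exact Eventually.of_forall fun y => QQ_bound lam x al be y hx

/-- single term -/
theorem fourier_term (N : ℕ) (hN : 2 ≤ N) (al be : ℝ) (l : ℤ) (hab : al - be = 2 * Real.pi / Real.log N * (2 * l - 1))
    (x : ℝ) (hx : 0 < x) : ∫ y : ℝ, (x : ℂ) ^ (-((3/2 : ℝ) + y * Complex.I)) *
      (Q (Real.log N) ((((3/2:ℝ):ℂ) + y * Complex.I) - al * Complex.I) * Q (Real.log N) ((((3/2:ℝ):ℂ) + y * Complex.I) - be * Complex.I)) =
      2 * Real.pi * kap N al be x := by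
  have h1 : ∀ y : ℝ, mellin (kap N al be) (((3/2 : ℝ):ℂ) + y * Complex.I) = Q (Real.log N) ((((3/2:ℝ):ℂ) + y * Complex.I) - al * Complex.I) * Q (Real.log N) ((((3/2:ℝ):ℂ) + y * Complex.I) - be * Complex.I) := by
    intro y
    refine (mellin_kap N hN al be l hab _ ?_).2
    simp
  have h2 := mellinInv_mellin_eq (3/2) (kap N al be) hx (mellin_kap N hN al be l hab ((3/2:ℝ):ℂ) (by simp)).1 (by
    rw [Complex.VerticalIntegrable]
    simp_rw [h1]
    exact QQ_integrable _ _ _ _ (by norm_num)) (kap_cont N al be).continuousAt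
  rw [mellinInv] at h2
  simp_rw [h1] at h2
  simp only [smul_eq_mul] at h2
  rw [← h2, Complex.real_smul]
  have := Real.pi_ne_zero
  have h3 : (Real.pi:ℂ) ≠ 0 := by exact_mod_cast this
  rw [← mul_assoc, show (2 * Real.pi * ((1 / (2 * Real.pi) : ℝ) : ℂ) : ℂ) = 1 by push_cast; field_simp, one_mul]

open ArithmeticFunction in
theorem fourier_main (a : ℕ → ℂ) (A0 : ℝ) (ha : ∀ n, ‖a n‖ ≤ A0) (N : ℕ) (hN : 2 ≤ N) (al be : ℝ) (l : ℤ) (hab : al - be = 2 * Real.pi / Real.log N * (2 * l - 1)) :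
    ∫ y : ℝ, LSeries (fun n => (vonMangoldt n : ℂ) * a n) (((2 : ℝ):ℂ) + y * Complex.I) *
      (Q (Real.log N) ((((3/2:ℝ):ℂ) + y * Complex.I) - al * Complex.I) * Q (Real.log N) ((((3/2:ℝ):ℂ) + y * Complex.I) - be * Complex.I)) =
      - (2 * Real.pi * ((Gs N (cf a) al - Gs N (cf a) be) / (Complex.I * (al - be)))) := by
  set P : ℝ → ℂ := fun y => (Q (Real.log N) ((((3/2:ℝ):ℂ) + y * Complex.I) - al * Complex.I) * Q (Real.log N) ((((3/2:ℝ):ℂ) + y * Complex.I) - be * Complex.I)) with hP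
  have hPi : Integrable P := QQ_integrable _ _ _ _ (by norm_num)
  set F : ℕ → ℝ → ℂ := fun n y => LSeries.term (fun n => (vonMangoldt n : ℂ) * a n) (((2 : ℝ):ℂ) + y * Complex.I) n * P y with hF
  have hFe : ∀ n y, F n y = (vonMangoldt n : ℂ) * a n * (n:ℂ) ^ (-((1/2:ℝ):ℂ)) * (((n:ℝ):ℂ) ^ (-(((3/2 : ℝ):ℂ) + y * Complex.I)) * P y) := by
    intro n y
    simp only [hF]
    rcases eq_or_ne n 0 with rfl | hn
    · simp
    · rw [LSeries.term_of_ne_zero hn]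
      have hnc : (n:ℂ) ≠ 0 := by exact_mod_cast hn
      have : (((n:ℝ):ℂ)) = (n:ℂ) := by push_cast; rfl
      rw [this, div_eq_mul_inv, ← Complex.cpow_neg,
        show (-((2:ℝ) + y * Complex.I) : ℂ) = -((1/2:ℝ):ℂ) + -(((3/2 : ℝ):ℂ) + y * Complex.I) by push_cast; ring, Complex.cpow_add _ _ hnc]
      ring
  have hcont : ∀ n : ℕ, n ≠ 0 → Continuous fun y : ℝ => ((n:ℝ):ℂ) ^ (-(((3/2 : ℝ):ℂ) + y * Complex.I)) := by
    intro n hn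
    have hnc : ((n:ℝ):ℂ) ≠ 0 := by exact_mod_cast hn
    exact Continuous.const_cpow (by fun_prop) (Or.inl hnc)
  have hnorm : ∀ n : ℕ, n ≠ 0 → ∀ y : ℝ, ‖((n:ℝ):ℂ) ^ (-(((3/2 : ℝ):ℂ) + y * Complex.I))‖ = (n:ℝ) ^ (-(3/2):ℝ) := by
    intro n hn y
    rw [Complex.norm_cpow_eq_rpow_re_of_pos (by positivity)]
    simp
  have hint : ∀ n, Integrable (F n) := by
    intro n
    rw [show F n = fun y : ℝ => (vonMangoldt n : ℂ) * a n * (n:ℂ) ^ (-((1/2:ℝ):ℂ)) * (((n:ℝ):ℂ) ^ (-(((3/2 : ℝ):ℂ) + y * Complex.I)) * P y) from funext (hFe n)]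
    rcases eq_or_ne n 0 with rfl | hn
    · simp
    refine Integrable.const_mul ?_ _
    refine hPi.bdd_mul (c := (n:ℝ) ^ (-(3/2):ℝ)) (hcont n hn).aestronglyMeasurable (Eventually.of_forall fun y => (hnorm n hn y).le)
  have hsum : Summable fun n => ∫ y, ‖F n y‖ := by
    obtain ⟨C, hC, hh⟩ := lam_upper
    have hs := ((hh 2 (by norm_num) le_rfl).1.mul_left A0).mul_right (∫ y, ‖P y‖)
    refine Summable.of_nonneg_of_le (fun n => by positivity) (fun n => ?_) hs
    have hle : ∀ y, ‖F n y‖ ≤ (A0 * (vonMangoldt n / (n:ℝ) ^ (2:ℝ))) * ‖P y‖ := by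
      intro y
      simp only [hF]
      rw [norm_mul]
      gcongr
      rcases eq_or_ne n 0 with rfl | hn
      · simp
      rw [LSeries.norm_term_eq, if_neg hn]
      simp only [Complex.norm_mul, Complex.norm_real, Real.norm_of_nonneg vonMangoldt_nonneg]
      have : ((((2:ℝ):ℂ) + y * Complex.I)).re = 2 := by simp
      rw [this, mul_div_assoc', mul_comm A0]
      have := vonMangoldt_nonneg (n := n)
      gcongr
      exact ha n
    rw [← integral_const_mul]
    exact integral_mono_of_nonneg (Eventually.of_forall fun y => norm_nonneg _) (hPi.norm.const_mul _) (Eventually.of_forall hle)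
  have h := hasSum_integral_of_summable_integral_norm hint hsum
  have e1 : ∀ y, ∑' n, F n y = LSeries (fun n => (vonMangoldt n : ℂ) * a n) (((2 : ℝ):ℂ) + y * Complex.I) * P y := by
    intro y
    simp only [hF]
    rw [tsum_mul_right]; rfl
  simp_rw [e1] at h
  rw [← h.tsum_eq]
  have e2 : ∀ n, ∫ y, F n y = if n ∈ Finset.Icc 1 N then - (2 * Real.pi * ((cf a n * Complex.exp (-(Real.log n * al) * Complex.I) - cf a n * Complex.exp (-(Real.log n * be) * Complex.I)) / (Complex.I * (al - be)))) else 0 := by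
    intro n
    simp_rw [hFe]
    rcases eq_or_ne n 0 with rfl | hn
    · simp
    have hnp : (0:ℝ) < n := by positivity
    rw [integral_const_mul, fourier_term N hN al be l hab n hnp]
    have hn1 : (1:ℝ) ≤ n := by exact_mod_cast Nat.one_le_iff_ne_zero.2 hn
    split_ifs with h
    · have hnN : (n:ℝ) ≤ N := by exact_mod_cast (Finset.mem_Icc.1 h).2
      rw [kap_in N al be n ⟨hn1, hnN⟩, kk, cf]
      have : (n:ℂ) ^ (-((1/2:ℝ):ℂ)) = (((Real.sqrt n)⁻¹ : ℝ) : ℂ) := by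
        rw [Real.sqrt_eq_rpow, ← Real.rpow_neg hnp.le, Complex.ofReal_cpow hnp.le]
        push_cast; rfl
      rw [this]
      push_cast
      ring
    · have : (N:ℝ) < n := by
        have : N < n := by
          by_contra h'
          exact h (Finset.mem_Icc.2 ⟨by omega, by omega⟩)
        exact_mod_cast this
      rw [kap_out N hN al be l hab n (fun h' => by linarith [h'.2])]
      simp
  simp_rw [e2]
  rw [tsum_eq_sum (s := Finset.Icc 1 N) (fun n hn => by simp [hn])]
  rw [Finset.sum_congr rfl (fun n hn => if_pos hn), Finset.sum_neg_distrib, ← Finset.mul_sum, ← Finset.sum_div, Finset.sum_sub_distrib]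
  rfl

end DZ

namespace DZ
open MeasureTheory

theorem periodic_sum (N : ℕ) [NeZero N] (χ : DirichletCharacter ℂ N) :
    ∃ (κ : ℂ) (C : ℝ), 0 ≤ C ∧ ∀ n : ℕ, ‖(∑ k ∈ Finset.Icc 1 n, χ (k : ZMod N)) - κ * n‖ ≤ C := by
  set A : ℕ → ℂ := fun n => ∑ k ∈ Finset.Icc 1 n, χ (k : ZMod N) with hA
  have hN : (N:ℂ) ≠ 0 := by exact_mod_cast NeZero.ne N
  have hstep : ∀ n, A (n + 1) = A n + χ ((n+1 : ℕ) : ZMod N) := by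
    intro n
    simp only [hA]
    rw [Finset.sum_Icc_succ_top (by omega)]
  have h1 : ∀ n, A (n + N) - A n = A N - A 0 := by
    intro n
    induction n with
    | zero => simp
    | succ n ih =>
      rw [show n + 1 + N = (n + N) + 1 by ring, hstep, hstep, ← ih]
      push_cast
      simp
  have h0 : A 0 = 0 := by simp [hA]
  let κ : ℂ := A N / N
  have hper : Function.Periodic (fun n : ℕ => A n - κ * n) N := by
    intro n
    have := h1 n
    simp only [κ]
    push_cast
    field_simp
    rw [h0] at this
    linear_combination N * this
  refine ⟨κ, ∑ j ∈ Finset.range N, ‖A j - κ * j‖, by positivity, fun n => ?_⟩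
  have := hper.map_mod_nat n
  rw [← this]
  exact Finset.single_le_sum (f := fun j : ℕ => ‖A j - κ * j‖) (fun _ _ => norm_nonneg _) (Finset.mem_range.2 (Nat.mod_lt _ (NeZero.pos N)))

theorem L_growth (N : ℕ) [NeZero N] (χ : DirichletCharacter ℂ N) :
    ∃ C : ℝ, 0 < C ∧ ∀ s : ℂ, 1/4 ≤ s.re → 1 ≤ s.im → ‖χ.LFunction s‖ ≤ C * ‖s‖ := by
  obtain ⟨κ, C0, hC0, hb⟩ := periodic_sum N χ
  set A : ℕ → ℂ := fun n => ∑ k ∈ Finset.Icc 1 n, χ (k : ZMod N) with hA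
  set f : ℝ → ℂ := (Set.Ioi (1:ℝ)).indicator (fun t => A ⌊t⌋₊ - κ * t) with hf
  set C1 : ℝ := C0 + ‖κ‖ with hC1
  have hC1' : 0 ≤ C1 := by positivity
  have hfb : ∀ t, ‖f t‖ ≤ C1 := by
    intro t
    simp only [hf]
    by_cases ht : t ∈ Set.Ioi (1:ℝ)
    · rw [Set.indicator_of_mem ht]
      have e : A ⌊t⌋₊ - κ * t = (A ⌊t⌋₊ - κ * (⌊t⌋₊:ℕ)) - κ * ((t - ⌊t⌋₊ : ℝ) : ℂ) := by push_cast; ring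
      rw [e]
      refine (norm_sub_le _ _).trans (add_le_add (hb _) ?_)
      rw [norm_mul, Complex.norm_real]
      have h1 := Nat.floor_le (show 0 ≤ t by have : (1:ℝ) < t := ht; linarith)
      have h2 := Nat.lt_floor_add_one t
      have : ‖t - ⌊t⌋₊‖ ≤ 1 := by rw [Real.norm_eq_abs, abs_le]; constructor <;> linarith
      exact mul_le_of_le_one_right (norm_nonneg _) this
    · rw [Set.indicator_of_notMem ht]; simpa using hC1'
  have hfm : Measurable f := by
    refine Measurable.indicator ?_ measurableSet_Ioi
    refine Measurable.sub ((measurable_from_nat (f := A)).comp Nat.measurable_floor) ?_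
    fun_prop
  have hloc : LocallyIntegrableOn f (Set.Ioi 0) := by
    refine LocallyIntegrable.locallyIntegrableOn ?_ _
    have hc : LocallyIntegrable (fun _ : ℝ => C1) := continuous_const.locallyIntegrable
    refine hc.mono hfm.aestronglyMeasurable (Eventually.of_forall fun t => ?_)
    rw [Real.norm_of_nonneg hC1']; exact hfb t
  have hdiff : ∀ s : ℂ, 0 < s.re → DifferentiableAt ℂ (fun s => mellin f (-s)) s := by
    intro s hs
    have : DifferentiableAt ℂ (mellin f) (-s) := by
      refine mellin_differentiableAt_of_isBigO_rpow (a := 0) (b := -s.re - 1) hloc ?_ (by simpa using hs) ?_ (by simp)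
      · simp only [neg_zero, Real.rpow_zero]
        exact Asymptotics.IsBigO.of_bound C1 (Eventually.of_forall fun t => by simpa using hfb t)
      · refine Asymptotics.IsBigO.of_bound 0 ?_
        have : Set.Iio (1:ℝ) ∈ 𝓝[>] (0:ℝ) := mem_nhdsWithin_of_mem_nhds (Iio_mem_nhds (by norm_num))
        filter_upwards [this] with t ht
        rw [hf, Set.indicator_of_notMem (by simpa using le_of_lt ht)]; simp
    exact this.comp s differentiableAt_id.neg
  have hmel : ∀ s : ℂ, mellin f (-s) = ∫ t in Set.Ioi (1:ℝ), (A ⌊t⌋₊ - κ * t) * (t:ℂ) ^ (-(s + 1)) := by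
    intro s
    rw [mellin]
    have e : ∀ t : ℝ, (t:ℂ) ^ (-s - 1) • f t = (Set.Ioi (1:ℝ)).indicator (fun t : ℝ => (A ⌊t⌋₊ - κ * t) * (t:ℂ) ^ (-(s + 1))) t := by
      intro t
      by_cases ht : t ∈ Set.Ioi (1:ℝ)
      · rw [hf, Set.indicator_of_mem ht, Set.indicator_of_mem ht, smul_eq_mul, mul_comm]; congr 2; ring
      · rw [hf, Set.indicator_of_notMem ht, Set.indicator_of_notMem ht, smul_zero]
    simp_rw [e]
    rw [setIntegral_indicator measurableSet_Ioi, show Set.Ioi (0:ℝ) ∩ Set.Ioi 1 = Set.Ioi 1 from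
      Set.inter_eq_right.2 (Set.Ioi_subset_Ioi (by norm_num))]
  have hmelb : ∀ s : ℂ, 0 < s.re → ‖mellin f (-s)‖ ≤ C1 / s.re ∧
      IntegrableOn (fun t : ℝ => (A ⌊t⌋₊ - κ * t) * (t:ℂ) ^ (-(s + 1))) (Set.Ioi 1) := by
    intro s hs
    have hi : IntegrableOn (fun t : ℝ => C1 * t ^ (-(s.re + 1))) (Set.Ioi 1) :=
      (integrableOn_Ioi_rpow_of_lt (by linarith) one_pos).const_mul C1
    have hle : ∀ t ∈ Set.Ioi (1:ℝ), ‖(A ⌊t⌋₊ - κ * t) * (t:ℂ) ^ (-(s + 1))‖ ≤ C1 * t ^ (-(s.re + 1)) := by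
      intro t ht
      have ht0 : (1:ℝ) < t := ht
      rw [norm_mul, Complex.norm_cpow_eq_rpow_re_of_pos (by linarith)]
      have := hfb t
      rw [hf, Set.indicator_of_mem ht] at this
      simp only [Complex.neg_re, Complex.add_re, Complex.one_re]
      gcongr
    constructor
    · rw [hmel]
      refine (norm_integral_le_of_norm_le hi ((ae_restrict_iff' measurableSet_Ioi).2 (Eventually.of_forall hle))).trans (le_of_eq ?_)
      rw [integral_const_mul, integral_Ioi_rpow_of_lt (by linarith) one_pos]
      simp
      field_simp
    · refine Integrable.mono' hi ?_ ((ae_restrict_iff' measurableSet_Ioi).2 (Eventually.of_forall hle))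
      refine Measurable.aestronglyMeasurable ?_
      refine Measurable.mul (Measurable.sub ((measurable_from_nat (f := A)).comp Nat.measurable_floor) (by fun_prop)) (by fun_prop)
  have hform : ∀ s : ℂ, 1 < s.re → χ.LFunction s = s * mellin f (-s) + κ * s / (s - 1) := by
    intro s hs
    have hs1 : s - 1 ≠ 0 := fun h => by
      have := congrArg Complex.re h; simp at this; linarith
    rw [DirichletCharacter.LFunction_eq_LSeries χ hs, LSeries_eq_mul_integral _ zero_le_one hs (DirichletCharacter.LSeriesSummable_of_one_lt_re χ hs)]
    · have hit : IntegrableOn (fun t : ℝ => κ * (t:ℂ) ^ (-s)) (Set.Ioi 1) :=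
        (integrableOn_Ioi_cpow_of_lt (by simpa using hs) one_pos).const_mul κ
      have e : ∫ t in Set.Ioi (1:ℝ), (A ⌊t⌋₊) * (t:ℂ) ^ (-(s + 1)) = mellin f (-s) + κ / (s - 1) := by
        rw [hmel]
        have e2 : κ / (s - 1) = ∫ t in Set.Ioi (1:ℝ), κ * (t:ℂ) ^ (-s) := by
          rw [integral_const_mul, integral_Ioi_cpow_of_lt (by simpa using hs) one_pos]
          simp
          rw [show -s + 1 = -(s - 1) by ring, div_neg]
          field_simp
        rw [e2, ← integral_add (hmelb s (by linarith)).2 hit]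
        refine setIntegral_congr_fun measurableSet_Ioi fun t ht => ?_
        have ht0 : (t:ℂ) ≠ 0 := by
          have : (1:ℝ) < t := ht
          have : t ≠ 0 := by linarith
          exact_mod_cast this
        have : (t:ℂ) ^ (-s) = t * (t:ℂ) ^ (-(s + 1)) := by
          rw [show -s = 1 + -(s+1) by ring, Complex.cpow_add _ _ ht0, Complex.cpow_one]
        simp only [this]
        ring
      simp only [hA] at e
      rw [e]; field_simp
    · refine Asymptotics.IsBigO.of_bound C1 ?_
      filter_upwards [eventually_ge_atTop 1] with n hn
      have hn1 : (1:ℝ) ≤ n := by exact_mod_cast hn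
      have e : ∑ k ∈ Finset.Icc 1 n, χ (k : ZMod N) = ((∑ k ∈ Finset.Icc 1 n, χ (k : ZMod N)) - κ * n) + κ * n := by ring
      rw [e]
      refine (norm_add_le _ _).trans ?_
      rw [norm_mul, Real.rpow_one]
      simp only [Complex.norm_natCast, Real.norm_natCast]
      have := hb n
      nlinarith
  have hU : ∀ s ∈ {s : ℂ | 0 < s.re ∧ 0 < s.im}, χ.LFunction s = s * mellin f (-s) + κ * s / (s - 1) := by
    have hopen : IsOpen {s : ℂ | 0 < s.re ∧ 0 < s.im} :=
      (isOpen_lt continuous_const Complex.continuous_re).inter (isOpen_lt continuous_const Complex.continuous_im)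
    have hconv : Convex ℝ {s : ℂ | 0 < s.re ∧ 0 < s.im} :=
      (convex_halfSpace_re_gt 0).inter (convex_halfSpace_im_gt 0)
    have hne : ∀ s ∈ {s : ℂ | 0 < s.re ∧ 0 < s.im}, s ≠ 1 := fun s hs h => by rw [h] at hs; simpa using hs.2
    refine AnalyticOnNhd.eqOn_of_preconnected_of_eventuallyEq (z₀ := 2 + Complex.I) (DifferentiableOn.analyticOnNhd (fun s hs => ?_) hopen) (DifferentiableOn.analyticOnNhd (fun s hs => ?_) hopen) hconv.isPreconnected (by simp) ?_
    · exact (DirichletCharacter.differentiableAt_LFunction χ s (Or.inl (hne s hs))).differentiableWithinAt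
    · have := hdiff s hs.1
      have h1 : s - 1 ≠ 0 := sub_ne_zero.2 (hne s hs)
      refine DifferentiableAt.differentiableWithinAt ?_
      refine DifferentiableAt.add (differentiableAt_id.mul this) (DifferentiableAt.div (by fun_prop) (by fun_prop) h1)
    · have : {s : ℂ | 1 < s.re} ∈ 𝓝 (2 + Complex.I) := (isOpen_lt continuous_const Complex.continuous_re).mem_nhds (by simp)
      filter_upwards [this] with s hs
      exact hform s hs
  refine ⟨4 * C1 + ‖κ‖ + 1, by positivity, fun s h1 h2 => ?_⟩
  rw [hU s ⟨by linarith, by linarith⟩]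
  refine (norm_add_le _ _).trans ?_
  rw [norm_mul, norm_div, norm_mul]
  have h3 : ‖mellin f (-s)‖ ≤ 4 * C1 := by
    refine (hmelb s (by linarith)).1.trans ?_
    rw [div_le_iff₀ (by linarith)]
    nlinarith
  have h4 : 1 ≤ ‖s - 1‖ := by
    refine le_trans ?_ (Complex.abs_im_le_norm _)
    simp only [Complex.sub_im, Complex.one_im, sub_zero]
    exact h2.trans (le_abs_self _)
  have h5 : ‖κ‖ * ‖s‖ / ‖s - 1‖ ≤ ‖κ‖ * ‖s‖ := div_le_self (by positivity) h4
  have h6 := norm_nonneg s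
  nlinarith [mul_le_mul_of_nonneg_left h3 h6]

theorem L_lower (N : ℕ) [NeZero N] (χ : DirichletCharacter ℂ N) :
    ∃ c : ℝ, 0 < c ∧ ∀ s : ℂ, s.re = 2 → c ≤ ‖χ.LFunction s‖ := by
  have hs0 : Summable (fun n : ℕ => 1 / (n:ℝ) ^ (2:ℝ)) := Real.summable_one_div_nat_rpow.2 (by norm_num)
  set Z := ∑' n : ℕ, 1 / (n:ℝ) ^ (2:ℝ) with hZ
  have hZ1 : 1 ≤ Z := by
    have := hs0.le_tsum 1 (fun n _ => by positivity)
    rw [Nat.cast_one, Real.one_rpow, div_one] at this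
    exact this
  refine ⟨1 / Z, by positivity, fun s hs => ?_⟩
  have h1 := DirichletCharacter.LSeries.mul_mu_eq_one χ (s := s) (by linarith)
  rw [DirichletCharacter.LFunction_eq_LSeries χ (by linarith)]
  set X := LSeries (fun n => χ n) s with hX
  set Y := LSeries ((fun n : ℕ => χ (n : ZMod N)) * fun n => ((ArithmeticFunction.moebius n : ℤ) : ℂ)) s with hY
  have h2 : ‖Y‖ ≤ Z := by
    refine tsum_of_norm_bounded hs0.hasSum fun n => ?_
    rw [LSeries.norm_term_eq]
    split_ifs with hn
    · positivity
    · rw [hs]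
      gcongr
      simp only [Pi.mul_apply, norm_mul]
      have a1 := χ.norm_le_one (n : ZMod N)
      have a2 : ‖((ArithmeticFunction.moebius n : ℤ) : ℂ)‖ ≤ 1 := by
        rw [Complex.norm_intCast]
        have := ArithmeticFunction.abs_moebius_le_one (n := n)
        exact_mod_cast this
      exact mul_le_one₀ a1 (norm_nonneg _) a2
  have h3 : ‖X‖ * ‖Y‖ = 1 := by rw [← norm_mul, h1, norm_one]
  rw [div_le_iff₀ (by positivity), ← h3]
  gcongr

end DZ

namespace DZ

theorem factor_aux {U : Set ℂ} (hU : IsOpen U) (hUp : IsPreconnected U) {F : ℂ → ℂ} (hF : AnalyticOnNhd ℂ F U)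
    {z0 : ℂ} (hz0 : z0 ∈ U) (hne : F z0 ≠ 0) (Z : Finset ℂ) : (∀ ρ ∈ Z, ρ ∈ U) →
    ∃ (k : ℂ → ℕ) (g : ℂ → ℂ), AnalyticOnNhd ℂ g U ∧ (∀ s ∈ U, F s = (∏ ρ ∈ Z, (s - ρ) ^ k ρ) * g s) ∧
      ∀ ρ ∈ Z, g ρ ≠ 0 := by
  classical
  induction Z using Finset.induction_on with
  | empty => intro _; exact ⟨fun _ => 0, F, hF, fun s _ => by simp, fun ρ h => by simp at h⟩
  | insert ρ Z hρ ih =>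
    intro hZ
    obtain ⟨k, g, hg, hFg, hgn⟩ := ih fun x hx => hZ x (Finset.mem_insert_of_mem hx)
    have hρU := hZ ρ (Finset.mem_insert_self _ _)
    have hnz : ¬ ∀ᶠ z in 𝓝 ρ, g z = 0 := by
      intro h
      have := hg.eqOn_zero_of_preconnected_of_eventuallyEq_zero hUp hρU h hz0
      apply hne
      rw [hFg z0 hz0, this]; simp
    obtain ⟨n, u, hu, hu0, hgu⟩ := (hg ρ hρU).exists_eventuallyEq_pow_smul_nonzero_iff.2 hnz
    let g' : ℂ → ℂ := fun s => if s = ρ then u ρ else g s / (s - ρ) ^ n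
    have hg' : ∀ s, g s = (s - ρ) ^ n * g' s := by
      intro s
      by_cases hs : s = ρ
      · subst hs
        have := hgu.self_of_nhds
        simpa [g'] using this
      · simp only [g', if_neg hs]
        have : s - ρ ≠ 0 := sub_ne_zero.2 hs
        field_simp
    refine ⟨fun x => if x = ρ then n else k x, g', ?_, ?_, ?_⟩
    · intro s hs
      by_cases h : s = ρ
      · subst h
        refine hu.congr ?_
        filter_upwards [hgu] with z hz
        by_cases hzs : z = s
        · simp [g', hzs]
        · simp only [g', if_neg hzs]
          have : z - s ≠ 0 := sub_ne_zero.2 hzs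
          rw [hz, smul_eq_mul]; field_simp
      · have h1 : AnalyticAt ℂ (fun z => g z / (z - ρ) ^ n) s :=
          (hg s hs).div (by fun_prop) (pow_ne_zero _ (sub_ne_zero.2 h))
        refine h1.congr ?_
        filter_upwards [isOpen_ne.mem_nhds h] with z hz
        simp only [g', if_neg hz]
    · intro s hs
      rw [hFg s hs, Finset.prod_insert hρ, hg' s]
      simp only [if_true]
      have : ∏ x ∈ Z, (s - x) ^ (if x = ρ then n else k x) = ∏ x ∈ Z, (s - x) ^ k x := by
        refine Finset.prod_congr rfl fun x hx => ?_
        rw [if_neg (fun h : x = ρ => hρ (h ▸ hx))]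
      rw [this]; ring
    · intro x hx
      rcases Finset.mem_insert.1 hx with rfl | hx
      · simp [g', hu0]
      · intro h
        have := hg' x
        rw [h, mul_zero] at this
        exact hgn x hx this

theorem zeros_finite {U : Set ℂ} (hUp : IsPreconnected U) {F : ℂ → ℂ} (hF : AnalyticOnNhd ℂ F U)
    {z0 : ℂ} (hz0 : z0 ∈ U) (hne : F z0 ≠ 0) {K : Set ℂ} (hK : IsCompact K) (hKU : K ⊆ U) :
    {z | z ∈ K ∧ F z = 0}.Finite := by
  by_contra hinf
  obtain ⟨x, hxK, hx⟩ := Set.Infinite.exists_accPt_of_subset_isCompact hinf hK (fun z hz => hz.1)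
  rw [accPt_iff_frequently_nhdsNE] at hx
  exact hne (hF.eqOn_zero_of_preconnected_of_frequently_eq_zero hUp (hKU hxK) (hx.mono fun z hz => hz.2) hz0)

theorem factor {U : Set ℂ} (hU : IsOpen U) (hUp : IsPreconnected U) {F : ℂ → ℂ} (hF : AnalyticOnNhd ℂ F U)
    {z0 : ℂ} (hz0 : z0 ∈ U) (hne : F z0 ≠ 0) {K : Set ℂ} (hK : IsCompact K) (hKU : K ⊆ U) :
    ∃ (Z : Finset ℂ) (k : ℂ → ℕ) (g : ℂ → ℂ), AnalyticOnNhd ℂ g U ∧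
      (∀ s ∈ U, F s = (∏ ρ ∈ Z, (s - ρ) ^ k ρ) * g s) ∧
      (∀ ρ, ρ ∈ Z ↔ ρ ∈ K ∧ F ρ = 0) ∧ (∀ s ∈ K, g s ≠ 0) := by
  have hfin := zeros_finite hUp hF hz0 hne hK hKU
  obtain ⟨k, g, h1, h2, h3⟩ := factor_aux hU hUp hF hz0 hne hfin.toFinset (fun ρ hρ => hKU ((hfin.mem_toFinset.1 hρ).1))
  refine ⟨hfin.toFinset, k, g, h1, h2, fun ρ => by simp, fun s hs hgs => ?_⟩
  by_cases h : F s = 0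
  · exact h3 s (by simp [hs, h]) hgs
  · exact h (by rw [h2 s (hKU hs), hgs, mul_zero])

/-- log derivative of a factored function -/
theorem logDeriv_factor {U : Set ℂ} (hU : IsOpen U) {F g : ℂ → ℂ} {Z : Finset ℂ} {k : ℂ → ℕ} (hg : AnalyticOnNhd ℂ g U)
    (h : ∀ s ∈ U, F s = (∏ ρ ∈ Z, (s - ρ) ^ k ρ) * g s) {s : ℂ} (hs : s ∈ U) (hsZ : s ∉ Z) (hgs : g s ≠ 0) :
    logDeriv F s = ∑ ρ ∈ Z, (k ρ : ℂ) / (s - ρ) + logDeriv g s := by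
  have e : F =ᶠ[𝓝 s] fun s => (∏ ρ ∈ Z, (s - ρ) ^ k ρ) * g s := by
    filter_upwards [hU.mem_nhds hs] with z hz using h z hz
  rw [(logDeriv_congr_nhds e).self_of_nhds]
  have hne : ∀ ρ ∈ Z, (s - ρ) ^ k ρ ≠ 0 := fun ρ hρ => pow_ne_zero _ (sub_ne_zero.2 fun h => hsZ (h ▸ hρ))
  rw [logDeriv_mul (f := fun s => ∏ ρ ∈ Z, (s - ρ) ^ k ρ) s (Finset.prod_ne_zero_iff.2 hne) hgs (by fun_prop) (hg s hs).differentiableAt]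
  congr 1
  have := logDeriv_prod (s := Z) (f := fun ρ s => (s - ρ) ^ k ρ) (x := s) hne (fun ρ _ => by fun_prop)
  rw [this]
  refine Finset.sum_congr rfl fun ρ _ => ?_
  rw [logDeriv_fun_pow (by fun_prop), logDeriv_apply]
  simp
  ring

end DZ

namespace DZ
open Metric

theorem nonvan_ld (r r1 R' : ℝ) (hr0 : 0 < r) (hr : r < r1) (hr1 : r1 < R') {g : ℂ → ℂ} (M : ℝ) (hM : 0 < M)
    (hg : DifferentiableOn ℂ g (ball 0 R')) (hne : ∀ s ∈ ball (0:ℂ) R', g s ≠ 0)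
    (hb : ∀ s ∈ ball (0:ℂ) R', ‖g s‖ ≤ Real.exp M) (h0 : Real.exp (-M) ≤ ‖g 0‖) :
    ∀ s ∈ closedBall (0:ℂ) r, ‖logDeriv g s‖ ≤ (4 * r1 / (R' - r1)) / (r1 - r) * M := by
  have hR'0 : 0 < R' := by linarith
  have h0mem : (0:ℂ) ∈ ball (0:ℂ) R' := by simpa using hR'0
  have hld : DifferentiableOn ℂ (logDeriv g) (ball 0 R') :=
    (hg.deriv isOpen_ball).div hg hne
  obtain ⟨h, hh0, hh⟩ := hld.isExactOn_ball.with_val_at 0 0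
  have hhd : DifferentiableOn ℂ h (ball 0 R') := fun s hs => (hh s hs).differentiableAt.differentiableWithinAt
  have hexp : Set.EqOn g (fun s => g 0 * Complex.exp (h s)) (ball 0 R') := by
    have e1 : Set.EqOn (logDeriv g) (logDeriv fun s => Complex.exp (h s)) (ball 0 R') := by
      intro s hs
      rw [logDeriv_apply (fun s => Complex.exp (h s)), ((hh s hs).cexp).deriv]
      have := Complex.exp_ne_zero (h s)
      field_simp
    obtain ⟨z, hz, hzz⟩ := (logDeriv_eqOn_iff hg (fun s hs => ((hhd s hs).cexp)) isOpen_ball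
      (convex_ball _ _).isPreconnected (fun s _ => Complex.exp_ne_zero _) hne).1 e1
    have hz0 := hzz h0mem
    simp only [Pi.smul_apply, hh0, Complex.exp_zero, smul_eq_mul, mul_one] at hz0
    intro s hs
    rw [hzz hs, hz0]; simp
  have hre : Set.MapsTo h (ball 0 R') {z | z.re ≤ 2 * M} := by
    intro s hs
    have h1 := hb s hs
    rw [hexp hs, norm_mul, Complex.norm_exp] at h1
    have h2 : Real.exp (-M) * Real.exp (h s).re ≤ Real.exp M :=
      (mul_le_mul_of_nonneg_right h0 (Real.exp_pos _).le).trans h1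
    rw [← Real.exp_add, Real.exp_le_exp] at h2
    show (h s).re ≤ 2 * M
    linarith
  have hbc : ∀ s ∈ closedBall (0:ℂ) r1, ‖h s‖ ≤ 4 * M * r1 / (R' - r1) := by
    intro s hs
    have hs1 : ‖s‖ ≤ r1 := by simpa using hs
    refine (Complex.borelCaratheodory_zero (M := 2 * M) (by positivity) hhd hre hR'0 (by simp; linarith) hh0).trans ?_
    have : 0 < R' - r1 := by linarith
    have hr1p : 0 < r1 := by linarith
    rw [show 2 * (2 * M) * ‖s‖ = 4 * M * ‖s‖ by ring]
    gcongr
  intro s hs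
  have hs1 : ‖s‖ ≤ r := by simpa using hs
  have hsub : closedBall s (r1 - r) ⊆ closedBall (0:ℂ) r1 := by
    refine closedBall_subset_closedBall' ?_
    rw [dist_zero_right]; linarith
  have hsub2 : closedBall (0:ℂ) r1 ⊆ ball 0 R' := closedBall_subset_ball hr1
  have hsm : s ∈ ball (0:ℂ) R' := by simp; linarith
  rw [← (hh s hsm).deriv]
  have hd : DiffContOnCl ℂ h (ball s (r1 - r)) := by
    refine DifferentiableOn.diffContOnCl ?_
    rw [closure_ball _ (by linarith)]
    exact hhd.mono (hsub.trans hsub2)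
  refine (Complex.norm_deriv_le_of_forall_mem_sphere_norm_le (by linarith) hd (fun z hz => hbc z (hsub (sphere_subset_closedBall hz)))).trans (le_of_eq ?_)
  ring

theorem local0 (r R' R R2 : ℝ) (hr0 : 0 < r) (hr : r < R') (hR' : R' < R) (hR2 : R < R2) :
    ∃ C : ℝ, 0 < C ∧ ∀ (Φ : ℂ → ℂ) (M : ℝ), 0 < M → AnalyticOnNhd ℂ Φ (ball 0 R2) →
      (∀ z ∈ closedBall (0:ℂ) R, ‖Φ z‖ ≤ Real.exp M) → Real.exp (-M) ≤ ‖Φ 0‖ →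
      ∃ (Z : Finset ℂ) (k : ℂ → ℕ), ((∑ ρ ∈ Z, k ρ : ℕ) : ℝ) ≤ C * M ∧ (∀ ρ ∈ Z, 1 ≤ k ρ) ∧
        ∀ s ∈ closedBall (0:ℂ) r, s ∉ Z → Φ s ≠ 0 ∧ ‖logDeriv Φ s‖ ≤ ∑ ρ ∈ Z, (k ρ : ℝ) / ‖s - ρ‖ + C * M := by
  have hlog : 0 < Real.log (R / R') := Real.log_pos (by rw [lt_div_iff₀ (by linarith)]; linarith)
  have hRR : 0 < R - R' := by linarith
  have hR'0 : 0 < R' := by linarith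
  have hR0 : 0 < R := by linarith
  set C1 := 2 / Real.log (R / R') with hC1
  have hC1p : 0 < C1 := by positivity
  set r1 := (r + R') / 2 with hr1
  set C2 := (4 * r1 / (R' - r1)) / (r1 - r) with hC2
  have hC2p : 0 < C2 := by
    have : 0 < R' - r1 := by rw [hr1]; linarith
    have : 0 < r1 - r := by rw [hr1]; linarith
    have : 0 < r1 := by rw [hr1]; linarith
    positivity
  refine ⟨C1 + C1 / (R - R') + C2, by positivity, fun Φ M hM hΦ hΦb hΦ0 => ?_⟩
  have hne0 : Φ 0 ≠ 0 := norm_pos_iff.1 ((Real.exp_pos _).trans_le hΦ0)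
  obtain ⟨Z, k, g, hg, hfac, hZ, hgne⟩ := factor isOpen_ball (convex_ball (0:ℂ) R2).isPreconnected hΦ (z0 := 0) (by simp; linarith) hne0 (isCompact_closedBall (0:ℂ) R') (closedBall_subset_ball (by linarith))
  have hZn : ∀ ρ ∈ Z, ‖ρ‖ ≤ R' := fun ρ hρ => by simpa using ((hZ ρ).1 hρ).1
  let b : ℂ → ℂ → ℂ := fun ρ s => ((R:ℂ) ^ 2 - (starRingEnd ℂ) ρ * s) / R
  have hRc : (R:ℂ) ≠ 0 := by exact_mod_cast hR0.ne'
  have hlowb : ∀ ρ ∈ Z, ∀ s : ℂ, ‖s‖ ≤ R → R * (R - R') ≤ ‖(R:ℂ) ^ 2 - (starRingEnd ℂ) ρ * s‖ := by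
    intro ρ hρ s hs
    have h1 : ‖(R:ℂ) ^ 2‖ = R ^ 2 := by rw [norm_pow, Complex.norm_real, Real.norm_of_nonneg hR0.le]
    have h2 : ‖(starRingEnd ℂ) ρ * s‖ ≤ R' * R := by
      rw [norm_mul, RCLike.norm_conj]
      exact mul_le_mul (hZn ρ hρ) hs (norm_nonneg _) hR'0.le
    have := norm_sub_norm_le ((R:ℂ) ^ 2) ((starRingEnd ℂ) ρ * s)
    rw [h1] at this
    nlinarith
  have hbne : ∀ ρ ∈ Z, ∀ s : ℂ, ‖s‖ ≤ R → b ρ s ≠ 0 := by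
    intro ρ hρ s hs
    refine div_ne_zero ?_ hRc
    exact norm_pos_iff.1 (lt_of_lt_of_le (by positivity) (hlowb ρ hρ s hs))
  have hbsph : ∀ ρ, ∀ s : ℂ, ‖s‖ = R → ‖b ρ s‖ = ‖s - ρ‖ := by
    intro ρ s hs
    have e : (R:ℂ) ^ 2 - (starRingEnd ℂ) ρ * s = s * (starRingEnd ℂ) (s - ρ) := by
      have : s * (starRingEnd ℂ) s = (R:ℂ) ^ 2 := by
        rw [Complex.mul_conj, Complex.normSq_eq_norm_sq, hs]; push_cast; rfl
      rw [map_sub, mul_sub, this]; ring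
    simp only [b]
    rw [e, norm_div, norm_mul, RCLike.norm_conj, hs, Complex.norm_real, Real.norm_of_nonneg hR0.le]
    field_simp
  let g1 : ℂ → ℂ := fun s => (∏ ρ ∈ Z, b ρ s ^ k ρ) * g s
  have hPd : Differentiable ℂ (fun s => ∏ ρ ∈ Z, b ρ s ^ k ρ) := by
    simp only [b]; fun_prop
  have hg1d : DifferentiableOn ℂ g1 (ball 0 R2) := hPd.differentiableOn.mul hg.differentiableOn
  have hsphb : ∀ s ∈ frontier (ball (0:ℂ) R), ‖g1 s‖ ≤ Real.exp M := by
    intro s hs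
    rw [frontier_ball _ hR0.ne'] at hs
    have hsn : ‖s‖ = R := by simpa using hs
    have hsm : s ∈ ball (0:ℂ) R2 := by simp; linarith
    refine le_trans (le_of_eq ?_) (hΦb s (sphere_subset_closedBall hs))
    rw [hfac s hsm, norm_mul, norm_mul, norm_prod, norm_prod]
    congr 1
    refine Finset.prod_congr rfl fun ρ _ => ?_
    rw [norm_pow, norm_pow, hbsph ρ s hsn]
  have hg1b : ∀ s ∈ closedBall (0:ℂ) R, ‖g1 s‖ ≤ Real.exp M := by
    intro s hs
    refine Complex.norm_le_of_forall_mem_frontier_norm_le (isBounded_ball (x := (0:ℂ)) (r := R)) ?_ hsphb (by rwa [closure_ball _ hR0.ne'])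
    refine DifferentiableOn.diffContOnCl ?_
    rw [closure_ball _ hR0.ne']
    exact hg1d.mono (closedBall_subset_ball hR2)
  set n := ∑ ρ ∈ Z, k ρ with hn
  have hb0 : ∏ ρ ∈ Z, b ρ 0 ^ k ρ = (R:ℂ) ^ n := by
    rw [hn, ← Finset.prod_pow_eq_pow_sum]
    refine Finset.prod_congr rfl fun ρ _ => ?_
    simp only [b]; congr 1; field_simp; simp
  have hg10 : ‖g1 0‖ = R ^ n * ‖g 0‖ := by
    simp only [g1]
    rw [hb0, norm_mul, norm_pow, Complex.norm_real, Real.norm_of_nonneg hR0.le]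
  have hΦ0' : ‖Φ 0‖ ≤ R' ^ n * ‖g 0‖ := by
    rw [hfac 0 (by simp; linarith), norm_mul, norm_prod, hn, ← Finset.prod_pow_eq_pow_sum]
    gcongr with ρ hρ
    rw [norm_pow]
    gcongr
    simpa using hZn ρ hρ
  have hR'n : 0 < R' ^ n := by positivity
  have hg1low : Real.exp (-M) ≤ ‖g1 0‖ := by
    rw [hg10]
    refine hΦ0.trans (hΦ0'.trans ?_)
    gcongr
  have hcount : (n:ℝ) ≤ C1 * M := by
    have h1 := hg1b 0 (by simp; linarith)
    rw [hg10] at h1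
    have h2 := hΦ0.trans hΦ0'
    have h3 : (R / R') ^ n ≤ Real.exp (2 * M) := by
      rw [div_pow, div_le_iff₀ hR'n]
      have e : Real.exp (2 * M) = Real.exp M * Real.exp M := by rw [← Real.exp_add]; congr 1; ring
      have e2 : Real.exp M * Real.exp (-M) = 1 := by rw [← Real.exp_add]; simp
      have hg0 : 0 < ‖g 0‖ := norm_pos_iff.2 (hgne 0 (by simp; linarith))
      rw [e]
      have h4 : Real.exp M * Real.exp (-M) ≤ Real.exp M * (R' ^ n * ‖g 0‖) := by gcongr
      rw [e2] at h4
      have : R ^ n * ‖g 0‖ ≤ (Real.exp M * Real.exp M * R' ^ n) * ‖g 0‖ := by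
        calc R ^ n * ‖g 0‖ ≤ Real.exp M * 1 := by linarith
          _ ≤ Real.exp M * (Real.exp M * (R' ^ n * ‖g 0‖)) := by gcongr
          _ = _ := by ring
      exact le_of_mul_le_mul_right this hg0
    have h4 := Real.log_le_log (by positivity) h3
    rw [Real.log_exp, Real.log_pow] at h4
    rw [hC1, div_mul_eq_mul_div, le_div_iff₀ hlog]
    linarith
  refine ⟨Z, k, hcount.trans ?_, fun ρ hρ => ?_, fun s hs hsZ => ?_⟩
  · have : 0 ≤ C1 / (R - R') * M := by positivity
    have : 0 ≤ C2 * M := by positivity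
    nlinarith
  · have hρK := ((hZ ρ).1 hρ).1
    have h0 := ((hZ ρ).1 hρ).2
    rw [hfac ρ (closedBall_subset_ball (by linarith) hρK)] at h0
    have h1 := (mul_eq_zero.1 h0).resolve_right (hgne ρ hρK)
    obtain ⟨ρ', hρ', h2⟩ := Finset.prod_eq_zero_iff.1 h1
    have h3 : ρ = ρ' := sub_eq_zero.1 (by by_contra hc; exact pow_ne_zero _ hc h2)
    by_contra hlt
    rw [← h3, show k ρ = 0 by omega, pow_zero] at h2
    exact one_ne_zero h2
  have hsn : ‖s‖ ≤ r := by simpa using hs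
  have hΦs : Φ s ≠ 0 := fun h => hsZ ((hZ s).2 ⟨by simp; linarith, h⟩)
  refine ⟨hΦs, ?_⟩
  have hgs : g s ≠ 0 := hgne s (by simp; linarith)
  have hsm : s ∈ ball (0:ℂ) R2 := by simp; linarith
  rw [logDeriv_factor isOpen_ball hg hfac hsm hsZ hgs]
  have hld := nonvan_ld r r1 R' hr0 (by rw [hr1]; linarith) (by rw [hr1]; linarith) M hM
    (hg1d.mono (ball_subset_ball (by linarith))) (fun z hz => by
      have hzn : ‖z‖ < R' := by simpa using hz
      refine mul_ne_zero (Finset.prod_ne_zero_iff.2 fun ρ hρ => pow_ne_zero _ (hbne ρ hρ z (by linarith))) (hgne z (by simp; linarith)))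
    (fun z hz => hg1b z (by
      have hzn : ‖z‖ < R' := by simpa using hz
      simp; linarith)) hg1low s hs
  have hb' : ∀ ρ ∈ Z, b ρ s ^ k ρ ≠ 0 := fun ρ hρ => pow_ne_zero _ (hbne ρ hρ s (by linarith))
  have e1 : logDeriv g1 s = ∑ ρ ∈ Z, logDeriv (fun s => b ρ s ^ k ρ) s + logDeriv g s := by
    simp only [g1]
    rw [logDeriv_mul (f := fun s => ∏ ρ ∈ Z, b ρ s ^ k ρ) s (Finset.prod_ne_zero_iff.2 hb') hgs hPd.differentiableAt (hg s hsm).differentiableAt]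
    congr 1
    exact logDeriv_prod (s := Z) (f := fun ρ s => b ρ s ^ k ρ) (x := s) hb' (fun ρ _ => by simp only [b]; fun_prop)
  have e2 : ∀ ρ ∈ Z, ‖logDeriv (fun s => b ρ s ^ k ρ) s‖ ≤ k ρ * (1 / (R - R')) := by
    intro ρ hρ
    rw [logDeriv_fun_pow (by simp only [b]; fun_prop), norm_mul]
    simp only [Complex.norm_natCast]
    gcongr
    rw [logDeriv_apply]
    have hder : deriv (b ρ) s = -(starRingEnd ℂ) ρ / R := by
      have : HasDerivAt (b ρ) ((0 - (starRingEnd ℂ) ρ * 1) / R) s :=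
        ((hasDerivAt_const s ((R:ℂ) ^ 2)).sub ((hasDerivAt_id s).const_mul _)).div_const _
      rw [this.deriv]; simp
    rw [hder]
    simp only [b]
    rw [div_div_div_cancel_right₀ hRc, norm_div, norm_neg, RCLike.norm_conj, div_le_div_iff₀ (norm_pos_iff.2 (fun h => hbne ρ hρ s (by linarith) (by simp only [b, h, zero_div]))) hRR]
    have := hlowb ρ hρ s (by linarith)
    have := hZn ρ hρ
    nlinarith [norm_nonneg ρ]
  have e3 : logDeriv g s = logDeriv g1 s - ∑ ρ ∈ Z, logDeriv (fun s => b ρ s ^ k ρ) s := by rw [e1]; ring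
  refine (norm_add_le _ _).trans (add_le_add ?_ ?_)
  · refine (norm_sum_le _ _).trans (le_of_eq (Finset.sum_congr rfl fun ρ _ => ?_))
    rw [norm_div]; simp
  · rw [e3]
    refine (norm_sub_le _ _).trans ?_
    have h5 : ‖∑ ρ ∈ Z, logDeriv (fun s => b ρ s ^ k ρ) s‖ ≤ n * (1 / (R - R')) := by
      refine (norm_sum_le _ _).trans ((Finset.sum_le_sum e2).trans (le_of_eq ?_))
      rw [← Finset.sum_mul, hn]; push_cast; rfl
    have h6 : (n:ℝ) * (1 / (R - R')) ≤ C1 * M * (1 / (R - R')) := by gcongr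
    have h7 : 0 ≤ C1 * M := by positivity
    have h8 : C1 * M * (1 / (R - R')) = C1 / (R - R') * M := by ring
    rw [h8] at h6
    nlinarith

end DZ

namespace DZ
open Metric MeasureTheory

theorem choose_h (Y : Finset ℝ) (τ : ℝ) : ∃ h ∈ Set.Icc τ (τ+1), ∀ y ∈ Y, 1 / (4 * ((Y.card:ℝ) + 1)) ≤ |h - y| := by
  by_contra! hcon
  set η := 1 / (4 * ((Y.card:ℝ) + 1)) with hη
  have hηp : 0 < η := by positivity
  have hsub : Set.Icc τ (τ+1) ⊆ ⋃ y ∈ Y, ball y η := by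
    intro h hh
    obtain ⟨y, hy, hy2⟩ := hcon h hh
    simp only [Set.mem_iUnion]
    exact ⟨y, hy, by simpa [Real.dist_eq] using hy2⟩
  have h1 : volume (Set.Icc τ (τ+1)) ≤ ∑ y ∈ Y, volume (ball y η) :=
    (measure_mono hsub).trans (measure_biUnion_finset_le _ _)
  simp only [Real.volume_Icc, Real.volume_ball, Finset.sum_const, nsmul_eq_mul] at h1
  rw [← ENNReal.ofReal_natCast, ← ENNReal.ofReal_mul (by positivity)] at h1
  have h2 := (ENNReal.ofReal_le_ofReal_iff (by positivity)).1 h1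
  have h3 : (4 * ((Y.card:ℝ) + 1)) * η = 1 := by rw [hη]; field_simp
  nlinarith

theorem edge1 (N : ℕ) [NeZero N] (χ : DirichletCharacter ℂ N) :
    ∃ C : ℝ, 0 < C ∧ ∀ τ : ℝ, 10 ≤ τ → ∃ Y : Finset ℝ, (Y.card : ℝ) ≤ C * Real.log τ ∧
      ∀ h ∈ Set.Icc τ (τ+1), ∀ η : ℝ, 0 < η → η ≤ 1 → (∀ y ∈ Y, η ≤ |h - y|) → ∀ σ : ℝ, 1/2 ≤ σ → σ ≤ 2 →
        χ.LFunction (σ + h * Complex.I) ≠ 0 ∧ ‖logDeriv χ.LFunction (σ + h * Complex.I)‖ ≤ C * Real.log τ / η := by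
  obtain ⟨C0, hC0, hloc⟩ := local0 (16/10) (17/10) (7/4) 2 (by norm_num) (by norm_num) (by norm_num) (by norm_num)
  obtain ⟨C1, hC1, hgr⟩ := L_growth N χ
  obtain ⟨c2, hc2, hlow⟩ := L_lower N χ
  set A := 2 + |Real.log C1| + |Real.log c2| with hA
  have hAp : 2 ≤ A := by rw [hA]; have := abs_nonneg (Real.log C1); have := abs_nonneg (Real.log c2); linarith
  refine ⟨2 * C0 * A, by positivity, fun τ hτ => ?_⟩
  have hlog1 : 1 ≤ Real.log τ := by
    rw [Real.le_log_iff_exp_le (by linarith)]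
    have := Real.exp_one_lt_d9; linarith
  set M := A * Real.log τ with hM
  have hMp : 0 < M := by positivity
  set c : ℂ := 2 + ((τ + 1/2 : ℝ):ℂ) * Complex.I with hc
  have hcre : c.re = 2 := by simp [hc]
  have hcim : c.im = τ + 1/2 := by simp [hc]
  set Φ : ℂ → ℂ := fun w => χ.LFunction (c + w) with hΦ
  have hΦa : AnalyticOnNhd ℂ Φ (ball 0 2) := by
    refine DifferentiableOn.analyticOnNhd (fun w hw => ?_) isOpen_ball
    have hw2 : ‖w‖ < 2 := by simpa using hw
    have h1 : c + w ≠ 1 := by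
      intro h
      have := congrArg Complex.im h
      simp only [Complex.add_im, hcim, Complex.one_im] at this
      have := (abs_le.1 (Complex.abs_im_le_norm w)).1
      linarith
    have := (DirichletCharacter.differentiableAt_LFunction χ (c + w) (Or.inl h1))
    exact (DifferentiableAt.comp w this (by fun_prop)).differentiableWithinAt
  have hb : ∀ z ∈ closedBall (0:ℂ) (7/4), ‖Φ z‖ ≤ Real.exp M := by
    intro z hz
    have hz2 : ‖z‖ ≤ 7/4 := by simpa using hz
    have hre := (abs_le.1 ((Complex.abs_re_le_norm z).trans hz2))
    have him := (abs_le.1 ((Complex.abs_im_le_norm z).trans hz2))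
    refine (hgr (c + z) (by simp only [Complex.add_re, hcre]; linarith) (by simp only [Complex.add_im, hcim]; linarith)).trans ?_
    have h1 : ‖c + z‖ ≤ τ ^ 2 := by
      have : ‖c‖ ≤ 2 + (τ + 1/2) := by
        rw [hc]; refine (norm_add_le _ _).trans ?_
        rw [norm_mul, Complex.norm_I, Complex.norm_real, Real.norm_of_nonneg (by linarith)]; simp
      have := norm_add_le c z
      nlinarith
    have h2 : C1 * τ ^ 2 = Real.exp (Real.log C1 + 2 * Real.log τ) := by
      rw [Real.exp_add, Real.exp_log hC1, show 2 * Real.log τ = Real.log τ + Real.log τ by ring, Real.exp_add, Real.exp_log (by linarith)]; ring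
    calc C1 * ‖c + z‖ ≤ C1 * τ ^ 2 := by gcongr
      _ ≤ _ := by
        rw [h2, Real.exp_le_exp, hM, hA]
        have := le_abs_self (Real.log C1)
        have : |Real.log C1| ≤ |Real.log C1| * Real.log τ := le_mul_of_one_le_right (abs_nonneg _) hlog1
        have : 0 ≤ |Real.log c2| * Real.log τ := by positivity
        nlinarith
  have h0 : Real.exp (-M) ≤ ‖Φ 0‖ := by
    refine le_trans ?_ (hlow (c + 0) (by simp [hcre]))
    rw [← Real.le_log_iff_exp_le hc2, hM, hA]
    have := neg_abs_le (Real.log c2)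
    have : |Real.log c2| ≤ |Real.log c2| * Real.log τ := le_mul_of_one_le_right (abs_nonneg _) hlog1
    have : 0 ≤ |Real.log C1| * Real.log τ := by positivity
    nlinarith
  obtain ⟨Z, k, hk, hk1, hZ⟩ := hloc Φ M hMp hΦa hb h0
  classical
  refine ⟨Z.image (fun ρ => ρ.im + (τ + 1/2)), ?_, ?_⟩
  · have h1 : (Z.image (fun ρ => ρ.im + (τ + 1/2))).card ≤ ∑ ρ ∈ Z, k ρ := by
      refine Finset.card_image_le.trans ?_
      rw [Finset.card_eq_sum_ones]
      exact Finset.sum_le_sum hk1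
    have h2 : ((Z.image (fun ρ => ρ.im + (τ + 1/2))).card : ℝ) ≤ ((∑ ρ ∈ Z, k ρ : ℕ):ℝ) := by exact_mod_cast h1
    refine h2.trans (hk.trans ?_)
    rw [hM]
    have : 0 ≤ C0 * A * Real.log τ := by positivity
    nlinarith
  intro h hh η hη hη1 hY σ hσ1 hσ2
  set s : ℂ := (σ + h * Complex.I) - c with hs
  have hsc : c + s = σ + h * Complex.I := by rw [hs]; ring
  have hsre : s.re = σ - 2 := by simp [hs, hcre]
  have hsim : s.im = h - (τ + 1/2) := by simp [hs, hcim]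
  have hsb : s ∈ closedBall (0:ℂ) (16/10) := by
    simp only [mem_closedBall, dist_zero_right]
    rw [← Real.sqrt_sq (norm_nonneg s), ← Complex.normSq_eq_norm_sq, Complex.normSq_apply, hsre, hsim]
    refine Real.sqrt_le_iff.2 ⟨by norm_num, ?_⟩
    nlinarith [hh.1, hh.2]
  have hd : ∀ ρ ∈ Z, η ≤ ‖s - ρ‖ := by
    intro ρ hρ
    have h1 := hY _ (Finset.mem_image_of_mem _ hρ)
    refine h1.trans ?_
    have := Complex.abs_im_le_norm (s - ρ)
    rw [Complex.sub_im, hsim] at this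
    refine le_trans (le_of_eq ?_) this
    congr 1; ring
  have hsZ : s ∉ Z := fun hm => by
    have := hd s hm
    simp at this; linarith
  obtain ⟨e1, e2⟩ := hZ s hsb hsZ
  have hl : logDeriv Φ s = logDeriv χ.LFunction (σ + h * Complex.I) := by
    rw [logDeriv_apply, logDeriv_apply]
    simp only [hΦ]
    rw [deriv_comp_const_add, hsc]
  simp only [hΦ, hsc] at e1
  refine ⟨e1, ?_⟩
  rw [← hl]
  refine e2.trans ?_
  have h3 : ∑ ρ ∈ Z, (k ρ : ℝ) / ‖s - ρ‖ ≤ C0 * M / η := by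
    calc _ ≤ ∑ ρ ∈ Z, (k ρ : ℝ) / η := Finset.sum_le_sum fun ρ hρ => by
          have := hd ρ hρ
          gcongr
      _ = ((∑ ρ ∈ Z, k ρ : ℕ):ℝ) / η := by rw [← Finset.sum_div]; push_cast; rfl
      _ ≤ _ := by gcongr
  have h4 : C0 * M ≤ C0 * M / η := by
    rw [le_div_iff₀ hη]; exact mul_le_of_le_one_right (by positivity) hη1
  calc _ ≤ C0 * M / η + C0 * M / η := add_le_add h3 h4
    _ = _ := by rw [hM]; ring

theorem edge_family {ι : Type*} [Fintype ι] (χ : ι → Σ n : ℕ, DirichletCharacter ℂ n) (hmod : ∀ i, (χ i).1 ≠ 0) :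
    ∃ C : ℝ, 0 < C ∧ ∀ τ : ℝ, 10 ≤ τ → ∃ h ∈ Set.Icc τ (τ+1), ∀ i, ∀ σ : ℝ, 1/2 ≤ σ → σ ≤ 2 →
      haveI : NeZero (χ i).1 := ⟨hmod i⟩
      (χ i).2.LFunction (σ + h * Complex.I) ≠ 0 ∧
      ‖logDeriv (χ i).2.LFunction (σ + h * Complex.I)‖ ≤ C * Real.log τ ^ 2 := by
  classical
  have hex : ∀ i, haveI : NeZero (χ i).1 := ⟨hmod i⟩
    ∃ C : ℝ, 0 < C ∧ ∀ τ : ℝ, 10 ≤ τ → ∃ Y : Finset ℝ, (Y.card : ℝ) ≤ C * Real.log τ ∧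
      ∀ h ∈ Set.Icc τ (τ+1), ∀ η : ℝ, 0 < η → η ≤ 1 → (∀ y ∈ Y, η ≤ |h - y|) → ∀ σ : ℝ, 1/2 ≤ σ → σ ≤ 2 →
        (χ i).2.LFunction (σ + h * Complex.I) ≠ 0 ∧ ‖logDeriv (χ i).2.LFunction (σ + h * Complex.I)‖ ≤ C * Real.log τ / η := by
    intro i
    haveI : NeZero (χ i).1 := ⟨hmod i⟩
    exact edge1 _ _
  choose C hC hY using hex
  set S := ∑ i, C i with hS
  have hS0 : 0 ≤ S := Finset.sum_nonneg fun i _ => (hC i).le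
  refine ⟨(S + 1) * (4 * (S + 1)), by positivity, fun τ hτ => ?_⟩
  have hlog1 : 1 ≤ Real.log τ := by
    rw [Real.le_log_iff_exp_le (by linarith)]
    have := Real.exp_one_lt_d9; linarith
  choose Y hYc hYb using fun i => hY i τ hτ
  obtain ⟨h, hh, hd⟩ := choose_h (Finset.univ.biUnion Y) τ
  refine ⟨h, hh, fun i σ h1 h2 => ?_⟩
  set n := (Finset.univ.biUnion Y).card with hn
  have hcard : (n:ℝ) ≤ S * Real.log τ := by
    have : (n:ℝ) ≤ ∑ i, ((Y i).card:ℝ) := by exact_mod_cast Finset.card_biUnion_le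
    refine this.trans ((Finset.sum_le_sum fun i _ => hYc i).trans (le_of_eq ?_))
    rw [hS, Finset.sum_mul]
  obtain ⟨e1, e2⟩ := hYb i h hh (1 / (4 * ((n:ℝ) + 1))) (by positivity) (by
    rw [div_le_one (by positivity)]; have : (0:ℝ) ≤ n := by positivity
    linarith) (fun y hy => hd y (Finset.mem_biUnion.2 ⟨i, Finset.mem_univ _, hy⟩)) σ h1 h2
  refine ⟨e1, e2.trans ?_⟩
  have hCS : C i ≤ S := Finset.single_le_sum (fun j _ => (hC j).le) (Finset.mem_univ i)
  have h5 : (n:ℝ) + 1 ≤ (S + 1) * Real.log τ := by nlinarith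
  rw [div_div_eq_mul_div, div_one]
  calc C i * Real.log τ * (4 * ((n:ℝ) + 1)) ≤ (S + 1) * Real.log τ * (4 * ((S + 1) * Real.log τ)) := by
        gcongr; linarith
    _ = _ := by ring

end DZ

namespace DZ
open Complex

theorem logDeriv_L_eq (N : ℕ) [NeZero N] (χ : DirichletCharacter ℂ N) {s : ℂ} (hs : 1 < s.re) :
    logDeriv χ.LFunction s = -LSeries (fun n => (ArithmeticFunction.vonMangoldt n : ℂ) * χ n) s := by
  have h := DirichletCharacter.LSeries_twist_vonMangoldt_eq χ hs
  rw [← DirichletCharacter.deriv_LFunction_eq_deriv_LSeries χ hs, ← DirichletCharacter.LFunction_eq_LSeries χ hs] at h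
  rw [logDeriv_apply]
  have h2 : LSeries (fun n => (ArithmeticFunction.vonMangoldt n : ℂ) * χ n) s = LSeries ((fun n : ℕ => χ n) * fun n => (ArithmeticFunction.vonMangoldt n : ℂ)) s :=
    LSeries_congr (fun _ => by simp [mul_comm]) s
  rw [h2, h]; ring

theorem logDeriv_L_bdd (N : ℕ) [NeZero N] (χ : DirichletCharacter ℂ N) :
    ∃ K : ℝ, 0 < K ∧ ∀ s : ℂ, 3/2 ≤ s.re → ‖logDeriv χ.LFunction s‖ ≤ K := by
  have hsum := (ArithmeticFunction.LSeriesSummable_vonMangoldt (s := ((3/2:ℝ):ℂ)) (by norm_num)).norm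
  refine ⟨1 + ∑' n, ‖LSeries.term (fun n => (ArithmeticFunction.vonMangoldt n : ℂ)) ((3/2:ℝ):ℂ) n‖, by positivity, fun s hs => ?_⟩
  rw [logDeriv_L_eq N χ (by linarith), norm_neg]
  refine le_trans ?_ (le_add_of_nonneg_left zero_le_one)
  refine tsum_of_norm_bounded hsum.hasSum fun n => ?_
  rw [LSeries.norm_term_eq, LSeries.norm_term_eq]
  split_ifs with hn
  · rfl
  · rw [norm_mul]
    have hn1 : (1:ℝ) ≤ n := by exact_mod_cast Nat.one_le_iff_ne_zero.2 hn
    have := χ.norm_le_one (n : ZMod N)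
    simp only [ofReal_re]
    gcongr
    exact mul_le_of_le_one_right (norm_nonneg _) this

theorem L_conj (N : ℕ) [NeZero N] (χ : DirichletCharacter ℂ N) {s : ℂ} (hs : s ≠ 1) :
    χ⁻¹.LFunction s = (starRingEnd ℂ) (χ.LFunction ((starRingEnd ℂ) s)) := by
  have ho : IsOpen ({1}ᶜ : Set ℂ) := isOpen_compl_singleton
  have ha : AnalyticOnNhd ℂ (χ⁻¹.LFunction) ({1}ᶜ : Set ℂ) :=
    DifferentiableOn.analyticOnNhd (fun w hw => (DirichletCharacter.differentiableAt_LFunction χ⁻¹ w (Or.inl hw)).differentiableWithinAt) ho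
  have hb : AnalyticOnNhd ℂ ((starRingEnd ℂ) ∘ χ.LFunction ∘ (starRingEnd ℂ)) ({1}ᶜ : Set ℂ) := by
    refine DifferentiableOn.analyticOnNhd (fun w hw => (differentiableAt_conj_conj_iff.2 (DirichletCharacter.differentiableAt_LFunction χ _ (Or.inl ?_))).differentiableWithinAt) ho
    intro h
    apply hw
    have := congrArg (starRingEnd ℂ) h
    simpa using this
  have hp : IsPreconnected ({1}ᶜ : Set ℂ) := (isConnected_compl_singleton_of_one_lt_rank (by simp) (1:ℂ)).isPreconnected
  have he : (χ⁻¹.LFunction) =ᶠ[𝓝 (2:ℂ)] ((starRingEnd ℂ) ∘ χ.LFunction ∘ (starRingEnd ℂ)) := by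
    have : {z : ℂ | 1 < z.re} ∈ 𝓝 (2:ℂ) := (isOpen_lt continuous_const continuous_re).mem_nhds (by simp)
    filter_upwards [this] with z hz
    have hz' : 1 < z.re := hz
    simp only [Function.comp]
    rw [DirichletCharacter.LFunction_eq_LSeries _ hz', DirichletCharacter.LFunction_eq_LSeries _ (by simpa using hz')]
    simp only [LSeries]
    rw [conj_tsum]
    refine tsum_congr fun n => ?_
    by_cases hn : n = 0
    · simp [hn]
    · rw [LSeries.term_of_ne_zero hn, LSeries.term_of_ne_zero hn, map_div₀, MulChar.inv_apply_eq_inv']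
      have hcp := cpow_conj (n:ℂ) z (by rw [natCast_arg]; exact Real.pi_pos.ne)
      rw [conj_natCast] at hcp
      rw [hcp, conj_conj]
      congr 1
      by_cases hu : IsUnit (n : ZMod N)
      · have h1 := DirichletCharacter.unit_norm_eq_one χ hu.unit
        exact Complex.inv_eq_conj (by simpa using h1)
      · rw [MulChar.map_nonunit _ hu]; simp
  exact ha.eqOn_of_preconnected_of_eventuallyEq hb hp (by simp) he hs

theorem L_conj_ld (N : ℕ) [NeZero N] (χ : DirichletCharacter ℂ N) {s : ℂ} (hs : s ≠ 1) :
    ‖logDeriv χ⁻¹.LFunction s‖ = ‖logDeriv χ.LFunction ((starRingEnd ℂ) s)‖ := by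
  have he : (χ⁻¹.LFunction) =ᶠ[𝓝 s] ((starRingEnd ℂ) ∘ χ.LFunction ∘ (starRingEnd ℂ)) := by
    filter_upwards [isOpen_compl_singleton.mem_nhds (show s ∈ ({1}ᶜ : Set ℂ) from hs)] with z hz
    exact L_conj N χ hz
  rw [(logDeriv_congr_nhds he).self_of_nhds, logDeriv_apply, deriv_conj_conj, logDeriv_apply]
  simp only [Function.comp]
  rw [norm_div, norm_div, RCLike.norm_conj, RCLike.norm_conj]

theorem trig_bound {z : ℂ} (hz : 1 ≤ z.im) :
    Complex.cos z ≠ 0 ∧ Complex.sin z ≠ 0 ∧ ‖Complex.sin z / Complex.cos z‖ ≤ 3 ∧ ‖Complex.cos z / Complex.sin z‖ ≤ 3 := by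
  set u := cexp (z * I) with hu
  set v := cexp (-z * I) with hv
  have hun : ‖u‖ = Real.exp (-z.im) := by rw [hu, norm_exp]; simp
  have hvn : ‖v‖ = Real.exp (z.im) := by rw [hv, norm_exp]; simp
  have huv : 2 * ‖u‖ ≤ ‖v‖ := by
    rw [hun, hvn]
    have h1 := Real.add_one_le_exp z.im
    have h2 : Real.exp (-z.im) ≤ 1 := Real.exp_le_one_iff.2 (by linarith)
    linarith
  have hvp : 0 < ‖v‖ := by rw [hvn]; exact Real.exp_pos _
  have hc : Complex.cos z = (u + v) / 2 := rfl
  have hs : Complex.sin z = (v - u) * I / 2 := rfl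
  have b1 : ‖u + v‖ ≤ 3/2 * ‖v‖ := (norm_add_le _ _).trans (by linarith)
  have b2 : ‖v - u‖ ≤ 3/2 * ‖v‖ := (norm_sub_le _ _).trans (by linarith)
  have b3 : 1/2 * ‖v‖ ≤ ‖u + v‖ := by
    have := norm_sub_norm_le v (-u)
    rw [norm_neg, sub_neg_eq_add, add_comm v u] at this; linarith
  have b4 : 1/2 * ‖v‖ ≤ ‖v - u‖ := by
    have := norm_sub_norm_le v u
    linarith
  have nc : ‖Complex.cos z‖ = ‖u + v‖ / 2 := by rw [hc]; simp
  have ns : ‖Complex.sin z‖ = ‖v - u‖ / 2 := by rw [hs]; simp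
  have pc : 0 < ‖Complex.cos z‖ := by rw [nc]; linarith
  have ps : 0 < ‖Complex.sin z‖ := by rw [ns]; linarith
  refine ⟨norm_pos_iff.1 pc, norm_pos_iff.1 ps, ?_, ?_⟩
  · rw [norm_div, div_le_iff₀ pc, nc, ns]; linarith
  · rw [norm_div, div_le_iff₀ ps, nc, ns]; linarith

theorem ld_cos {s : ℂ} (hs : 1 ≤ s.im) : ‖logDeriv (fun s : ℂ => Complex.cos (Real.pi * s / 2)) s‖ ≤ 6 := by
  have h : 1 ≤ (Real.pi * s / 2 : ℂ).im := by
    have : (Real.pi * s / 2 : ℂ).im = Real.pi * s.im / 2 := by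
      rw [show (Real.pi * s / 2 : ℂ) = ((Real.pi / 2 : ℝ):ℂ) * s by push_cast; ring, Complex.im_ofReal_mul]; ring
    rw [this]; nlinarith [Real.pi_gt_three]
  have hd : HasDerivAt (fun s : ℂ => Complex.cos (Real.pi * s / 2)) (-Complex.sin (Real.pi * s / 2) * (Real.pi * 1 / 2)) s :=
    (((hasDerivAt_id s).const_mul (Real.pi : ℂ)).div_const 2).ccos
  rw [logDeriv_apply, hd.deriv, mul_div_right_comm, norm_mul, neg_div, norm_neg]
  have hp : ‖(Real.pi * 1 / 2 : ℂ)‖ ≤ 2 := by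
    rw [show (Real.pi * 1 / 2 : ℂ) = ((Real.pi / 2 : ℝ):ℂ) by push_cast; ring, Complex.norm_real, Real.norm_of_nonneg (by positivity)]
    linarith [Real.pi_le_four]
  calc _ ≤ (3:ℝ) * 2 := mul_le_mul (trig_bound h).2.2.1 hp (norm_nonneg _) (by norm_num)
    _ = 6 := by norm_num

theorem ld_sin {s : ℂ} (hs : 1 ≤ s.im) : ‖logDeriv (fun s : ℂ => Complex.sin (Real.pi * s / 2)) s‖ ≤ 6 := by
  have h : 1 ≤ (Real.pi * s / 2 : ℂ).im := by
    have : (Real.pi * s / 2 : ℂ).im = Real.pi * s.im / 2 := by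
      rw [show (Real.pi * s / 2 : ℂ) = ((Real.pi / 2 : ℝ):ℂ) * s by push_cast; ring, Complex.im_ofReal_mul]; ring
    rw [this]; nlinarith [Real.pi_gt_three]
  have hd : HasDerivAt (fun s : ℂ => Complex.sin (Real.pi * s / 2)) (Complex.cos (Real.pi * s / 2) * (Real.pi * 1 / 2)) s :=
    (((hasDerivAt_id s).const_mul (Real.pi : ℂ)).div_const 2).csin
  rw [logDeriv_apply, hd.deriv, mul_div_right_comm, norm_mul]
  have hp : ‖(Real.pi * 1 / 2 : ℂ)‖ ≤ 2 := by
    rw [show (Real.pi * 1 / 2 : ℂ) = ((Real.pi / 2 : ℝ):ℂ) by push_cast; ring, Complex.norm_real, Real.norm_of_nonneg (by positivity)]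
    linarith [Real.pi_le_four]
  calc _ ≤ (3:ℝ) * 2 := mul_le_mul (trig_bound h).2.2.2 hp (norm_nonneg _) (by norm_num)
    _ = 6 := by norm_num

theorem trig_ne {s : ℂ} (hs : 1 ≤ s.im) : Complex.cos (Real.pi * s / 2) ≠ 0 ∧ Complex.sin (Real.pi * s / 2) ≠ 0 := by
  have h : 1 ≤ (Real.pi * s / 2 : ℂ).im := by
    have : (Real.pi * s / 2 : ℂ).im = Real.pi * s.im / 2 := by
      rw [show (Real.pi * s / 2 : ℂ) = ((Real.pi / 2 : ℝ):ℂ) * s by push_cast; ring, Complex.im_ofReal_mul]; ring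
    rw [this]; nlinarith [Real.pi_gt_three]
  exact ⟨(trig_bound h).1, (trig_bound h).2.1⟩

theorem im_ne {s : ℂ} (hs : s.im ≠ 0) (n : ℕ) : s ≠ -n := by
  intro h; apply hs; rw [h]; simp

theorem GR_ne {s : ℂ} (hs : s.im ≠ 0) : Gammaℝ s ≠ 0 := by
  rw [Ne, Gammaℝ_eq_zero_iff]; rintro ⟨n, h⟩
  apply hs; rw [h]; simp

theorem inv_parity {N : ℕ} {χ : DirichletCharacter ℂ N} : (χ.Even → χ⁻¹.Even) ∧ (χ.Odd → χ⁻¹.Odd) := by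
  constructor
  · intro h
    rw [DirichletCharacter.Even, MulChar.inv_apply_eq_inv', h]; simp
  · intro h
    rw [DirichletCharacter.Odd, MulChar.inv_apply_eq_inv', h]; norm_num

/-- functional equation in asymmetric form -/
theorem fe (N : ℕ) [NeZero N] (χ : DirichletCharacter ℂ N) (hχ : χ.IsPrimitive) :
    ∃ tr : ℂ → ℂ, (tr = (fun s : ℂ => Complex.cos (Real.pi * s / 2)) ∨ tr = (fun s : ℂ => Complex.sin (Real.pi * s / 2))) ∧
      ∀ s : ℂ, s.im ≠ 0 → χ.LFunction s * (Gammaℂ s * tr s) = ((N:ℂ) ^ (1 - s - 1/2) * χ.rootNumber) * χ⁻¹.LFunction (1 - s) := by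
  have key : ∀ s : ℂ, s.im ≠ 0 → χ.LFunction s * χ.gammaFactor s = ((N:ℂ) ^ (1 - s - 1/2) * χ.rootNumber) * (χ⁻¹.LFunction (1 - s) * χ⁻¹.gammaFactor (1 - s)) := by
    intro s hs
    have hs0 : s ≠ 0 := by rintro rfl; simp at hs
    have hs1 : 1 - s ≠ 0 := by
      intro h; apply hs; have := congrArg Complex.im h; simp at this; exact this
    have g1 : χ.gammaFactor s ≠ 0 := by
      rcases χ.even_or_odd with h | h
      · rw [h.gammaFactor_def]; exact GR_ne hs
      · rw [h.gammaFactor_def]; exact GR_ne (by simpa using hs)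
    have g2 : χ⁻¹.gammaFactor (1 - s) ≠ 0 := by
      rcases χ⁻¹.even_or_odd with h | h
      · rw [h.gammaFactor_def]; exact GR_ne (by simpa using hs)
      · rw [h.gammaFactor_def]; exact GR_ne (by simpa using hs)
    rw [DirichletCharacter.LFunction_eq_completed_div_gammaFactor χ s (Or.inl hs0), DirichletCharacter.LFunction_eq_completed_div_gammaFactor χ⁻¹ (1 - s) (Or.inl hs1),
      div_mul_cancel₀ _ g1, div_mul_cancel₀ _ g2, ← hχ.completedLFunction_one_sub, sub_sub_cancel]
  rcases χ.even_or_odd with h | h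
  · refine ⟨_, Or.inl rfl, fun s hs => ?_⟩
    have k := key s hs
    have e := inv_Gammaℝ_one_sub (im_ne hs)
    rw [h.gammaFactor_def, (inv_parity.1 h).gammaFactor_def] at k
    have g1 : Gammaℝ s ≠ 0 := GR_ne hs
    have g2 : Gammaℝ (1 - s) ≠ 0 := GR_ne (by simpa using hs)
    have e2 : Gammaℂ s * Complex.cos (Real.pi * s / 2) = Gammaℝ s * (Gammaℝ (1 - s))⁻¹ := by rw [e]; field_simp
    rw [e2, ← mul_assoc, k]; field_simp
  · refine ⟨_, Or.inr rfl, fun s hs => ?_⟩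
    have k := key s hs
    have e := inv_Gammaℝ_two_sub (im_ne hs)
    rw [h.gammaFactor_def, (inv_parity.2 h).gammaFactor_def, show 1 - s + 1 = 2 - s by ring] at k
    have g1 : Gammaℝ (s + 1) ≠ 0 := GR_ne (by simpa using hs)
    have g2 : Gammaℝ (2 - s) ≠ 0 := GR_ne (by simpa using hs)
    have e2 : Gammaℂ s * Complex.sin (Real.pi * s / 2) = Gammaℝ (s + 1) * (Gammaℝ (2 - s))⁻¹ := by rw [e]; field_simp
    rw [e2, ← mul_assoc, k]; field_simp

theorem GC_ne {s : ℂ} (hs : s.im ≠ 0) : Gammaℂ s ≠ 0 := by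
  rw [← Gammaℝ_mul_Gammaℝ_add_one]
  exact mul_ne_zero (GR_ne hs) (GR_ne (by simpa using hs))

theorem GC_diff {s : ℂ} (hs : s.im ≠ 0) : DifferentiableAt ℂ Gammaℂ s := by
  have := (differentiable_Gammaℂ_inv s).inv (inv_ne_zero (GC_ne hs))
  exact (show (fun s => (Gammaℂ s)⁻¹)⁻¹ = Gammaℂ from by ext z; simp) ▸ this

theorem fe_ld (N : ℕ) [NeZero N] (χ : DirichletCharacter ℂ N) (hχ : χ.IsPrimitive) :
    ∃ K : ℝ, 0 < K ∧ ∀ s : ℂ, 1 ≤ s.im → χ.LFunction (1 - (starRingEnd ℂ) s) ≠ 0 →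
      χ.LFunction s ≠ 0 ∧ ‖logDeriv χ.LFunction s + logDeriv Gammaℂ s‖ ≤ K + ‖logDeriv χ.LFunction (1 - (starRingEnd ℂ) s)‖ := by
  obtain ⟨tr, htr, hfe⟩ := fe N χ hχ
  have hN0 : (N:ℂ) ≠ 0 := by exact_mod_cast NeZero.ne N
  have htrne : ∀ s : ℂ, 1 ≤ s.im → tr s ≠ 0 ∧ ‖logDeriv tr s‖ ≤ 6 ∧ DifferentiableAt ℂ tr s := by
    intro s hs
    rcases htr with rfl | rfl
    · exact ⟨(trig_ne hs).1, ld_cos hs, by fun_prop⟩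
    · exact ⟨(trig_ne hs).2, ld_sin hs, by fun_prop⟩
  have hroot : χ.rootNumber ≠ 0 := by
    intro h0
    have := hfe (2 + I) (by simp)
    rw [h0] at this
    simp only [mul_zero, zero_mul, mul_eq_zero] at this
    rcases this with h | h | h
    · exact DirichletCharacter.LFunction_ne_zero_of_one_le_re χ (s := 2 + I) (Or.inr (by intro h; have := congrArg Complex.re h; norm_num at this)) (by simp) h
    · exact GC_ne (s := 2 + I) (by simp) h
    · exact (htrne (2 + I) (by simp)).1 h
  refine ⟨6 + ‖Complex.log N‖, by positivity, fun s hs hne => ?_⟩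
  have him : s.im ≠ 0 := by linarith
  have hs1 : 1 - s ≠ 1 := by intro h; apply him; have := congrArg Complex.im h; simpa using this
  have hss : s ≠ 1 := by intro h; apply him; rw [h]; simp
  have hcj : (starRingEnd ℂ) (1 - s) = 1 - (starRingEnd ℂ) s := by simp
  have hinv : χ⁻¹.LFunction (1 - s) ≠ 0 := by
    rw [L_conj N χ hs1, hcj]; simpa using hne
  have hpow : (N:ℂ) ^ (1 - s - 1/2) ≠ 0 := by rw [Ne, Complex.cpow_eq_zero_iff]; tauto
  have hrhs : ((N:ℂ) ^ (1 - s - 1/2) * χ.rootNumber) * χ⁻¹.LFunction (1 - s) ≠ 0 := mul_ne_zero (mul_ne_zero hpow hroot) hinv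
  have hL : χ.LFunction s ≠ 0 := by
    intro h; apply hrhs; rw [← hfe s him, h, zero_mul]
  refine ⟨hL, ?_⟩
  obtain ⟨t1, t2, t3⟩ := htrne s hs
  have hdL := DirichletCharacter.differentiableAt_LFunction χ s (Or.inl hss)
  have hdL' := DirichletCharacter.differentiableAt_LFunction χ⁻¹ (1 - s) (Or.inl hs1)
  have he : (fun s => χ.LFunction s * (Gammaℂ s * tr s)) =ᶠ[𝓝 s] (fun s => ((N:ℂ) ^ (1 - s - 1/2) * χ.rootNumber) * χ⁻¹.LFunction (1 - s)) := by
    filter_upwards [(isOpen_lt continuous_const continuous_im).mem_nhds (show s ∈ {z : ℂ | 0 < z.im} from by show 0 < s.im; linarith)] with z hz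
    exact hfe z (ne_of_gt hz)
  have hd1 : HasDerivAt (fun s : ℂ => (N:ℂ) ^ (1 - s - 1/2)) ((N:ℂ) ^ (1 - s - 1/2) * Complex.log N * (-1)) s :=
    HasDerivAt.const_cpow (((hasDerivAt_id s).const_sub 1).sub_const _) (Or.inl hN0)
  have hcomp : logDeriv (fun s => χ⁻¹.LFunction (1 - s)) s = - logDeriv χ⁻¹.LFunction (1 - s) := by
    have := logDeriv_comp (f := χ⁻¹.LFunction) (g := fun s => 1 - s) (x := s) hdL' (by fun_prop)
    rw [Function.comp_def] at this
    rw [this]; simp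
  have h1 := (logDeriv_congr_nhds he).self_of_nhds
  rw [logDeriv_mul (f := χ.LFunction) (g := fun s => Gammaℂ s * tr s) s hL (mul_ne_zero (GC_ne him) t1) hdL ((GC_diff him).mul t3), logDeriv_mul (f := Gammaℂ) (g := tr) s (GC_ne him) t1 (GC_diff him) t3,
    logDeriv_mul (f := fun s => (N:ℂ) ^ (1 - s - 1/2) * χ.rootNumber) (g := fun s => χ⁻¹.LFunction (1 - s)) s (mul_ne_zero hpow hroot) hinv (hd1.differentiableAt.mul_const _)
      (hdL'.comp s (by fun_prop)), logDeriv_mul_const _ _ hroot, hcomp, logDeriv_apply (fun s : ℂ => (N:ℂ) ^ (1 - s - 1/2)), hd1.deriv] at h1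
  have h2 : (N:ℂ) ^ (1 - s - 1/2) * Complex.log N * (-1) / (N:ℂ) ^ (1 - s - 1/2) = - Complex.log N := by
    generalize (N:ℂ) ^ (1 - s - 1/2) = P at hpow
    field_simp
  rw [h2] at h1
  have h3 : logDeriv χ.LFunction s + logDeriv Gammaℂ s = -Complex.log N - logDeriv χ⁻¹.LFunction (1 - s) - logDeriv tr s := by
    linear_combination h1
  rw [h3]
  have h4 := L_conj_ld N χ hs1
  rw [hcj] at h4
  rw [← h4]
  calc _ ≤ ‖-Complex.log N‖ + ‖logDeriv χ⁻¹.LFunction (1 - s)‖ + ‖logDeriv tr s‖ := (norm_sub_le _ _).trans (add_le_add_left (norm_sub_le _ _) _)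
    _ ≤ _ := by rw [norm_neg]; linarith

end DZ

namespace DZ
open Complex

noncomputable def LF (x : Σ n : ℕ, DirichletCharacter ℂ n) (h : x.1 ≠ 0) (s : ℂ) : ℂ :=
  haveI : NeZero x.1 := ⟨h⟩
  x.2.LFunction s

theorem LF_diff (x : Σ n : ℕ, DirichletCharacter ℂ n) (h : x.1 ≠ 0) {s : ℂ} (hs : s ≠ 1) : DifferentiableAt ℂ (LF x h) s := by
  haveI : NeZero x.1 := ⟨h⟩
  exact DirichletCharacter.differentiableAt_LFunction x.2 s (Or.inl hs)

theorem LF_ne (x : Σ n : ℕ, DirichletCharacter ℂ n) (h : x.1 ≠ 0) {s : ℂ} (hs : s ≠ 1) (h1 : 1 ≤ s.re) : LF x h s ≠ 0 := by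
  haveI : NeZero x.1 := ⟨h⟩
  exact DirichletCharacter.LFunction_ne_zero_of_one_le_re x.2 (Or.inr hs) h1

theorem LF_ld (x : Σ n : ℕ, DirichletCharacter ℂ n) (h : x.1 ≠ 0) {s : ℂ} (hs : 1 < s.re) :
    logDeriv (LF x h) s = -LSeries (fun n => (ArithmeticFunction.vonMangoldt n : ℂ) * x.2 n) s := by
  haveI : NeZero x.1 := ⟨h⟩
  exact logDeriv_L_eq x.1 x.2 hs

theorem LF_bdd (x : Σ n : ℕ, DirichletCharacter ℂ n) (h : x.1 ≠ 0) :
    ∃ K : ℝ, 0 < K ∧ ∀ s : ℂ, 3/2 ≤ s.re → ‖logDeriv (LF x h) s‖ ≤ K := by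
  haveI : NeZero x.1 := ⟨h⟩
  exact logDeriv_L_bdd x.1 x.2

theorem LF_fe (x : Σ n : ℕ, DirichletCharacter ℂ n) (h : x.1 ≠ 0) (hp : x.2.IsPrimitive) :
    ∃ K : ℝ, 0 < K ∧ ∀ s : ℂ, 1 ≤ s.im → LF x h (1 - (starRingEnd ℂ) s) ≠ 0 →
      LF x h s ≠ 0 ∧ ‖logDeriv (LF x h) s + logDeriv Gammaℂ s‖ ≤ K + ‖logDeriv (LF x h) (1 - (starRingEnd ℂ) s)‖ := by
  haveI : NeZero x.1 := ⟨h⟩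
  exact fe_ld x.1 x.2 hp

theorem ne_one_of_im {s : ℂ} (h : 0 < s.im) : s ≠ 1 := by rintro rfl; simp at h

theorem LF_ne_left (x : Σ n : ℕ, DirichletCharacter ℂ n) (h : x.1 ≠ 0) (hp : x.2.IsPrimitive) {s : ℂ} (hs : 1 ≤ s.im) (hr : s.re ≤ 0) :
    LF x h s ≠ 0 := by
  obtain ⟨K, _, hK⟩ := LF_fe x h hp
  refine (hK s hs (LF_ne x h ?_ ?_)).1
  · apply ne_one_of_im; simp; linarith
  · simp; linarith

noncomputable def Lp {m : ℕ} (χ : Fin m → Σ n : ℕ, DirichletCharacter ℂ n) (hmod : ∀ i, (χ i).1 ≠ 0) (s : ℂ) : ℂ :=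
  ∏ i, LF (χ i) (hmod i) s

section
variable {m : ℕ} (χ χ₁ χ₂ : Fin m → Σ n : ℕ, DirichletCharacter ℂ n) (hmod : ∀ i, (χ i).1 ≠ 0)
  (hmod₁ : ∀ i, (χ₁ i).1 ≠ 0) (hmod₂ : ∀ i, (χ₂ i).1 ≠ 0)

theorem Lp_diff {s : ℂ} (hs : s ≠ 1) : DifferentiableAt ℂ (Lp χ hmod) s := by
  have : Lp χ hmod = fun s => ∏ i, LF (χ i) (hmod i) s := rfl
  rw [this]
  exact DifferentiableAt.fun_finset_prod fun i _ => LF_diff (χ i) (hmod i) hs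

theorem Lp_analytic : AnalyticOnNhd ℂ (Lp χ hmod) {s : ℂ | 0 < s.im} :=
  DifferentiableOn.analyticOnNhd (fun _ hs => (Lp_diff χ hmod (ne_one_of_im hs)).differentiableWithinAt)
    (isOpen_lt continuous_const continuous_im)

theorem Lp_ne_iff {s : ℂ} : Lp χ hmod s ≠ 0 ↔ ∀ i, LF (χ i) (hmod i) s ≠ 0 := by
  simp [Lp, Finset.prod_eq_zero_iff]

theorem Lp_ne_out (hp : ∀ i, (χ i).2.IsPrimitive) {s : ℂ} (hs : 1 ≤ s.im) (hr : s.re ≤ 0 ∨ 1 ≤ s.re) : Lp χ hmod s ≠ 0 := by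
  rw [Lp_ne_iff]
  intro i
  rcases hr with hr | hr
  · exact LF_ne_left (χ i) (hmod i) (hp i) hs hr
  · exact LF_ne (χ i) (hmod i) (ne_one_of_im (by linarith)) hr

theorem Lp_ld {s : ℂ} (hs : s ≠ 1) (hne : Lp χ hmod s ≠ 0) : logDeriv (Lp χ hmod) s = ∑ i, logDeriv (LF (χ i) (hmod i)) s := by
  have : Lp χ hmod = fun s => ∏ i, LF (χ i) (hmod i) s := rfl
  rw [this]
  exact logDeriv_prod (s := Finset.univ) (f := fun i => LF (χ i) (hmod i)) (fun i _ => (Lp_ne_iff χ hmod).1 hne i) (fun i _ => LF_diff (χ i) (hmod i) hs)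

noncomputable def ff (s : ℂ) : ℂ := logDeriv (Lp χ₁ hmod₁) s - logDeriv (Lp χ₂ hmod₂) s

noncomputable def aa (n : ℕ) : ℂ := ∑ i, ((χ₁ i).2 n - (χ₂ i).2 n)

theorem aa_norm (n : ℕ) : ‖aa χ₁ χ₂ n‖ ≤ 2 * m := by
  refine (norm_sum_le _ _).trans ?_
  calc _ ≤ ∑ i : Fin m, (2:ℝ) := Finset.sum_le_sum fun i _ => by
        refine (norm_sub_le _ _).trans ?_
        have := (χ₁ i).2.norm_le_one n
        have := (χ₂ i).2.norm_le_one n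
        linarith
    _ = _ := by simp; ring

theorem ff_right {s : ℂ} (hs : 1 < s.re) :
    ff χ₁ χ₂ hmod₁ hmod₂ s = -LSeries (fun n => (ArithmeticFunction.vonMangoldt n : ℂ) * aa χ₁ χ₂ n) s := by
  have hs1 : s ≠ 1 := by rintro rfl; simp at hs
  have hsum : ∀ (x : Σ n : ℕ, DirichletCharacter ℂ n), LSeriesSummable (fun n => (ArithmeticFunction.vonMangoldt n : ℂ) * x.2 n) s := by
    intro x
    refine (LSeriesSummable_congr s ?_).1 (DirichletCharacter.LSeriesSummable_twist_vonMangoldt x.2 hs)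
    intro n _; simp [mul_comm]
  rw [ff, Lp_ld χ₁ hmod₁ hs1 ((Lp_ne_iff χ₁ hmod₁).2 fun i => LF_ne _ _ hs1 hs.le), Lp_ld χ₂ hmod₂ hs1 ((Lp_ne_iff χ₂ hmod₂).2 fun i => LF_ne _ _ hs1 hs.le),
    ← Finset.sum_sub_distrib]
  have h1 : LSeries (fun n => (ArithmeticFunction.vonMangoldt n : ℂ) * aa χ₁ χ₂ n) s = LSeries (∑ i, ((fun n => (ArithmeticFunction.vonMangoldt n : ℂ) * (χ₁ i).2 n) - (fun n => (ArithmeticFunction.vonMangoldt n : ℂ) * (χ₂ i).2 n))) s := by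
    congr 1; ext n; simp [aa, Finset.mul_sum, mul_sub]
  rw [h1, LSeries_sum (S := Finset.univ) (fun i _ => (hsum (χ₁ i)).sub (hsum (χ₂ i))), ← Finset.sum_neg_distrib]
  refine Finset.sum_congr rfl fun i _ => ?_
  rw [LF_ld _ _ hs, LF_ld _ _ hs, LSeries_sub (hsum _) (hsum _)]; ring

theorem ff_right_bdd : ∃ K : ℝ, 0 < K ∧ ∀ s : ℂ, 3/2 ≤ s.re → ‖ff χ₁ χ₂ hmod₁ hmod₂ s‖ ≤ K := by
  choose K₁ hK₁ hb₁ using fun i => LF_bdd (χ₁ i) (hmod₁ i)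
  choose K₂ hK₂ hb₂ using fun i => LF_bdd (χ₂ i) (hmod₂ i)
  refine ⟨1 + (∑ i, K₁ i + ∑ i, K₂ i), ?_, fun s hs => ?_⟩
  · have := Finset.sum_nonneg fun i (_ : i ∈ Finset.univ) => (hK₁ i).le
    have := Finset.sum_nonneg fun i (_ : i ∈ Finset.univ) => (hK₂ i).le
    linarith
  have hs1 : s ≠ 1 := by rintro rfl; norm_num at hs
  rw [ff, Lp_ld χ₁ hmod₁ hs1 ((Lp_ne_iff χ₁ hmod₁).2 fun i => LF_ne _ _ hs1 (by linarith)), Lp_ld χ₂ hmod₂ hs1 ((Lp_ne_iff χ₂ hmod₂).2 fun i => LF_ne _ _ hs1 (by linarith))]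
  refine (norm_sub_le _ _).trans (le_trans ?_ (le_add_of_nonneg_left zero_le_one))
  refine add_le_add ((norm_sum_le _ _).trans ?_) ((norm_sum_le _ _).trans ?_)
  · exact Finset.sum_le_sum fun i _ => hb₁ i s hs
  · exact Finset.sum_le_sum fun i _ => hb₂ i s hs

theorem ff_refl (hp₁ : ∀ i, (χ₁ i).2.IsPrimitive) (hp₂ : ∀ i, (χ₂ i).2.IsPrimitive) : ∃ K : ℝ, 0 < K ∧ ∀ s : ℂ, 1 ≤ s.im → ∀ B : ℝ,
    (∀ i, LF (χ₁ i) (hmod₁ i) (1 - (starRingEnd ℂ) s) ≠ 0 ∧ ‖logDeriv (LF (χ₁ i) (hmod₁ i)) (1 - (starRingEnd ℂ) s)‖ ≤ B) →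
    (∀ i, LF (χ₂ i) (hmod₂ i) (1 - (starRingEnd ℂ) s) ≠ 0 ∧ ‖logDeriv (LF (χ₂ i) (hmod₂ i)) (1 - (starRingEnd ℂ) s)‖ ≤ B) →
    Lp χ₁ hmod₁ s ≠ 0 ∧ Lp χ₂ hmod₂ s ≠ 0 ∧ ‖ff χ₁ χ₂ hmod₁ hmod₂ s‖ ≤ K + 2 * m * B := by
  choose K₁ hK₁ hb₁ using fun i => LF_fe (χ₁ i) (hmod₁ i) (hp₁ i)
  choose K₂ hK₂ hb₂ using fun i => LF_fe (χ₂ i) (hmod₂ i) (hp₂ i)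
  refine ⟨1 + (∑ i, K₁ i + ∑ i, K₂ i), ?_, fun s hs B h1 h2 => ?_⟩
  · have := Finset.sum_nonneg fun i (_ : i ∈ Finset.univ) => (hK₁ i).le
    have := Finset.sum_nonneg fun i (_ : i ∈ Finset.univ) => (hK₂ i).le
    linarith
  have hs1 : s ≠ 1 := ne_one_of_im (by linarith)
  have n1 := (Lp_ne_iff χ₁ hmod₁).2 fun i => (hb₁ i s hs (h1 i).1).1
  have n2 := (Lp_ne_iff χ₂ hmod₂).2 fun i => (hb₂ i s hs (h2 i).1).1
  refine ⟨n1, n2, ?_⟩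
  rw [ff, Lp_ld χ₁ hmod₁ hs1 n1, Lp_ld χ₂ hmod₂ hs1 n2]
  have e : ∑ i, logDeriv (LF (χ₁ i) (hmod₁ i)) s - ∑ i, logDeriv (LF (χ₂ i) (hmod₂ i)) s
      = ∑ i, (logDeriv (LF (χ₁ i) (hmod₁ i)) s + logDeriv Gammaℂ s) - ∑ i, (logDeriv (LF (χ₂ i) (hmod₂ i)) s + logDeriv Gammaℂ s) := by
    rw [Finset.sum_add_distrib, Finset.sum_add_distrib]; ring
  rw [e]
  have b1 : ‖∑ i, (logDeriv (LF (χ₁ i) (hmod₁ i)) s + logDeriv Gammaℂ s)‖ ≤ ∑ i, K₁ i + m * B := by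
    refine (norm_sum_le _ _).trans ((Finset.sum_le_sum fun i _ => (hb₁ i s hs (h1 i).1).2.trans (add_le_add_right (h1 i).2 _)).trans (le_of_eq ?_))
    rw [Finset.sum_add_distrib]; simp
  have b2 : ‖∑ i, (logDeriv (LF (χ₂ i) (hmod₂ i)) s + logDeriv Gammaℂ s)‖ ≤ ∑ i, K₂ i + m * B := by
    refine (norm_sum_le _ _).trans ((Finset.sum_le_sum fun i _ => (hb₂ i s hs (h2 i).1).2.trans (add_le_add_right (h2 i).2 _)).trans (le_of_eq ?_))
    rw [Finset.sum_add_distrib]; simp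
  refine (norm_sub_le _ _).trans ?_
  linarith

theorem ff_left_bdd (hp₁ : ∀ i, (χ₁ i).2.IsPrimitive) (hp₂ : ∀ i, (χ₂ i).2.IsPrimitive) : ∃ K : ℝ, 0 < K ∧ ∀ s : ℂ, s.re = -1/2 → 1 ≤ s.im → ‖ff χ₁ χ₂ hmod₁ hmod₂ s‖ ≤ K := by
  choose K₁ hK₁ hb₁ using fun i => LF_bdd (χ₁ i) (hmod₁ i)
  choose K₂ hK₂ hb₂ using fun i => LF_bdd (χ₂ i) (hmod₂ i)
  obtain ⟨K, hK, hb⟩ := ff_refl χ₁ χ₂ hmod₁ hmod₂ hp₁ hp₂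
  have p1 := Finset.sum_nonneg fun i (_ : i ∈ Finset.univ) => (hK₁ i).le
  have p2 := Finset.sum_nonneg fun i (_ : i ∈ Finset.univ) => (hK₂ i).le
  refine ⟨K + 2 * m * (∑ i, K₁ i + ∑ i, K₂ i), by positivity, fun s hr hs => ?_⟩
  have hr' : (1 - (starRingEnd ℂ) s).re = 3/2 := by simp [hr]; norm_num
  have hi' : (1 - (starRingEnd ℂ) s) ≠ 1 := ne_one_of_im (by simp; linarith)
  refine (hb s hs _ (fun i => ⟨LF_ne _ _ hi' (by linarith), (hb₁ i _ hr'.ge).trans ?_⟩) (fun i => ⟨LF_ne _ _ hi' (by linarith), (hb₂ i _ hr'.ge).trans ?_⟩)).2.2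
  · have := Finset.single_le_sum (fun j _ => (hK₁ j).le) (Finset.mem_univ i)
    linarith
  · have := Finset.single_le_sum (fun j _ => (hK₂ j).le) (Finset.mem_univ i)
    linarith

theorem ff_edge (hp₁ : ∀ i, (χ₁ i).2.IsPrimitive) (hp₂ : ∀ i, (χ₂ i).2.IsPrimitive) : ∃ C : ℝ, 0 < C ∧ ∀ τ : ℝ, 10 ≤ τ → ∃ h ∈ Set.Icc τ (τ+1),
    ∀ σ : ℝ, -1/2 ≤ σ → σ ≤ 2 → Lp χ₁ hmod₁ (σ + h * I) ≠ 0 ∧ Lp χ₂ hmod₂ (σ + h * I) ≠ 0 ∧ ‖ff χ₁ χ₂ hmod₁ hmod₂ (σ + h * I)‖ ≤ C * Real.log τ ^ 2 := by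
  obtain ⟨K, hK, hb⟩ := ff_refl χ₁ χ₂ hmod₁ hmod₂ hp₁ hp₂
  obtain ⟨C, hC, hE⟩ := edge_family (Sum.elim χ₁ χ₂) (by rintro (i | i); exacts [hmod₁ i, hmod₂ i])
  refine ⟨K + 2 * m * C, by positivity, fun τ hτ => ?_⟩
  obtain ⟨h, hh, hE⟩ := hE τ hτ
  have hlog1 : 1 ≤ Real.log τ := by
    rw [Real.le_log_iff_exp_le (by linarith)]
    have := Real.exp_one_lt_d9; linarith
  have hlog2 : 1 ≤ Real.log τ ^ 2 := one_le_pow₀ hlog1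
  have E1 : ∀ i, ∀ σ : ℝ, 1/2 ≤ σ → σ ≤ 2 → LF (χ₁ i) (hmod₁ i) (σ + h * I) ≠ 0 ∧ ‖logDeriv (LF (χ₁ i) (hmod₁ i)) (σ + h * I)‖ ≤ C * Real.log τ ^ 2 :=
    fun i => hE (Sum.inl i)
  have E2 : ∀ i, ∀ σ : ℝ, 1/2 ≤ σ → σ ≤ 2 → LF (χ₂ i) (hmod₂ i) (σ + h * I) ≠ 0 ∧ ‖logDeriv (LF (χ₂ i) (hmod₂ i)) (σ + h * I)‖ ≤ C * Real.log τ ^ 2 :=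
    fun i => hE (Sum.inr i)
  refine ⟨h, hh, fun σ s1 s2 => ?_⟩
  have him : (σ + h * I : ℂ).im = h := by simp
  have hh1 := hh.1
  rcases le_or_gt (1/2) σ with hσ | hσ
  · have hs1 : (σ + h * I : ℂ) ≠ 1 := ne_one_of_im (by rw [him]; linarith)
    have n1 := (Lp_ne_iff χ₁ hmod₁).2 fun i => (E1 i σ hσ s2).1
    have n2 := (Lp_ne_iff χ₂ hmod₂).2 fun i => (E2 i σ hσ s2).1
    refine ⟨n1, n2, ?_⟩
    rw [ff, Lp_ld χ₁ hmod₁ hs1 n1, Lp_ld χ₂ hmod₂ hs1 n2]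
    refine (norm_sub_le _ _).trans ?_
    have b1 := (norm_sum_le Finset.univ fun i => logDeriv (LF (χ₁ i) (hmod₁ i)) (σ + h * I)).trans (Finset.sum_le_sum fun i _ => (E1 i σ hσ s2).2)
    have b2 := (norm_sum_le Finset.univ fun i => logDeriv (LF (χ₂ i) (hmod₂ i)) (σ + h * I)).trans (Finset.sum_le_sum fun i _ => (E2 i σ hσ s2).2)
    simp only [Finset.sum_const, Finset.card_univ, Fintype.card_fin, nsmul_eq_mul] at b1 b2
    nlinarith
  · have hc : (1 - (starRingEnd ℂ) (σ + h * I : ℂ)) = ((1 - σ : ℝ) : ℂ) + h * I := by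
      simp; ring
    obtain ⟨n1, n2, n3⟩ := hb (σ + h * I) (by rw [him]; linarith) (C * Real.log τ ^ 2)
      (fun i => by rw [hc]; exact E1 i _ (by linarith) (by linarith)) (fun i => by rw [hc]; exact E2 i _ (by linarith) (by linarith))
    refine ⟨n1, n2, n3.trans ?_⟩
    nlinarith
end

end DZ

namespace DZ
open Complex

/-- closed rectangle -/
def KR (h1 h2 : ℝ) : Set ℂ := {s | -1/2 ≤ s.re ∧ s.re ≤ 2 ∧ h1 ≤ s.im ∧ s.im ≤ h2}
/-- its boundary -/
def BR (h1 h2 : ℝ) : Set ℂ := {s | s ∈ KR h1 h2 ∧ (s.re = -1/2 ∨ s.re = 2 ∨ s.im = h1 ∨ s.im = h2)}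

noncomputable def bd (h1 h2 : ℝ) (f : ℂ → ℂ) : ℂ :=
  (∫ x : ℝ in (-1/2)..2, f ((x:ℂ) + (h1:ℂ) * I)) - (∫ x : ℝ in (-1/2)..2, f ((x:ℂ) + (h2:ℂ) * I)) +
    I * (∫ y : ℝ in h1..h2, f (((2:ℝ):ℂ) + y * I)) - I * (∫ y : ℝ in h1..h2, f (((-1/2:ℝ):ℂ) + y * I))

section
variable {h1 h2 : ℝ}

theorem mem_b1 (h12 : h1 ≤ h2) {x : ℝ} (hx : x ∈ Set.uIcc (-1/2 : ℝ) 2) : (x:ℂ) + (h1:ℂ) * I ∈ BR h1 h2 := by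
  rw [Set.uIcc_of_le (by norm_num)] at hx
  simp [BR, KR, h12, hx.1, hx.2]

theorem mem_b2 (h12 : h1 ≤ h2) {x : ℝ} (hx : x ∈ Set.uIcc (-1/2 : ℝ) 2) : (x:ℂ) + (h2:ℂ) * I ∈ BR h1 h2 := by
  rw [Set.uIcc_of_le (by norm_num)] at hx
  simp [BR, KR, h12, hx.1, hx.2]

theorem mem_b3 (h12 : h1 ≤ h2) {y : ℝ} (hy : y ∈ Set.uIcc h1 h2) : ((2:ℝ):ℂ) + y * I ∈ BR h1 h2 := by
  rw [Set.uIcc_of_le h12] at hy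
  simp [BR, KR, hy.1, hy.2]; norm_num

theorem mem_b4 (h12 : h1 ≤ h2) {y : ℝ} (hy : y ∈ Set.uIcc h1 h2) : ((-1/2:ℝ):ℂ) + y * I ∈ BR h1 h2 := by
  rw [Set.uIcc_of_le h12] at hy
  have e1 : (((-1/2:ℝ):ℂ) + y * I).re = -1/2 := by simp
  have e2 : (((-1/2:ℝ):ℂ) + y * I).im = y := by simp
  refine ⟨⟨e1.ge, ?_, ?_, ?_⟩, Or.inl e1⟩
  · rw [e1]; norm_num
  · rw [e2]; exact hy.1
  · rw [e2]; exact hy.2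

theorem bd_congr (h12 : h1 ≤ h2) {f g : ℂ → ℂ} (h : Set.EqOn f g (BR h1 h2)) : bd h1 h2 f = bd h1 h2 g := by
  unfold bd
  rw [intervalIntegral.integral_congr (fun x hx => h (mem_b1 h12 hx)), intervalIntegral.integral_congr (fun x hx => h (mem_b2 h12 hx)),
    intervalIntegral.integral_congr (fun x hx => h (mem_b3 h12 hx)), intervalIntegral.integral_congr (fun x hx => h (mem_b4 h12 hx))]

theorem int_b1 (h12 : h1 ≤ h2) {f : ℂ → ℂ} (hf : ContinuousOn f (BR h1 h2)) : IntervalIntegrable (fun x : ℝ => f ((x:ℂ) + (h1:ℂ) * I)) MeasureTheory.volume (-1/2) 2 :=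
  (hf.comp (by fun_prop) (fun _ hx => mem_b1 h12 hx)).intervalIntegrable

theorem int_b2 (h12 : h1 ≤ h2) {f : ℂ → ℂ} (hf : ContinuousOn f (BR h1 h2)) : IntervalIntegrable (fun x : ℝ => f ((x:ℂ) + (h2:ℂ) * I)) MeasureTheory.volume (-1/2) 2 :=
  (hf.comp (by fun_prop) (fun _ hx => mem_b2 h12 hx)).intervalIntegrable

theorem int_b3 (h12 : h1 ≤ h2) {f : ℂ → ℂ} (hf : ContinuousOn f (BR h1 h2)) : IntervalIntegrable (fun y : ℝ => f (((2:ℝ):ℂ) + y * I)) MeasureTheory.volume h1 h2 :=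
  (hf.comp (by fun_prop) (fun _ hx => mem_b3 h12 hx)).intervalIntegrable

theorem int_b4 (h12 : h1 ≤ h2) {f : ℂ → ℂ} (hf : ContinuousOn f (BR h1 h2)) : IntervalIntegrable (fun y : ℝ => f (((-1/2:ℝ):ℂ) + y * I)) MeasureTheory.volume h1 h2 :=
  (hf.comp (by fun_prop) (fun _ hx => mem_b4 h12 hx)).intervalIntegrable

theorem bd_add (h12 : h1 ≤ h2) {f g : ℂ → ℂ} (hf : ContinuousOn f (BR h1 h2)) (hg : ContinuousOn g (BR h1 h2)) :
    bd h1 h2 (fun s => f s + g s) = bd h1 h2 f + bd h1 h2 g := by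
  unfold bd
  rw [intervalIntegral.integral_add (int_b1 h12 hf) (int_b1 h12 hg), intervalIntegral.integral_add (int_b2 h12 hf) (int_b2 h12 hg),
    intervalIntegral.integral_add (int_b3 h12 hf) (int_b3 h12 hg), intervalIntegral.integral_add (int_b4 h12 hf) (int_b4 h12 hg)]
  ring

theorem bd_const_mul {f : ℂ → ℂ} (c : ℂ) : bd h1 h2 (fun s => c * f s) = c * bd h1 h2 f := by
  unfold bd
  simp only [intervalIntegral.integral_const_mul]
  ring

theorem bd_sum (h12 : h1 ≤ h2) (S : Finset ℂ) (c : ℂ → ℂ) {f : ℂ → ℂ → ℂ} (hf : ∀ ρ ∈ S, ContinuousOn (f ρ) (BR h1 h2)) :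
    bd h1 h2 (fun s => ∑ ρ ∈ S, c ρ * f ρ s) = ∑ ρ ∈ S, c ρ * bd h1 h2 (f ρ) := by
  classical
  induction S using Finset.induction_on with
  | empty => simp [bd]
  | insert a S ha ih =>
    simp only [Finset.sum_insert ha]
    rw [bd_add h12 (f := fun s => c a * f a s) (g := fun s => ∑ ρ ∈ S, c ρ * f ρ s) (continuousOn_const.mul (hf a (by simp))) (continuousOn_finset_sum _ fun ρ hρ => continuousOn_const.mul (hf ρ (by simp [hρ]))),
      bd_const_mul, ih (fun ρ hρ => hf ρ (by simp [hρ]))]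

theorem bd_zero (h12 : h1 ≤ h2) {f : ℂ → ℂ} (hf : DifferentiableOn ℂ f (KR h1 h2)) : bd h1 h2 f = 0 := by
  have := Complex.integral_boundary_rect_eq_zero_of_differentiableOn f (((-1/2:ℝ):ℂ) + h1 * I) (((2:ℝ):ℂ) + h2 * I) (by
    refine hf.mono ?_
    intro s hs
    have e1 : (((-1/2:ℝ):ℂ) + h1 * I).re = -1/2 := by simp
    have e2 : (((-1/2:ℝ):ℂ) + h1 * I).im = h1 := by simp
    have e3 : (((2:ℝ):ℂ) + h2 * I).re = 2 := by simp
    have e4 : (((2:ℝ):ℂ) + h2 * I).im = h2 := by simp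
    rw [e1, e2, e3, e4, Set.uIcc_of_le h12, Set.uIcc_of_le (by norm_num)] at hs
    exact ⟨hs.1.1, hs.1.2, hs.2.1, hs.2.2⟩)
  have e1 : (((-1/2:ℝ):ℂ) + h1 * I).re = -1/2 := by simp
  have e2 : (((-1/2:ℝ):ℂ) + h1 * I).im = h1 := by simp
  have e3 : (((2:ℝ):ℂ) + h2 * I).re = 2 := by simp
  have e4 : (((2:ℝ):ℂ) + h2 * I).im = h2 := by simp
  rw [e1, e2, e3, e4] at this
  simpa only [bd, smul_eq_mul] using this

end

theorem order_unique {F g : ℂ → ℂ} {ρ c : ℂ} {k n : ℕ} (hc : c ≠ 0) (hg : ContinuousAt g ρ) (hg0 : g ρ ≠ 0)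
    (hF : ∀ᶠ s in 𝓝[≠] ρ, F s = (s - ρ) ^ k * g s) (hl : Tendsto (fun s => F s / (s - ρ) ^ n) (𝓝[≠] ρ) (𝓝 c)) : n = k := by
  have hgl : Tendsto g (𝓝[≠] ρ) (𝓝 (g ρ)) := hg.tendsto.mono_left nhdsWithin_le_nhds
  have hz : ∀ j : ℕ, j ≠ 0 → Tendsto (fun s : ℂ => (s - ρ) ^ j) (𝓝[≠] ρ) (𝓝 0) := by
    intro j hj
    have : Tendsto (fun s : ℂ => (s - ρ) ^ j) (𝓝 ρ) (𝓝 ((ρ - ρ) ^ j)) := by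
      apply Continuous.tendsto; fun_prop
    rw [sub_self, zero_pow hj] at this
    exact this.mono_left nhdsWithin_le_nhds
  rcases lt_trichotomy n k with h | h | h
  · exfalso
    have h1 : Tendsto (fun s => (s - ρ) ^ (k - n) * g s) (𝓝[≠] ρ) (𝓝 c) := by
      refine hl.congr' ?_
      filter_upwards [hF, self_mem_nhdsWithin] with s hs hne
      have : s - ρ ≠ 0 := sub_ne_zero.2 hne
      rw [hs, div_eq_iff (pow_ne_zero _ this), mul_right_comm, ← pow_add]
      congr 2; omega
    have h2 := (hz (k - n) (by omega)).mul hgl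
    rw [zero_mul] at h2
    exact hc (tendsto_nhds_unique h1 h2)
  · exact h
  · exfalso
    have h1 : Tendsto g (𝓝[≠] ρ) (𝓝 (0 * c)) := by
      refine ((hz (n - k) (by omega)).mul hl).congr' ?_
      filter_upwards [hF, self_mem_nhdsWithin] with s hs hne
      have h3 : s - ρ ≠ 0 := sub_ne_zero.2 hne
      rw [hs, ← mul_div_assoc, div_eq_iff (pow_ne_zero _ h3), ← mul_assoc, ← pow_add, mul_comm]
      congr 2; omega
    rw [zero_mul] at h1
    exact hg0 (tendsto_nhds_unique hgl h1)

theorem KR_compact (h1 h2 : ℝ) : IsCompact (KR h1 h2) := by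
  have : KR h1 h2 = (Set.Icc (-1/2) 2) ×ℂ (Set.Icc h1 h2) := by
    ext s; simp [KR, Complex.mem_reProdIm, and_assoc]
  rw [this]
  exact isCompact_Icc.reProdIm isCompact_Icc

/-- factorisation over the rectangle with prescribed multiplicities -/
theorem factor_rect {F : ℂ → ℂ} {h1 h2 : ℝ} (hh1 : 0 < h1) (h12 : h1 ≤ h2)
    (hF : AnalyticOnNhd ℂ F {s : ℂ | 0 < s.im}) (hB : ∀ s ∈ BR h1 h2, F s ≠ 0) (mm : ℂ → ℕ)
    (hm : ∀ ρ ∈ KR h1 h2, F ρ = 0 → ∃ c : ℂ, c ≠ 0 ∧ Tendsto (fun s : ℂ => F s / (s - ρ) ^ (mm ρ)) (𝓝[≠] ρ) (𝓝 c)) :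
    ∃ (Z : Finset ℂ) (g : ℂ → ℂ), (∀ ρ, ρ ∈ Z ↔ ρ ∈ KR h1 h2 ∧ F ρ = 0) ∧ DifferentiableOn ℂ g (KR h1 h2) ∧
      ∀ s ∈ BR h1 h2, logDeriv F s = ∑ ρ ∈ Z, (mm ρ : ℂ) * (s - ρ)⁻¹ + g s := by
  classical
  have hU : IsOpen {s : ℂ | 0 < s.im} := isOpen_lt continuous_const continuous_im
  have hUp : IsPreconnected {s : ℂ | 0 < s.im} := (convex_halfSpace_im_gt 0).isPreconnected
  have hKU : KR h1 h2 ⊆ {s : ℂ | 0 < s.im} := fun s hs => lt_of_lt_of_le hh1 hs.2.2.1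
  have hz0 := mem_b1 h12 (x := 0) (by rw [Set.uIcc_of_le (by norm_num)]; norm_num)
  obtain ⟨Z, k, g, hg, hfac, hZ, hgne⟩ := factor hU hUp hF (hKU hz0.1) (hB _ hz0) (KR_compact h1 h2) hKU
  have hk : ∀ ρ ∈ Z, mm ρ = k ρ := by
    intro ρ hρ
    obtain ⟨hρK, hρ0⟩ := (hZ ρ).1 hρ
    obtain ⟨c, hc, hl⟩ := hm ρ hρK hρ0
    refine order_unique (g := fun s => (∏ ρ' ∈ Z.erase ρ, (s - ρ') ^ k ρ') * g s) hc ?_ ?_ ?_ hl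
    · exact ContinuousAt.mul (by fun_prop) (hg ρ (hKU hρK)).continuousAt
    · refine mul_ne_zero (Finset.prod_ne_zero_iff.2 fun ρ' hρ' => pow_ne_zero _ (sub_ne_zero.2 (Finset.ne_of_mem_erase hρ').symm)) (hgne ρ hρK)
    · refine Filter.Eventually.filter_mono nhdsWithin_le_nhds ?_
      filter_upwards [hU.mem_nhds (hKU hρK)] with s hs
      rw [hfac s hs, ← Finset.mul_prod_erase Z _ hρ, mul_assoc]
  refine ⟨Z, logDeriv g, hZ, ?_, ?_⟩
  · intro s hs
    have hd := hg s (hKU hs)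
    exact (hd.deriv.differentiableAt.div hd.differentiableAt (hgne s hs)).differentiableWithinAt
  · intro s hs
    have hsZ : s ∉ Z := fun h => hB s hs ((hZ s).1 h).2
    rw [logDeriv_factor hU hg hfac (hKU hs.1) hsZ (hgne s hs.1)]
    congr 1
    refine Finset.sum_congr rfl fun ρ hρ => ?_
    rw [hk ρ hρ, div_eq_mul_inv]

theorem bd_pole {h1 h2 : ℝ} (h12 : h1 ≤ h2) (Z : Finset ℂ) (hZ : ∀ s ∈ BR h1 h2, s ∉ Z) (g L : ℂ → ℂ) (hg : DifferentiableOn ℂ g (KR h1 h2)) (n : ℂ → ℂ)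
    (hL : ∀ s ∈ BR h1 h2, L s = ∑ ρ ∈ Z, n ρ * (s - ρ)⁻¹ + g s) (Ψ : ℂ → ℂ) (hΨ : Differentiable ℂ Ψ) :
    bd h1 h2 (fun s => L s * Ψ s) = ∑ ρ ∈ Z, n ρ * bd h1 h2 (fun s => (s - ρ)⁻¹) * Ψ ρ := by
  have hds : ∀ ρ, Differentiable ℂ (dslope Ψ ρ) := fun ρ => by
    rw [← differentiableOn_univ, Complex.differentiableOn_dslope Filter.univ_mem]
    exact hΨ.differentiableOn
  set D : ℂ → ℂ := fun s => ∑ ρ ∈ Z, n ρ * dslope Ψ ρ s + g s * Ψ s with hD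
  have hDd : DifferentiableOn ℂ D (KR h1 h2) := by
    refine DifferentiableOn.add ?_ (hg.mul hΨ.differentiableOn)
    exact (Differentiable.fun_sum fun ρ _ => (hds ρ).const_mul _).differentiableOn
  have hsub : BR h1 h2 ⊆ KR h1 h2 := fun s hs => hs.1
  have hinv : ∀ ρ ∈ Z, ContinuousOn (fun s : ℂ => (s - ρ)⁻¹) (BR h1 h2) := fun ρ hρ =>
    ContinuousOn.inv₀ (by fun_prop) fun s hs => sub_ne_zero.2 fun h => hZ s hs (h ▸ hρ)
  have e : Set.EqOn (fun s => L s * Ψ s) (fun s => D s + ∑ ρ ∈ Z, (n ρ * Ψ ρ) * (s - ρ)⁻¹) (BR h1 h2) := by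
    intro s hs
    simp only [hD]
    rw [hL s hs, add_mul, Finset.sum_mul, add_right_comm, ← Finset.sum_add_distrib]
    congr 1
    refine Finset.sum_congr rfl fun ρ hρ => ?_
    have hne : s ≠ ρ := fun h => hZ s hs (h ▸ hρ)
    have h0 : s - ρ ≠ 0 := sub_ne_zero.2 hne
    rw [dslope_of_ne _ hne, slope_def_field]
    field_simp; ring
  rw [bd_congr h12 e, bd_add h12 (f := D) (g := fun s => ∑ ρ ∈ Z, n ρ * Ψ ρ * (s - ρ)⁻¹) (hDd.continuousOn.mono hsub) (continuousOn_finset_sum _ fun ρ hρ => continuousOn_const.mul (hinv ρ hρ)), bd_zero h12 hDd, zero_add,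
    bd_sum h12 Z _ hinv]
  exact Finset.sum_congr rfl fun ρ _ => by ring

theorem contour {F₁ F₂ : ℂ → ℂ} {h1 h2 : ℝ} (hh1 : 0 < h1) (h12 : h1 ≤ h2)
    (hF₁ : AnalyticOnNhd ℂ F₁ {s : ℂ | 0 < s.im}) (hF₂ : AnalyticOnNhd ℂ F₂ {s : ℂ | 0 < s.im})
    (hB₁ : ∀ s ∈ BR h1 h2, F₁ s ≠ 0) (hB₂ : ∀ s ∈ BR h1 h2, F₂ s ≠ 0) (m₁ m₂ : ℂ → ℕ)
    (hm₁ : ∀ ρ ∈ KR h1 h2, (F₁ ρ = 0 ∨ F₂ ρ = 0) → ∃ c : ℂ, c ≠ 0 ∧ Tendsto (fun s : ℂ => F₁ s / (s - ρ) ^ (m₁ ρ)) (𝓝[≠] ρ) (𝓝 c))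
    (hm₂ : ∀ ρ ∈ KR h1 h2, (F₁ ρ = 0 ∨ F₂ ρ = 0) → ∃ c : ℂ, c ≠ 0 ∧ Tendsto (fun s : ℂ => F₂ s / (s - ρ) ^ (m₂ ρ)) (𝓝[≠] ρ) (𝓝 c)) :
    ∃ (S : Finset ℂ) (w : ℂ → ℂ), (∀ ρ ∈ S, ρ ∈ KR h1 h2 ∧ (F₁ ρ = 0 ∨ F₂ ρ = 0) ∧ m₁ ρ ≠ m₂ ρ) ∧
      ∀ Ψ : ℂ → ℂ, Differentiable ℂ Ψ → bd h1 h2 (fun s => (logDeriv F₁ s - logDeriv F₂ s) * Ψ s) = ∑ ρ ∈ S, w ρ * Ψ ρ := by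
  classical
  obtain ⟨Z₁, g₁, hZ₁, hg₁, hl₁⟩ := factor_rect hh1 h12 hF₁ hB₁ m₁ (fun ρ hρ h => hm₁ ρ hρ (Or.inl h))
  obtain ⟨Z₂, g₂, hZ₂, hg₂, hl₂⟩ := factor_rect hh1 h12 hF₂ hB₂ m₂ (fun ρ hρ h => hm₂ ρ hρ (Or.inr h))
  have hzero : ∀ (F : ℂ → ℂ) (mm : ℂ → ℕ) (ρ : ℂ), ContinuousAt F ρ → F ρ ≠ 0 →
      (∃ c : ℂ, c ≠ 0 ∧ Tendsto (fun s : ℂ => F s / (s - ρ) ^ (mm ρ)) (𝓝[≠] ρ) (𝓝 c)) → mm ρ = 0 := by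
    rintro F mm ρ hc h0 ⟨c, hc0, hl⟩
    exact order_unique hc0 hc h0 (Eventually.of_forall fun s => by simp) hl
  have hKU : KR h1 h2 ⊆ {s : ℂ | 0 < s.im} := fun s hs => lt_of_lt_of_le hh1 hs.2.2.1
  have hmem : ∀ ρ ∈ Z₁ ∪ Z₂, ρ ∈ KR h1 h2 ∧ (F₁ ρ = 0 ∨ F₂ ρ = 0) := by
    intro ρ hρ
    rcases Finset.mem_union.1 hρ with h | h
    · exact ⟨((hZ₁ ρ).1 h).1, Or.inl ((hZ₁ ρ).1 h).2⟩
    · exact ⟨((hZ₂ ρ).1 h).1, Or.inr ((hZ₂ ρ).1 h).2⟩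
  have hz1 : ∀ ρ ∈ Z₁ ∪ Z₂, ρ ∉ Z₁ → m₁ ρ = 0 := by
    intro ρ hρ hn
    obtain ⟨hK, h⟩ := hmem ρ hρ
    exact hzero F₁ m₁ ρ (hF₁ ρ (hKU hK)).continuousAt (fun h0 => hn ((hZ₁ ρ).2 ⟨hK, h0⟩)) (hm₁ ρ hK h)
  have hz2 : ∀ ρ ∈ Z₁ ∪ Z₂, ρ ∉ Z₂ → m₂ ρ = 0 := by
    intro ρ hρ hn
    obtain ⟨hK, h⟩ := hmem ρ hρ
    exact hzero F₂ m₂ ρ (hF₂ ρ (hKU hK)).continuousAt (fun h0 => hn ((hZ₂ ρ).2 ⟨hK, h0⟩)) (hm₂ ρ hK h)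
  have hL : ∀ s ∈ BR h1 h2, logDeriv F₁ s - logDeriv F₂ s = ∑ ρ ∈ Z₁ ∪ Z₂, ((m₁ ρ : ℂ) - m₂ ρ) * (s - ρ)⁻¹ + (g₁ s - g₂ s) := by
    intro s hs
    rw [hl₁ s hs, hl₂ s hs]
    have e1 : ∑ ρ ∈ Z₁, (m₁ ρ : ℂ) * (s - ρ)⁻¹ = ∑ ρ ∈ Z₁ ∪ Z₂, (m₁ ρ : ℂ) * (s - ρ)⁻¹ :=
      Finset.sum_subset Finset.subset_union_left fun ρ hρ hn => by rw [hz1 ρ hρ hn]; simp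
    have e2 : ∑ ρ ∈ Z₂, (m₂ ρ : ℂ) * (s - ρ)⁻¹ = ∑ ρ ∈ Z₁ ∪ Z₂, (m₂ ρ : ℂ) * (s - ρ)⁻¹ :=
      Finset.sum_subset Finset.subset_union_right fun ρ hρ hn => by rw [hz2 ρ hρ hn]; simp
    rw [e1, e2]
    simp only [sub_mul, Finset.sum_sub_distrib]
    ring
  refine ⟨(Z₁ ∪ Z₂).filter (fun ρ => m₁ ρ ≠ m₂ ρ), fun ρ => ((m₁ ρ : ℂ) - m₂ ρ) * bd h1 h2 (fun s => (s - ρ)⁻¹), ?_, ?_⟩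
  · intro ρ hρ
    obtain ⟨a, b⟩ := Finset.mem_filter.1 hρ
    exact ⟨(hmem ρ a).1, (hmem ρ a).2, b⟩
  · intro Ψ hΨ
    rw [bd_pole h12 (Z₁ ∪ Z₂) (fun s hs h => (hmem s h).2.elim (hB₁ s hs) (hB₂ s hs)) (fun s => g₁ s - g₂ s) (fun s => logDeriv F₁ s - logDeriv F₂ s) (hg₁.sub hg₂) (fun ρ => (m₁ ρ : ℂ) - m₂ ρ) hL Ψ hΨ]
    rw [Finset.sum_filter]
    refine Finset.sum_congr rfl fun ρ _ => ?_
    split_ifs with h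
    · rfl
    · rw [not_not.1 h]; simp

end DZ

namespace DZ
open MeasureTheory

theorem Q_left (lam : ℝ) (hl : 0 ≤ lam) (al y : ℝ) :
    ‖Q lam ((((-1:ℝ):ℂ) + y * Complex.I) - al * Complex.I)‖ ≤ 2 * (Real.sqrt (1 + (y - al) ^ 2))⁻¹ := by
  have h0 : ‖(((-1:ℝ):ℂ) + y * Complex.I) - al * Complex.I‖ ^ 2 = 1 + (y - al) ^ 2 := by rw [norm_line]; ring
  have h1 : ‖(((-1:ℝ):ℂ) + y * Complex.I) - al * Complex.I‖ = Real.sqrt (1 + (y - al) ^ 2) := by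
    rw [← h0, Real.sqrt_sq (norm_nonneg _)]
  have hp : 0 < Real.sqrt (1 + (y - al) ^ 2) := Real.sqrt_pos.2 (by positivity)
  have hz : (((-1:ℝ):ℂ) + y * Complex.I) - al * Complex.I ≠ 0 := by rw [← norm_pos_iff, h1]; exact hp
  refine (Q_norm lam hz).trans ?_
  rw [h1, div_eq_mul_inv]
  gcongr
  have : Real.exp (lam / 2 * ((((-1:ℝ):ℂ) + y * Complex.I) - al * Complex.I).re) ≤ 1 := by
    rw [Real.exp_le_one_iff]; simp; linarith
  linarith

theorem int_inv_le (al h1 h2 : ℝ) (h12 : h1 ≤ h2) : ∫ y in h1..h2, (1 + (y - al) ^ 2)⁻¹ ≤ Real.pi := by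
  rw [intervalIntegral.integral_of_le h12]
  refine (setIntegral_le_integral (int_inv al) (Eventually.of_forall fun y => by positivity)).trans ?_
  rw [integral_sub_right_eq_self (fun y : ℝ => (1 + y ^ 2)⁻¹), integral_univ_inv_one_add_sq]

theorem int_sqrt_le (al h1 h2 T : ℝ) (hT : 3 ≤ T) (ha1 : |h1 - al| ≤ T) (ha2 : |h2 - al| ≤ T) :
    ∫ y in h1..h2, (Real.sqrt (1 + (y - al) ^ 2))⁻¹ ≤ 4 * Real.log T := by
  have hd : ∀ y ∈ Set.uIcc h1 h2, HasDerivAt (fun y => Real.arsinh (y - al)) ((Real.sqrt (1 + (y - al) ^ 2))⁻¹) y := by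
    intro y _
    simpa using ((hasDerivAt_id y).sub_const al).arsinh
  have hc : Continuous fun y : ℝ => (Real.sqrt (1 + (y - al) ^ 2))⁻¹ :=
    Continuous.inv₀ (by fun_prop) fun y => (Real.sqrt_pos.2 (by positivity)).ne'
  rw [intervalIntegral.integral_eq_sub_of_hasDerivAt hd (hc.intervalIntegrable _ _)]
  have hb : Real.arsinh T ≤ 2 * Real.log T := by
    have : Real.sqrt (1 + T ^ 2) ≤ 2 * T := Real.sqrt_le_iff.2 ⟨by linarith, by nlinarith⟩
    rw [Real.arsinh, show 2 * Real.log T = Real.log (T ^ 2) by rw [Real.log_pow]; norm_num]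
    apply Real.log_le_log
    · have := Real.sqrt_nonneg (1 + T^2); linarith
    · nlinarith
  have h2' : Real.arsinh (h2 - al) ≤ Real.arsinh T := Real.arsinh_le_arsinh.2 (abs_le.1 ha2).2
  have h1' : Real.arsinh (-T) ≤ Real.arsinh (h1 - al) := Real.arsinh_le_arsinh.2 (abs_le.1 ha1).1
  rw [Real.arsinh_neg] at h1'
  linarith

theorem left_bound (f : ℝ → ℂ) (K lam al be h1 h2 T : ℝ) (hK : 0 ≤ K) (hl : 0 ≤ lam) (h12 : h1 ≤ h2) (hT : 3 ≤ T)
    (hf : ∀ y ∈ Set.Icc h1 h2, ‖f y‖ ≤ K) (ha1 : |h1 - al| ≤ T) (ha2 : |h2 - al| ≤ T) (hb1 : |h1 - be| ≤ T) (hb2 : |h2 - be| ≤ T) (hab : al ≠ be) :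
    ‖∫ y in h1..h2, f y * (Q lam ((((-1:ℝ):ℂ) + y * Complex.I) - al * Complex.I) * Q lam ((((-1:ℝ):ℂ) + y * Complex.I) - be * Complex.I))‖ ≤ 8 * Real.pi * K ∧
    ‖∫ y in h1..h2, f y * (Q lam ((((-1:ℝ):ℂ) + y * Complex.I) - al * Complex.I) * Q lam ((((-1:ℝ):ℂ) + y * Complex.I) - be * Complex.I))‖ ≤ 32 * K * Real.log T / |al - be| := by
  have hc : ∀ al : ℝ, Continuous fun y : ℝ => (Real.sqrt (1 + (y - al) ^ 2))⁻¹ := fun al =>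
    Continuous.inv₀ (by fun_prop) fun y => (Real.sqrt_pos.2 (by positivity)).ne'
  have hc2 : ∀ al : ℝ, Continuous fun y : ℝ => (1 + (y - al) ^ 2)⁻¹ := fun al =>
    Continuous.inv₀ (by fun_prop) fun y => by positivity
  have key : ∀ y ∈ Set.Icc h1 h2, ‖f y * (Q lam ((((-1:ℝ):ℂ) + y * Complex.I) - al * Complex.I) * Q lam ((((-1:ℝ):ℂ) + y * Complex.I) - be * Complex.I))‖ ≤
      4 * K * ((Real.sqrt (1 + (y - al) ^ 2))⁻¹ * (Real.sqrt (1 + (y - be) ^ 2))⁻¹) := by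
    intro y hy
    rw [norm_mul, norm_mul]
    have := mul_le_mul (hf y hy) (mul_le_mul (Q_left lam hl al y) (Q_left lam hl be y) (norm_nonneg _) (by positivity)) (by positivity) hK
    linarith
  constructor
  · refine (intervalIntegral.norm_integral_le_of_norm_le h12 (g := fun y => 4 * K * ((1 + (y - al) ^ 2)⁻¹ + (1 + (y - be) ^ 2)⁻¹)) (Eventually.of_forall fun y hy => ?_) ?_).trans ?_
    · refine (key y ⟨hy.1.le, hy.2⟩).trans ?_
      gcongr
      have e : ∀ al : ℝ, (1 + (y - al) ^ 2)⁻¹ = ((Real.sqrt (1 + (y - al) ^ 2))⁻¹) ^ 2 := fun al => by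
        rw [inv_pow, Real.sq_sqrt (by positivity)]
      rw [e, e]
      nlinarith [sq_nonneg ((Real.sqrt (1 + (y - al) ^ 2))⁻¹ - (Real.sqrt (1 + (y - be) ^ 2))⁻¹), sq_nonneg ((Real.sqrt (1 + (y - al) ^ 2))⁻¹), sq_nonneg ((Real.sqrt (1 + (y - be) ^ 2))⁻¹)]
    · exact (continuous_const.mul ((hc2 al).add (hc2 be))).intervalIntegrable _ _
    · rw [intervalIntegral.integral_const_mul, intervalIntegral.integral_add ((hc2 al).intervalIntegrable _ _) ((hc2 be).intervalIntegrable _ _)]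
      have := int_inv_le al h1 h2 h12
      have := int_inv_le be h1 h2 h12
      nlinarith
  · have hD : 0 < |al - be| := abs_pos.2 (sub_ne_zero.2 hab)
    refine (intervalIntegral.norm_integral_le_of_norm_le h12 (g := fun y => 4 * K / |al - be| * ((Real.sqrt (1 + (y - al) ^ 2))⁻¹ + (Real.sqrt (1 + (y - be) ^ 2))⁻¹)) (Eventually.of_forall fun y hy => ?_) ?_).trans ?_
    · refine (key y ⟨hy.1.le, hy.2⟩).trans ?_
      have hA : 0 < Real.sqrt (1 + (y - al) ^ 2) := Real.sqrt_pos.2 (by positivity)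
      have hB : 0 < Real.sqrt (1 + (y - be) ^ 2) := Real.sqrt_pos.2 (by positivity)
      have hA1 : |y - al| ≤ Real.sqrt (1 + (y - al) ^ 2) := Real.abs_le_sqrt (by linarith)
      have hB1 : |y - be| ≤ Real.sqrt (1 + (y - be) ^ 2) := Real.abs_le_sqrt (by linarith)
      have hDD : |al - be| ≤ |y - al| + |y - be| := by
        have := abs_sub (y - be) (y - al)
        rw [show al - be = (y - be) - (y - al) by ring]
        linarith
      set A := Real.sqrt (1 + (y - al) ^ 2)
      set B := Real.sqrt (1 + (y - be) ^ 2)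
      rw [show 4 * K / |al - be| * (A⁻¹ + B⁻¹) = 4 * K * ((A + B) / |al - be| * (A⁻¹ * B⁻¹)) by field_simp; ring]
      have : 1 ≤ (A + B) / |al - be| := by rw [one_le_div hD]; linarith
      have h4 : 0 ≤ A⁻¹ * B⁻¹ := by positivity
      have := mul_le_mul_of_nonneg_right this h4
      rw [one_mul] at this
      gcongr
    · exact (continuous_const.mul ((hc al).add (hc be))).intervalIntegrable _ _
    · rw [intervalIntegral.integral_const_mul, intervalIntegral.integral_add ((hc al).intervalIntegrable _ _) ((hc be).intervalIntegrable _ _)]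
      have h1 := int_sqrt_le al h1 h2 T hT ha1 ha2
      have h2 := int_sqrt_le be _ _ T hT hb1 hb2
      have : 32 * K * Real.log T / |al - be| = 4 * K / |al - be| * (8 * Real.log T) := by ring
      rw [this]
      have h3 : 0 ≤ 4 * K / |al - be| := by positivity
      exact mul_le_mul_of_nonneg_left (by linarith) h3

theorem tail_bound (f : ℝ → ℂ) (hfc : Continuous f) (K lam al be h1 h2 d : ℝ) (hK : 0 ≤ K) (hd : 0 < d) (h12 : h1 ≤ h2)
    (hf : ∀ y, ‖f y‖ ≤ K) (ha1 : h1 + d ≤ al) (ha2 : al + d ≤ h2) (hb1 : h1 + d ≤ be) (hb2 : be + d ≤ h2) :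
    ‖(∫ y : ℝ, f y * (Q lam ((((3/2:ℝ):ℂ) + y * Complex.I) - al * Complex.I) * Q lam ((((3/2:ℝ):ℂ) + y * Complex.I) - be * Complex.I))) -
      (∫ y in h1..h2, f y * (Q lam ((((3/2:ℝ):ℂ) + y * Complex.I) - al * Complex.I) * Q lam ((((3/2:ℝ):ℂ) + y * Complex.I) - be * Complex.I)))‖ ≤
      K * (Real.exp (lam / 2 * (3/2)) + 1) ^ 2 * (4 * Real.pi / d) := by
  set M := (Real.exp (lam / 2 * (3/2)) + 1) ^ 2 with hM
  have hMp : 0 ≤ M := by positivity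
  set P : ℝ → ℂ := fun y => f y * (Q lam ((((3/2:ℝ):ℂ) + y * Complex.I) - al * Complex.I) * Q lam ((((3/2:ℝ):ℂ) + y * Complex.I) - be * Complex.I)) with hP
  have hPi : Integrable P := (QQ_integrable lam (3/2) al be (by norm_num)).bdd_mul hfc.aestronglyMeasurable (Eventually.of_forall hf)
  rw [intervalIntegral.integral_of_le h12, ← integral_add_compl (measurableSet_Ioc (a := h1) (b := h2)) hPi, add_sub_cancel_left]
  have hgi : ∀ al : ℝ, Integrable (fun y : ℝ => (2 / d ^ 2) * (1 + ((y - al) / d) ^ 2)⁻¹) := fun al =>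
    ((integrable_inv_one_add_sq.comp_div hd.ne').comp_sub_right al).const_mul _
  have hgv : ∀ al : ℝ, ∫ y : ℝ, (2 / d ^ 2) * (1 + ((y - al) / d) ^ 2)⁻¹ = 2 * Real.pi / d := fun al => by
    rw [integral_const_mul, integral_sub_right_eq_self (fun y : ℝ => (1 + (y / d) ^ 2)⁻¹), Measure.integral_comp_div (fun y : ℝ => (1 + y ^ 2)⁻¹),
      integral_univ_inv_one_add_sq, abs_of_pos hd, smul_eq_mul]
    field_simp
  have hpt : ∀ y u : ℝ, d ≤ |y - u| → (1 + (y - u) ^ 2)⁻¹ ≤ (2 / d ^ 2) * (1 + ((y - u) / d) ^ 2)⁻¹ := by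
    intro y u h
    have h2 : d ^ 2 ≤ (y - u) ^ 2 := by rw [← sq_abs (y - u)]; gcongr
    rw [show (2 / d ^ 2) * (1 + ((y - u) / d) ^ 2)⁻¹ = 2 / (d ^ 2 + (y - u) ^ 2) by field_simp, inv_eq_one_div, div_le_div_iff₀ (by positivity) (by positivity)]
    linarith
  set g : ℝ → ℝ := fun y => K * M * ((2 / d ^ 2) * (1 + ((y - al) / d) ^ 2)⁻¹ + (2 / d ^ 2) * (1 + ((y - be) / d) ^ 2)⁻¹) with hg
  have hgI : Integrable g := ((hgi al).add (hgi be)).const_mul _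
  calc ‖∫ y in (Set.Ioc h1 h2)ᶜ, P y‖ ≤ ∫ y in (Set.Ioc h1 h2)ᶜ, g y := by
        refine norm_integral_le_of_norm_le hgI.integrableOn ?_
        rw [ae_restrict_iff' measurableSet_Ioc.compl]
        refine Eventually.of_forall fun y hy => ?_
        have hy' : y ≤ h1 ∨ h2 < y := by
          by_contra hc
          push Not at hc
          exact hy ⟨hc.1, hc.2⟩
        have hya : d ≤ |y - al| := by
          rcases hy' with h | h
          · rw [abs_sub_comm]; exact le_trans (by linarith) (le_abs_self _)
          · exact le_trans (by linarith) (le_abs_self _)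
        have hyb : d ≤ |y - be| := by
          rcases hy' with h | h
          · rw [abs_sub_comm]; exact le_trans (by linarith) (le_abs_self _)
          · exact le_trans (by linarith) (le_abs_self _)
        simp only [hP, hg]
        rw [norm_mul, mul_assoc K]
        refine mul_le_mul (hf y) ((QQ_bound lam (3/2) al be y (by norm_num)).trans ?_) (norm_nonneg _) hK
        exact mul_le_mul_of_nonneg_left (add_le_add (hpt y al hya) (hpt y be hyb)) hMp
    _ ≤ ∫ y, g y := setIntegral_le_integral hgI (Eventually.of_forall fun y => by simp only [hg, Pi.zero_apply]; positivity)
    _ = K * M * (4 * Real.pi / d) := by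
        simp only [hg]
        rw [integral_const_mul, integral_add (hgi al) (hgi be), hgv, hgv]; ring

theorem edge_bound (f : ℝ → ℂ) (K lam al be h d : ℝ) (hK : 0 ≤ K) (hl : 0 ≤ lam) (hd : 0 < d)
    (hf : ∀ x ∈ Set.Icc (-1/2:ℝ) 2, ‖f x‖ ≤ K) (ha : d ≤ |h - al|) (hb : d ≤ |h - be|) :
    ‖∫ x in (-1/2:ℝ)..2, f x * (Q lam (((x:ℂ) + h * Complex.I) - 1/2 - al * Complex.I) * Q lam (((x:ℂ) + h * Complex.I) - 1/2 - be * Complex.I))‖ ≤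
      5/2 * (K * (Real.exp (lam / 2 * (3/2)) + 1) ^ 2 / d ^ 2) := by
  have hq : ∀ x ∈ Set.Icc (-1/2:ℝ) 2, ∀ al : ℝ, d ≤ |h - al| → ‖Q lam (((x:ℂ) + h * Complex.I) - 1/2 - al * Complex.I)‖ ≤ (Real.exp (lam / 2 * (3/2)) + 1) / d := by
    intro x hx al ha
    have him : (((x:ℂ) + h * Complex.I) - 1/2 - al * Complex.I).im = h - al := by simp
    have hre : (((x:ℂ) + h * Complex.I) - 1/2 - al * Complex.I).re = x - 1/2 := by simp
    have hn : d ≤ ‖((x:ℂ) + h * Complex.I) - 1/2 - al * Complex.I‖ := by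
      refine ha.trans ?_
      rw [← him]; exact Complex.abs_im_le_norm _
    have hz : ((x:ℂ) + h * Complex.I) - 1/2 - al * Complex.I ≠ 0 := by
      rw [← norm_pos_iff]; linarith
    refine (Q_norm lam hz).trans ?_
    rw [hre]
    gcongr
    linarith [hx.2]
  refine (intervalIntegral.norm_integral_le_of_norm_le_const (C := K * (Real.exp (lam / 2 * (3/2)) + 1) ^ 2 / d ^ 2) fun x hx => ?_).trans (le_of_eq ?_)
  · rw [Set.uIoc_of_le (by norm_num)] at hx
    have hx' : x ∈ Set.Icc (-1/2:ℝ) 2 := ⟨hx.1.le, hx.2⟩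
    rw [norm_mul, norm_mul]
    have := mul_le_mul (hf x hx') (mul_le_mul (hq x hx' al ha) (hq x hx' be hb) (norm_nonneg _) (by positivity)) (by positivity) hK
    refine this.trans (le_of_eq ?_)
    ring
  · rw [show |(2:ℝ) - -1/2| = 5/2 by norm_num]; ring

end DZ

namespace DZ
open Complex

theorem Lp_ld_cont {m : ℕ} (χ : Fin m → Σ n : ℕ, DirichletCharacter ℂ n) (hmod : ∀ i, (χ i).1 ≠ 0) {s : ℂ} (hs : s ≠ 1) (h0 : Lp χ hmod s ≠ 0) :
    ContinuousAt (logDeriv (Lp χ hmod)) s := by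
  have ha : AnalyticAt ℂ (Lp χ hmod) s := by
    refine DifferentiableOn.analyticAt (s := {1}ᶜ) (fun z hz => (Lp_diff χ hmod hz).differentiableWithinAt) (isOpen_compl_singleton.mem_nhds hs)
  exact ha.deriv.continuousAt.div ha.continuousAt h0

theorem ff_cont {m : ℕ} (χ₁ χ₂ : Fin m → Σ n : ℕ, DirichletCharacter ℂ n) (hmod₁ : ∀ i, (χ₁ i).1 ≠ 0) (hmod₂ : ∀ i, (χ₂ i).1 ≠ 0) :
    Continuous (fun y : ℝ => ff χ₁ χ₂ hmod₁ hmod₂ (((2:ℝ):ℂ) + y * I)) := by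
  rw [continuous_iff_continuousAt]
  intro y
  have hre : (((2:ℝ):ℂ) + y * I).re = 2 := by simp
  have hne : ((2:ℝ):ℂ) + y * I ≠ 1 := by intro h; rw [h] at hre; norm_num at hre
  have hn : ∀ (χ : Fin m → Σ n : ℕ, DirichletCharacter ℂ n) (hmod : ∀ i, (χ i).1 ≠ 0), Lp χ hmod (((2:ℝ):ℂ) + y * I) ≠ 0 := fun χ hmod =>
    (Lp_ne_iff χ hmod).2 fun i => LF_ne _ _ hne (by rw [hre]; norm_num)
  have : ContinuousAt (ff χ₁ χ₂ hmod₁ hmod₂) (((2:ℝ):ℂ) + y * I) := (Lp_ld_cont χ₁ hmod₁ hne (hn _ _)).sub (Lp_ld_cont χ₂ hmod₂ hne (hn _ _))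
  exact ContinuousAt.comp (f := fun y : ℝ => ((2:ℝ):ℂ) + y * I) this (by fun_prop)

theorem M_bound (N : ℕ) (hN : 2 ≤ N) (T : ℝ) (hNT : (N:ℝ) ^ 4 ≤ T) : (Real.exp (Real.log N / 2 * (3/2)) + 1) ^ 2 ≤ 4 * Real.sqrt T := by
  have hN' : (2:ℝ) ≤ N := by exact_mod_cast hN
  have hlog : 0 ≤ Real.log N := Real.log_nonneg (by linarith)
  have h1 : Real.exp (Real.log N / 2 * (3/2)) ≤ N := by
    calc _ ≤ Real.exp (Real.log N) := Real.exp_le_exp.2 (by linarith)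
      _ = N := Real.exp_log (by linarith)
  have h2 : (N:ℝ) ^ 2 ≤ Real.sqrt T := Real.le_sqrt_of_sq_le (by rw [← pow_mul]; exact hNT)
  have h3 := Real.exp_pos (Real.log N / 2 * (3/2))
  nlinarith

set_option maxHeartbeats 1000000 in
theorem interface {m : ℕ} (χ₁ χ₂ : Fin m → Σ n : ℕ, DirichletCharacter ℂ n) (hmod₁ : ∀ i, (χ₁ i).1 ≠ 0) (hmod₂ : ∀ i, (χ₂ i).1 ≠ 0)
    (hp₁ : ∀ i, (χ₁ i).2.IsPrimitive) (hp₂ : ∀ i, (χ₂ i).2.IsPrimitive) (m₁ m₂ : ℂ → ℕ)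
    (hm₁ : ∀ σ : ℂ, 0 < σ.re → σ.re < 1 → 0 < σ.im → ∃ c : ℂ, c ≠ 0 ∧
      Tendsto (fun s : ℂ => Lp χ₁ hmod₁ s / (s - σ) ^ (m₁ σ)) (𝓝[≠] σ) (𝓝 c))
    (hm₂ : ∀ σ : ℂ, 0 < σ.re → σ.re < 1 → 0 < σ.im → ∃ c : ℂ, c ≠ 0 ∧
      Tendsto (fun s : ℂ => Lp χ₂ hmod₂ s / (s - σ) ^ (m₂ σ)) (𝓝[≠] σ) (𝓝 c)) :
    ∃ K : ℝ, 0 < K ∧ ∀ T : ℝ, 100 ≤ T → ∀ N : ℕ, 2 ≤ N → (N:ℝ) ^ 4 ≤ T → ∃ (S : Finset ℂ) (w : ℂ → ℂ),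
      (∀ ρ ∈ S, 0 < ρ.re ∧ ρ.re < 1 ∧ 0 < ρ.im ∧ ρ.im < T ∧ Lp χ₁ hmod₁ ρ * Lp χ₂ hmod₂ ρ = 0 ∧ m₁ ρ ≠ m₂ ρ) ∧
      ∀ al ∈ Set.Icc (T/4) (T/2), ∀ be ∈ Set.Icc (T/4) (T/2), ∀ l : ℤ, al - be = 2 * Real.pi / Real.log N * (2 * l - 1) →
        ‖(Gs N (cf (aa χ₁ χ₂)) al - Gs N (cf (aa χ₁ χ₂)) be) / (I * (al - be)) -
          ∑ ρ ∈ S, (w ρ * Q (Real.log N) (ρ - 1/2 - al * I)) * Q (Real.log N) (ρ - 1/2 - be * I)‖ ≤ K ∧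
        ‖(Gs N (cf (aa χ₁ χ₂)) al - Gs N (cf (aa χ₁ χ₂)) be) / (I * (al - be)) -
          ∑ ρ ∈ S, (w ρ * Q (Real.log N) (ρ - 1/2 - al * I)) * Q (Real.log N) (ρ - 1/2 - be * I)‖ ≤
          K * (Real.log T / |al - be| + 1 / Real.sqrt T) := by
  obtain ⟨K1, hK1, hr⟩ := ff_right_bdd χ₁ χ₂ hmod₁ hmod₂
  obtain ⟨K2, hK2, hlft⟩ := ff_left_bdd χ₁ χ₂ hmod₁ hmod₂ hp₁ hp₂
  obtain ⟨C, hC, hedge⟩ := ff_edge χ₁ χ₂ hmod₁ hmod₂ hp₁ hp₂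
  have hpi := Real.pi_pos
  refine ⟨8 * Real.pi * K2 + 32 * K2 + (256 * Real.pi * K1 + 20480 * C), by positivity, fun T hT N hN hNT => ?_⟩
  obtain ⟨h1, hh1, he1⟩ := hedge (T/8) (by linarith)
  obtain ⟨h2, hh2, he2⟩ := hedge (T-2) (by linarith)
  have h12 : h1 ≤ h2 := by linarith [hh1.2, hh2.1]
  have h1p : 1 ≤ h1 := by linarith [hh1.1]
  have hBR : ∀ s ∈ BR h1 h2, Lp χ₁ hmod₁ s ≠ 0 ∧ Lp χ₂ hmod₂ s ≠ 0 := by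
    rintro s ⟨⟨a, b, c, d⟩, e | e | e | e⟩
    · exact ⟨Lp_ne_out _ _ hp₁ (by linarith) (Or.inl (by linarith)), Lp_ne_out _ _ hp₂ (by linarith) (Or.inl (by linarith))⟩
    · exact ⟨Lp_ne_out _ _ hp₁ (by linarith) (Or.inr (by linarith)), Lp_ne_out _ _ hp₂ (by linarith) (Or.inr (by linarith))⟩
    · have := he1 s.re a b
      rw [← e, Complex.re_add_im] at this
      exact ⟨this.1, this.2.1⟩
    · have := he2 s.re a b
      rw [← e, Complex.re_add_im] at this
      exact ⟨this.1, this.2.1⟩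
  have hstrip : ∀ ρ ∈ KR h1 h2, (Lp χ₁ hmod₁ ρ = 0 ∨ Lp χ₂ hmod₂ ρ = 0) → 0 < ρ.re ∧ ρ.re < 1 := by
    rintro ρ ⟨a, b, c, d⟩ h
    by_contra hcon
    have hcon' : ρ.re ≤ 0 ∨ 1 ≤ ρ.re := by
      by_contra hx; push Not at hx; exact hcon hx
    exact h.elim (Lp_ne_out _ _ hp₁ (by linarith) hcon') (Lp_ne_out _ _ hp₂ (by linarith) hcon')
  obtain ⟨S, w, hS, hct⟩ := contour (by linarith : 0 < h1) h12 (Lp_analytic χ₁ hmod₁) (Lp_analytic χ₂ hmod₂)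
    (fun s hs => (hBR s hs).1) (fun s hs => (hBR s hs).2) m₁ m₂
    (fun ρ hρ h => hm₁ ρ (hstrip ρ hρ h).1 (hstrip ρ hρ h).2 (by linarith [hρ.2.2.1]))
    (fun ρ hρ h => hm₂ ρ (hstrip ρ hρ h).1 (hstrip ρ hρ h).2 (by linarith [hρ.2.2.1]))
  refine ⟨S, fun ρ => -I / (2 * Real.pi) * w ρ, ?_, ?_⟩
  · intro ρ hρ
    obtain ⟨a, b, c⟩ := hS ρ hρ
    obtain ⟨d, e⟩ := hstrip ρ a b
    exact ⟨d, e, by linarith [a.2.2.1], by linarith [a.2.2.2, hh2.2], mul_eq_zero.2 b, c⟩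
  intro al hal be hbe l hl
  have hN' : (2:ℝ) ≤ N := by exact_mod_cast hN
  have hlam : 0 < Real.log N := Real.log_pos (by linarith)
  have hab : al ≠ be := by
    rw [← sub_ne_zero, hl]
    have : (2 * l - 1 : ℝ) ≠ 0 := by
      have : (2 * l - 1 : ℤ) ≠ 0 := by omega
      exact_mod_cast this
    positivity
  set lam := Real.log N with hlamdef
  set G := Gs N (cf (aa χ₁ χ₂)) with hG
  set f := ff χ₁ χ₂ hmod₁ hmod₂ with hf
  have hd : (0:ℝ) < T/16 := by linarith
  -- the main identity
  have hfm := fourier_main (aa χ₁ χ₂) (2*m) (aa_norm χ₁ χ₂) N hN al be l hl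
  set RI := ∫ y : ℝ, f (((2:ℝ):ℂ) + y * I) * (Q lam ((((3/2:ℝ):ℂ) + y * I) - al * I) * Q lam ((((3/2:ℝ):ℂ) + y * I) - be * I)) with hRI
  have hRI' : RI = 2 * Real.pi * ((G al - G be) / (I * (al - be))) := by
    have e : ∀ y : ℝ, f (((2:ℝ):ℂ) + y * I) = - LSeries (fun n => (ArithmeticFunction.vonMangoldt n : ℂ) * aa χ₁ χ₂ n) (((2:ℝ):ℂ) + y * I) := by
      intro y
      exact ff_right χ₁ χ₂ hmod₁ hmod₂ (by simp)
    rw [hRI]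
    simp only [e, neg_mul]
    rw [MeasureTheory.integral_neg, hfm, neg_neg]
  set RS := ∫ y : ℝ in h1..h2, f (((2:ℝ):ℂ) + y * I) * (Q lam ((((3/2:ℝ):ℂ) + y * I) - al * I) * Q lam ((((3/2:ℝ):ℂ) + y * I) - be * I)) with hRS
  have htail := tail_bound (fun y => f (((2:ℝ):ℂ) + y * I)) (ff_cont χ₁ χ₂ hmod₁ hmod₂) K1 lam al be h1 h2 (T/16) hK1.le hd h12
    (fun y => hr _ (by simp; norm_num)) (by linarith [hh1.2, hal.1]) (by linarith [hh2.1, hal.2]) (by linarith [hh1.2, hbe.1]) (by linarith [hh2.1, hbe.2])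
  rw [← hRI, ← hRS] at htail
  have hleft := left_bound (fun y => f (((-1/2:ℝ):ℂ) + y * I)) K2 lam al be h1 h2 T hK2.le hlam.le h12 (by linarith)
    (fun y hy => hlft _ (by simp) (by simp; linarith [hy.1]))
    (abs_le.2 ⟨by linarith [hh1.1, hal.2], by linarith [hh1.2, hal.1]⟩) (abs_le.2 ⟨by linarith [hh2.1, hal.2], by linarith [hh2.2, hal.1]⟩)
    (abs_le.2 ⟨by linarith [hh1.1, hbe.2], by linarith [hh1.2, hbe.1]⟩) (abs_le.2 ⟨by linarith [hh2.1, hbe.2], by linarith [hh2.2, hbe.1]⟩) hab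
  set LI := ∫ y in h1..h2, f (((-1/2:ℝ):ℂ) + y * I) * (Q lam ((((-1:ℝ):ℂ) + y * I) - al * I) * Q lam ((((-1:ℝ):ℂ) + y * I) - be * I)) with hLI
  have hlogT : Real.log T ^ 2 ≤ 4 * T := by
    have h0 : 0 ≤ Real.log T := Real.log_nonneg (by linarith)
    have h := Real.log_le_sub_one_of_pos (Real.sqrt_pos.2 (by linarith : 0 < T))
    rw [Real.log_sqrt (by linarith)] at h
    have hs := Real.sq_sqrt (by linarith : 0 ≤ T)
    have : Real.log T ≤ 2 * Real.sqrt T := by linarith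
    nlinarith [Real.sqrt_nonneg T]
  have hM := M_bound N hN T hNT
  rw [← hlamdef] at hM
  have hsq : 0 < Real.sqrt T := Real.sqrt_pos.2 (by linarith)
  have hss : Real.sqrt T * Real.sqrt T = T := Real.mul_self_sqrt (by linarith)
  have hedgeb : ∀ h τ : ℝ, 10 ≤ τ → τ ≤ T → (∀ σ : ℝ, -1/2 ≤ σ → σ ≤ 2 → Lp χ₁ hmod₁ (σ + h * I) ≠ 0 ∧ Lp χ₂ hmod₂ (σ + h * I) ≠ 0 ∧ ‖f (σ + h * I)‖ ≤ C * Real.log τ ^ 2) →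
      T/16 ≤ |h - al| → T/16 ≤ |h - be| →
      ‖∫ x in (-1/2:ℝ)..2, f (x + h * I) * (Q lam (((x:ℂ) + h * I) - 1/2 - al * I) * Q lam (((x:ℂ) + h * I) - 1/2 - be * I))‖ ≤ 10240 * C * (1 / Real.sqrt T) := by
    intro h τ hτ hτT he ha hb
    have h5 : Real.log τ ^ 2 ≤ Real.log T ^ 2 := by
      have := Real.log_nonneg (by linarith : 1 ≤ τ)
      have := Real.log_le_log (by linarith) hτT
      gcongr
    refine (edge_bound (fun x => f (x + h * I)) (C * (4 * T)) lam al be h (T/16) (by positivity) hlam.le hd (fun x hx => ?_) ha hb).trans ?_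
    · refine (he x hx.1 hx.2).2.2.trans ?_
      gcongr; linarith
    · have hTp : 0 < T := by linarith
      calc 5/2 * (C * (4 * T) * (Real.exp (lam / 2 * (3/2)) + 1) ^ 2 / (T/16) ^ 2) ≤ 5/2 * (C * (4 * T) * (4 * Real.sqrt T) / (T/16) ^ 2) := by gcongr
        _ = 10240 * C * (Real.sqrt T / T) := by field_simp; ring
        _ = 10240 * C * (1 / Real.sqrt T) := by
          congr 1
          rw [div_eq_div_iff hTp.ne' hsq.ne', hss]; ring
  have hE1 := hedgeb h1 (T/8) (by linarith) (by linarith) he1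
    (by rw [abs_sub_comm]; exact le_trans (by linarith [hh1.2, hal.1]) (le_abs_self _)) (by rw [abs_sub_comm]; exact le_trans (by linarith [hh1.2, hbe.1]) (le_abs_self _))
  have hE2 := hedgeb h2 (T-2) (by linarith) (by linarith) he2
    (le_trans (by linarith [hh2.1, hal.2]) (le_abs_self _)) (le_trans (by linarith [hh2.1, hbe.2]) (le_abs_self _))
  set E1 := ∫ x in (-1/2:ℝ)..2, f (x + h1 * I) * (Q lam (((x:ℂ) + h1 * I) - 1/2 - al * I) * Q lam (((x:ℂ) + h1 * I) - 1/2 - be * I)) with hE1d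
  set E2 := ∫ x in (-1/2:ℝ)..2, f (x + h2 * I) * (Q lam (((x:ℂ) + h2 * I) - 1/2 - al * I) * Q lam (((x:ℂ) + h2 * I) - 1/2 - be * I)) with hE2d
  have hct' := hct (fun s => Q lam (s - 1/2 - al * I) * Q lam (s - 1/2 - be * I)) (by
    have := Q_diff lam
    exact ((this.comp (by fun_prop : Differentiable ℂ fun s : ℂ => s - 1/2 - al * I)).mul (this.comp (by fun_prop : Differentiable ℂ fun s : ℂ => s - 1/2 - be * I))))
  have hbd : bd h1 h2 (fun s => (logDeriv (Lp χ₁ hmod₁) s - logDeriv (Lp χ₂ hmod₂) s) * (Q lam (s - 1/2 - al * I) * Q lam (s - 1/2 - be * I))) = E1 - E2 + I * RS - I * LI := by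
    have c1 : ∀ (y al : ℝ), ((2:ℝ):ℂ) + y * I - 1/2 - al * I = (((3/2:ℝ):ℂ) + y * I) - al * I := by intro y al; push_cast; ring
    have c2 : ∀ (y al : ℝ), ((-1/2:ℝ):ℂ) + y * I - 1/2 - al * I = (((-1:ℝ):ℂ) + y * I) - al * I := by intro y al; push_cast; ring
    unfold bd
    simp only [c1, c2]
    rfl
  rw [hbd] at hct'
  have hpi' : (Real.pi : ℂ) ≠ 0 := by exact_mod_cast hpi.ne'
  have hmain : (G al - G be) / (I * (al - be)) - ∑ ρ ∈ S, ((-I / (2 * Real.pi) * w ρ) * Q lam (ρ - 1/2 - al * I)) * Q lam (ρ - 1/2 - be * I) =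
      (1 / (2 * Real.pi)) * ((RI - RS) + LI + I * E1 - I * E2) := by
    have e1 : ∑ ρ ∈ S, ((-I / (2 * Real.pi) * w ρ) * Q lam (ρ - 1/2 - al * I)) * Q lam (ρ - 1/2 - be * I) = -I / (2 * Real.pi) * (E1 - E2 + I * RS - I * LI) := by
      rw [hct', Finset.mul_sum]
      exact Finset.sum_congr rfl fun ρ _ => by ring
    have e2 : (G al - G be) / (I * (al - be)) = 1 / (2 * Real.pi) * RI := by
      rw [hRI']; field_simp
    rw [e1, e2]
    field_simp
    linear_combination (RS - LI) * I_sq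
  have hnorm : ‖(G al - G be) / (I * (al - be)) - ∑ ρ ∈ S, ((-I / (2 * Real.pi) * w ρ) * Q lam (ρ - 1/2 - al * I)) * Q lam (ρ - 1/2 - be * I)‖ ≤
      ‖RI - RS‖ + ‖LI‖ + ‖E1‖ + ‖E2‖ := by
    rw [hmain, norm_mul]
    have hc : ‖(1 / (2 * Real.pi) : ℂ)‖ ≤ 1 := by
      rw [show (1 / (2 * Real.pi) : ℂ) = ((1 / (2 * Real.pi) : ℝ) : ℂ) by push_cast; rfl, Complex.norm_real, Real.norm_eq_abs, abs_of_pos (by positivity),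
        div_le_one (by positivity)]
      linarith [Real.pi_gt_three]
    have h3 : ‖(RI - RS) + LI + I * E1 - I * E2‖ ≤ ‖RI - RS‖ + ‖LI‖ + ‖E1‖ + ‖E2‖ := by
      refine (norm_sub_le _ _).trans ?_
      refine add_le_add ((norm_add_le _ _).trans (add_le_add (norm_add_le _ _) ?_)) ?_ <;> simp
    calc _ ≤ 1 * ‖(RI - RS) + LI + I * E1 - I * E2‖ := by gcongr
      _ ≤ _ := by rw [one_mul]; exact h3
  have htail2 : ‖RI - RS‖ ≤ 256 * Real.pi * K1 * (1 / Real.sqrt T) := by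
    refine htail.trans ?_
    have hTp : 0 < T := by linarith
    calc K1 * (Real.exp (lam / 2 * (3/2)) + 1) ^ 2 * (4 * Real.pi / (T/16)) ≤ K1 * (4 * Real.sqrt T) * (4 * Real.pi / (T/16)) := by gcongr
      _ = 256 * Real.pi * K1 * (Real.sqrt T / T) := by field_simp; ring
      _ = 256 * Real.pi * K1 * (1 / Real.sqrt T) := by
          congr 1
          rw [div_eq_div_iff hTp.ne' hsq.ne', hss]; ring
  have hs1 : 1 / Real.sqrt T ≤ 1 := by
    rw [div_le_one hsq]; exact Real.one_le_sqrt.2 (by linarith)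
  have hs0 : 0 < 1 / Real.sqrt T := by positivity
  set u := 1 / Real.sqrt T
  have hlp : 0 ≤ Real.log T / |al - be| := div_nonneg (Real.log_nonneg (by linarith)) (abs_nonneg _)
  have hleft2 : ‖LI‖ ≤ 32 * K2 * (Real.log T / |al - be|) := by
    rw [← mul_div_assoc]; exact hleft.2
  set v := Real.log T / |al - be|
  have hX : 0 < 256 * Real.pi * K1 := by positivity
  have hY : 0 < Real.pi * K2 := by positivity
  have hX1 := mul_le_mul_of_nonneg_left hs1 hX.le
  have hC1 := mul_le_mul_of_nonneg_left hs1 hC.le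
  refine ⟨hnorm.trans ?_, hnorm.trans ?_⟩
  · linarith [hleft.1]
  · have := mul_nonneg hY.le hlp
    have := mul_nonneg hX.le hlp
    have := mul_nonneg hC.le hlp
    have := mul_nonneg hY.le hs0.le
    have := mul_nonneg hK2.le hs0.le
    nlinarith
end DZ

namespace DZ
open Complex

theorem avg (φ : ℝ → ℝ) (hφ : Continuous φ) (x p : ℝ) (J : ℕ) :
    ∫ θ in (0:ℝ)..p, ∑ j : Fin J, φ (θ + x + p * (j:ℕ)) = ∫ t in x..(x + p * J), φ t := by
  rw [intervalIntegral.integral_finset_sum (fun j _ => Continuous.intervalIntegrable (by fun_prop) _ _)]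
  rw [Fin.sum_univ_eq_sum_range (fun j : ℕ => ∫ θ in (0:ℝ)..p, φ (θ + x + p * (j:ℕ)))]
  have h := intervalIntegral.sum_integral_adjacent_intervals (a := fun k : ℕ => x + p * k) (n := J) (f := φ) (μ := MeasureTheory.volume)
    (fun k _ => hφ.intervalIntegrable _ _)
  simp only [Nat.cast_zero, mul_zero, add_zero] at h
  rw [← h]
  refine Finset.sum_congr rfl fun k _ => ?_
  have := intervalIntegral.integral_comp_add_right (a := 0) (b := p) φ (x + p * k)
  simp only [← add_assoc] at this
  rw [this]
  congr 1 <;> push_cast <;> ring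

theorem integrated (N J : ℕ) (hJ : 0 < J) (hlam : 1 ≤ Real.log N) (a : ℕ → ℂ) (x T K B : ℝ) (hT : 1 ≤ T) (hK : 0 < K) (hB : 0 < B)
    (hx : x = T / 4) (hJT : 4 * Real.pi / Real.log N * (J + 1) ≤ T / 4) (hTN : Real.log T ≤ 40 * Real.log N)
    (S : Finset ℂ) (w : ℂ → ℂ)
    (hint : ∀ al ∈ Set.Icc (T/4) (T/2), ∀ be ∈ Set.Icc (T/4) (T/2), ∀ l : ℤ, al - be = 2 * Real.pi / Real.log N * (2 * l - 1) →
        ‖(Gs N (cf a) al - Gs N (cf a) be) / (I * (al - be)) -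
          ∑ ρ ∈ S, (w ρ * Q (Real.log N) (ρ - 1/2 - al * I)) * Q (Real.log N) (ρ - 1/2 - be * I)‖ ≤ K ∧
        ‖(Gs N (cf a) al - Gs N (cf a) be) / (I * (al - be)) -
          ∑ ρ ∈ S, (w ρ * Q (Real.log N) (ρ - 1/2 - al * I)) * Q (Real.log N) (ρ - 1/2 - be * I)‖ ≤
          K * (Real.log T / |al - be| + 1 / Real.sqrt T)) :
    Real.log N ^ 2 * ∫ t in x..(x + 4 * Real.pi / Real.log N * J), ‖Gs N (cf a) t - Gs N (cf a) (t + 2 * Real.pi / Real.log N)‖ ^ 2 ≤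
      4 * Real.pi ^ 2 * ((4 * Real.pi / Real.log N) * (2 * ((60 * K) ^ 2 * J) + B * Real.log N ^ 4 * S.card) +
        (16 * W + 4 * (60 * K) ^ 2 * (W + 1)) / B * ((∫ t in x..(x + 4 * Real.pi / Real.log N * J), ‖Gs N (cf a) t‖ ^ 4) +
          (∫ t in (x + 2 * Real.pi / Real.log N)..(x + 4 * Real.pi / Real.log N * J + 2 * Real.pi / Real.log N), ‖Gs N (cf a) t‖ ^ 4) +
          (4 * Real.pi / Real.log N * J) * Real.log N ^ 4)) := by
  have hpi := Real.pi_pos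
  have hT0 : 0 < T := by linarith
  set lam := Real.log N with hl
  set G := Gs N (cf a) with hG
  have hGc : Continuous G := Gs_cont N (cf a)
  have hl0 : 0 < lam := by linarith
  set p := 4 * Real.pi / lam with hp
  have hp0 : 0 < p := by positivity
  have hp2 : 2 * Real.pi / lam = p / 2 := by rw [hp]; ring
  have hpt : ∀ θ ∈ Set.Icc 0 p, lam ^ 2 * ∑ j : Fin J, ‖G (θ + x + p * (j:ℕ)) - G (θ + x + p * (j:ℕ) + p / 2)‖ ^ 2 ≤
      4 * Real.pi ^ 2 * (2 * ((60 * K) ^ 2 * J) + B * lam ^ 4 * S.card + (16 * W + 4 * (60 * K) ^ 2 * (W + 1)) / B *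
        ∑ j : Fin J, (‖G (θ + x + p * (j:ℕ))‖ ^ 4 + ‖G (θ + x + p * (j:ℕ) + p / 2)‖ ^ 4 + lam ^ 4)) := by
    intro θ hθ
    set al : Fin J → ℝ := fun j => θ + x + p * (j:ℕ) with hal
    set be : Fin J → ℝ := fun j => θ + x + p * (j:ℕ) + p / 2 with hbe
    have hjJ : ∀ j : Fin J, ((j:ℕ):ℝ) + 1 ≤ J := fun j => by exact_mod_cast j.2
    have hj0 : ∀ j : Fin J, 0 ≤ p * ((j:ℕ):ℝ) := fun j => by positivity
    have hjp : ∀ j : Fin J, p * ((j:ℕ):ℝ) + p ≤ p * J := fun j => by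
      have := mul_le_mul_of_nonneg_left (hjJ j) hp0.le
      linarith
    have halm : ∀ j, al j ∈ Set.Icc (T/4) (T/2) := fun j => by
      have := hjp j; have := hj0 j
      constructor <;> simp only [hal] <;> linarith [hθ.1, hθ.2]
    have hbem : ∀ j, be j ∈ Set.Icc (T/4) (T/2) := fun j => by
      have := hjp j; have := hj0 j
      constructor <;> simp only [hbe] <;> linarith [hθ.1, hθ.2]
    have hdiff : ∀ j k : Fin J, al j - be k = 2 * Real.pi / lam * (2 * ((((j:ℕ):ℤ) - ((k:ℕ):ℤ) : ℤ) : ℝ) - 1) := by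
      intro j k
      rw [hp2]; simp only [hal, hbe]; push_cast; ring
    have hodd : ∀ j k : Fin J, (1:ℝ) ≤ (2 * (((j:ℕ):ℝ) - ((k:ℕ):ℝ)) - 1) ^ 2 := by
      intro j k
      have h1 : (1:ℤ) ≤ (2 * (((j:ℕ):ℤ) - ((k:ℕ):ℤ)) - 1) ^ 2 := by
        have : (2 * (((j:ℕ):ℤ) - ((k:ℕ):ℤ)) - 1) ≠ 0 := by omega
        have := sq_pos_of_ne_zero this
        linarith
      exact_mod_cast h1
    have habs : ∀ j k : Fin J, |al j - be k| ^ 2 = (2 * Real.pi / lam) ^ 2 * (2 * (((j:ℕ):ℝ) - ((k:ℕ):ℝ)) - 1) ^ 2 := by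
      intro j k
      rw [sq_abs, hdiff]; push_cast; ring
    have hHn : ∀ j k : Fin J, ‖(G (al j) - G (be k)) / (I * ((al j:ℂ) - be k))‖ ^ 2 =
        lam ^ 2 / (4 * Real.pi ^ 2) * ‖G (al j) - G (be k)‖ ^ 2 * (1 / (2 * (((j:ℕ):ℝ) - ((k:ℕ):ℝ)) - 1) ^ 2) := by
      intro j k
      have := hodd j k
      rw [norm_div, norm_mul, Complex.norm_I, one_mul, ← Complex.ofReal_sub, Complex.norm_real, Real.norm_eq_abs, div_pow, habs]
      field_simp
      ring
    refine matrix_ineq S (fun ρ j => w ρ * Q lam (ρ - 1/2 - al j * I)) (fun ρ k => Q lam (ρ - 1/2 - be k * I))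
      (fun j k => (G (al j) - G (be k)) / (I * ((al j:ℂ) - be k)))
      (fun j k => (G (al j) - G (be k)) / (I * ((al j:ℂ) - be k)) - ∑ ρ ∈ S, (w ρ * Q lam (ρ - 1/2 - al j * I)) * Q lam (ρ - 1/2 - be k * I))
      (fun j k => by ring) (fun j => G (al j)) (fun k => G (be k)) lam (60 * K) (4 * Real.pi ^ 2) B hlam (by positivity) hB ?_ ?_ ?_ ?_
    · intro j k
      have := hodd j k
      rw [hHn]
      gcongr
      apply div_le_self (by positivity)
      nlinarith [Real.pi_gt_three]
    · intro j
      rw [hHn]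
      simp only [sub_self, mul_zero, zero_sub, even_two, Even.neg_pow, one_pow, div_one, mul_one]
      apply le_of_eq; field_simp
    · intro j k
      have ho := hodd j k
      have h := (hint (al j) (halm j) (be k) (hbem k) _ (hdiff j k)).2
      set X := Real.log T / |al j - be k| with hX
      have hXX : X ^ 2 ≤ 1600 * lam ^ 4 * (1 / (2 * (((j:ℕ):ℝ) - ((k:ℕ):ℝ)) - 1) ^ 2) := by
        have hlT : 0 ≤ Real.log T := Real.log_nonneg hT
        rw [hX, div_pow, habs]
        have h1 : Real.log T ^ 2 ≤ (40 * lam) ^ 2 := by gcongr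
        calc Real.log T ^ 2 / ((2 * Real.pi / lam) ^ 2 * (2 * (((j:ℕ):ℝ) - ((k:ℕ):ℝ)) - 1) ^ 2) ≤
            (40 * lam) ^ 2 / ((2 * Real.pi / lam) ^ 2 * (2 * (((j:ℕ):ℝ) - ((k:ℕ):ℝ)) - 1) ^ 2) := by gcongr
          _ = (1600 * lam ^ 4 / (4 * Real.pi ^ 2)) * (1 / (2 * (((j:ℕ):ℝ) - ((k:ℕ):ℝ)) - 1) ^ 2) := by field_simp; ring
          _ ≤ _ := by
            gcongr
            apply div_le_self (by positivity)
            nlinarith [Real.pi_gt_three]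
      have hJp : (0:ℝ) < J := by exact_mod_cast hJ
      have hTJ : 1 / T ≤ lam ^ 4 * (1 / J) := by
        have h1 : (J:ℝ) ≤ lam * T := by
          have : 4 * Real.pi * J ≤ lam * T := by
            have h2 : p * J ≤ T / 4 := by nlinarith
            rw [hp, div_mul_eq_mul_div, div_le_iff₀ hl0] at h2
            nlinarith
          nlinarith [Real.pi_gt_three]
        have h2 : lam ≤ lam ^ 4 := le_self_pow₀ hlam (by norm_num)
        rw [mul_one_div, div_le_div_iff₀ hT0 hJp]
        nlinarith
      have hs : (1 / Real.sqrt T) ^ 2 = 1 / T := by rw [div_pow, Real.sq_sqrt hT0.le, one_pow]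
      set Y := 1 / Real.sqrt T with hY
      calc _ ≤ (K * (X + Y)) ^ 2 := by gcongr
        _ ≤ K ^ 2 * (2 * X ^ 2 + 2 * Y ^ 2) := by rw [mul_pow]; gcongr; nlinarith [sq_nonneg (X - Y)]
        _ ≤ K ^ 2 * (2 * (1600 * lam ^ 4 * (1 / (2 * (((j:ℕ):ℝ) - ((k:ℕ):ℝ)) - 1) ^ 2)) + 2 * (lam ^ 4 * (1 / J))) := by rw [hs]; gcongr
        _ ≤ (60 * K) ^ 2 * lam ^ 4 * (1 / (2 * (((j:ℕ):ℝ) - ((k:ℕ):ℝ)) - 1) ^ 2 + 1 / J) := by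
          have e1 : 0 ≤ K ^ 2 * (lam ^ 4 * (1 / (2 * (((j:ℕ):ℝ) - ((k:ℕ):ℝ)) - 1) ^ 2)) := by positivity
          have e2 : 0 ≤ K ^ 2 * (lam ^ 4 * (1 / (J:ℝ))) := by positivity
          nlinarith
    · intro j
      exact (hint (al j) (halm j) (be j) (hbem j) _ (hdiff j j)).1.trans (by linarith)
  have hI := intervalIntegral.integral_mono_on (μ := MeasureTheory.volume) hp0.le (Continuous.intervalIntegrable (by fun_prop) _ _) (Continuous.intervalIntegrable (by fun_prop) _ _) hpt
  have e1 := avg (fun t => ‖G t - G (t + p / 2)‖ ^ 2) (by fun_prop) x p J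
  have e2 := avg (fun t => ‖G t‖ ^ 4 + ‖G (t + p / 2)‖ ^ 4 + lam ^ 4) (by fun_prop) x p J
  rw [intervalIntegral.integral_const_mul, intervalIntegral.integral_const_mul, intervalIntegral.integral_add (Continuous.intervalIntegrable (by fun_prop) _ _) (Continuous.intervalIntegrable (by fun_prop) _ _),
    intervalIntegral.integral_const_mul, e1, e2, intervalIntegral.integral_const] at hI
  rw [intervalIntegral.integral_add (Continuous.intervalIntegrable (by fun_prop) _ _) (Continuous.intervalIntegrable (by fun_prop) _ _),
    intervalIntegral.integral_add (Continuous.intervalIntegrable (by fun_prop) _ _) (Continuous.intervalIntegrable (by fun_prop) _ _),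
    intervalIntegral.integral_const, intervalIntegral.integral_comp_add_right (fun t => ‖G t‖ ^ 4)] at hI
  simp only [smul_eq_mul, sub_zero, add_sub_cancel_left] at hI
  rw [hp2]
  exact hI
end DZ

namespace DZ
open Complex

theorem chooseN (T : ℝ) (hT : 1 ≤ T) : ∃ N : ℕ, (N:ℝ) ^ 20 ≤ T ∧ T ^ (1/20:ℝ) - 1 ≤ N ∧ 1 ≤ N ∧ T ≤ (2 * (N:ℝ)) ^ 20 := by
  have h1 : 1 ≤ T ^ (1/20:ℝ) := Real.one_le_rpow hT (by norm_num)
  have h20 : (T ^ (1/20:ℝ)) ^ 20 = T := by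
    rw [← Real.rpow_natCast, ← Real.rpow_mul (by linarith)]; norm_num
  refine ⟨⌊T ^ (1/20:ℝ)⌋₊, ?_, ?_, ?_, ?_⟩
  · calc _ ≤ (T ^ (1/20:ℝ)) ^ 20 := by gcongr; exact Nat.floor_le (by linarith)
      _ = T := h20
  · have := Nat.lt_floor_add_one (T ^ (1/20:ℝ)); linarith
  · exact Nat.le_floor (by exact_mod_cast h1)
  · have h2 := Nat.lt_floor_add_one (T ^ (1/20:ℝ))
    have h3 : (1:ℝ) ≤ ⌊T ^ (1/20:ℝ)⌋₊ := by exact_mod_cast (Nat.le_floor (by exact_mod_cast h1) : 1 ≤ ⌊T ^ (1/20:ℝ)⌋₊)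
    calc T = (T ^ (1/20:ℝ)) ^ 20 := h20.symm
      _ ≤ _ := by gcongr; linarith

/-- pure numerics -/
theorem numerics (lam Y D I2 I4 I4' c2 C2N C4 K A B P : ℝ) (hlam : 1 ≤ lam) (hY : 0 ≤ Y) (hc2 : 0 < c2) (hC4 : 0 ≤ C4) (hA : 0 ≤ A) (hP : 0 < P)
    (hB : B = 8 * P * (A + 1) * (18 * C4 + 1) / c2)
    (h2 : c2 * (Y * lam ^ 2) - C2N ≤ I2) (hC2 : C2N ≤ c2 / 2 * (Y * lam ^ 2))
    (h4 : I4 ≤ C4 * (9 * (Y * lam ^ 4))) (h4' : I4' ≤ C4 * (9 * (Y * lam ^ 4)))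
    (hK : 16 * P * K ^ 2 ≤ c2 * lam)
    (hm : lam ^ 2 * I2 ≤ P * (2 * K ^ 2 * Y + 4 * Real.pi * B * lam ^ 3 * D + A / B * (I4 + I4' + Y * lam ^ 4))) :
    c2 / 4 * Y * lam ≤ 4 * Real.pi * B * P * D := by
  have hBp : 0 < B := by rw [hB]; positivity
  have hl3 : 0 < lam ^ 3 := by positivity
  have e1 : lam ^ 2 * (c2 / 2 * (Y * lam ^ 2)) ≤ lam ^ 2 * I2 := by
    apply mul_le_mul_of_nonneg_left _ (by positivity); linarith
  have e2 : P * (A / B) * (I4 + I4' + Y * lam ^ 4) ≤ c2 / 8 * (Y * lam ^ 4) := by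
    have h0 : 0 ≤ P * (A / B) := by positivity
    have h1 : I4 + I4' + Y * lam ^ 4 ≤ (18 * C4 + 1) * (Y * lam ^ 4) := by linarith
    refine (mul_le_mul_of_nonneg_left h1 h0).trans ?_
    rw [← mul_assoc]
    apply mul_le_mul_of_nonneg_right _ (by positivity)
    have : P * (A / B) * (18 * C4 + 1) = c2 / 8 * (A / (A + 1)) := by
      rw [hB]; field_simp
    rw [this]
    have : A / (A + 1) ≤ 1 := by rw [div_le_one (by linarith)]; linarith
    nlinarith
  have e3 : P * (2 * K ^ 2 * Y) ≤ c2 / 8 * (Y * lam ^ 4) := by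
    have h1 : lam ≤ lam ^ 4 := le_self_pow₀ hlam (by norm_num)
    have h2 : 16 * P * K ^ 2 ≤ c2 * lam ^ 4 := hK.trans (by gcongr)
    nlinarith [mul_le_mul_of_nonneg_right h2 hY]
  have e4 : (c2 / 4 * Y * lam) * lam ^ 3 ≤ (4 * Real.pi * B * P * D) * lam ^ 3 := by
    nlinarith
  exact le_of_mul_le_mul_right e4 hl3

set_option maxHeartbeats 2000000 in
theorem final_count {m : ℕ} (hm : 1 ≤ m) (χ₁ χ₂ : Fin m → Σ n : ℕ, DirichletCharacter ℂ n) (hmod₁ : ∀ i, (χ₁ i).1 ≠ 0) (hmod₂ : ∀ i, (χ₂ i).1 ≠ 0)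
    (hp₁ : ∀ i, (χ₁ i).2.IsPrimitive) (hp₂ : ∀ i, (χ₂ i).2.IsPrimitive) (hne : ∀ i j, χ₁ i ≠ χ₂ j) (m₁ m₂ : ℂ → ℕ)
    (hm₁ : ∀ σ : ℂ, 0 < σ.re → σ.re < 1 → 0 < σ.im → ∃ c : ℂ, c ≠ 0 ∧
      Tendsto (fun s : ℂ => Lp χ₁ hmod₁ s / (s - σ) ^ (m₁ σ)) (𝓝[≠] σ) (𝓝 c))
    (hm₂ : ∀ σ : ℂ, 0 < σ.re → σ.re < 1 → 0 < σ.im → ∃ c : ℂ, c ≠ 0 ∧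
      Tendsto (fun s : ℂ => Lp χ₂ hmod₂ s / (s - σ) ^ (m₂ σ)) (𝓝[≠] σ) (𝓝 c)) :
    ∃ c : ℝ, 0 < c ∧ ∃ T₀ : ℝ, 100 ≤ T₀ ∧ ∀ T : ℝ, T₀ ≤ T → ∃ S : Finset ℂ,
      (∀ ρ ∈ S, 0 < ρ.re ∧ ρ.re < 1 ∧ 0 < ρ.im ∧ ρ.im < T ∧ Lp χ₁ hmod₁ ρ * Lp χ₂ hmod₂ ρ = 0 ∧ m₁ ρ ≠ m₂ ρ) ∧
      c * (T * Real.log T) ≤ S.card := by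
  obtain ⟨K, hK, hint⟩ := interface χ₁ χ₂ hmod₁ hmod₂ hp₁ hp₂ m₁ m₂ hm₁ hm₂
  obtain ⟨C4, hC4, h4⟩ := fourth (aa χ₁ χ₂) (2*m) (aa_norm χ₁ χ₂)
  obtain ⟨q, hq, r, κ, hr, hκ, har⟩ := char_fact m hm χ₁ χ₂ hmod₁ hmod₂ hp₁ hp₂ hne
  obtain ⟨c2, C2, lam0, hc2, hC2, hlam0, h2⟩ := second (aa χ₁ χ₂) (2*m) (aa_norm χ₁ χ₂) q r hr κ hκ har
  have hpi := Real.pi_pos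
  have hpi4 := Real.pi_le_four
  set P := 4 * Real.pi ^ 2 with hP
  have hP0 : 0 < P := by positivity
  have hW := W_nonneg
  set A := 16 * W + 4 * (60 * K) ^ 2 * (W + 1) with hA
  have hA0 : 0 ≤ A := by positivity
  set B := 8 * P * (A + 1) * (18 * C4 + 1) / c2 with hB
  have hB0 : 0 < B := by positivity
  set N0 := max (max (Real.exp lam0) (Real.exp (16 * P * (60 * K) ^ 2 / c2))) (max (16 * C2 / c2) 2) with hN0
  refine ⟨c2 / (4 * 8 * 40 * (4 * Real.pi * B * P)), by positivity, max 1000 ((N0 + 1) ^ 20), le_trans (by norm_num) (le_max_left _ _), fun T hT => ?_⟩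
  have hT1 : 1000 ≤ T := (le_max_left _ _).trans hT
  have hT2 : (N0 + 1) ^ 20 ≤ T := (le_max_right _ _).trans hT
  obtain ⟨N, hNT, hNl, hN1, hTN⟩ := chooseN T (by linarith)
  have hN0p : 2 ≤ N0 := (le_max_right _ _).trans (le_max_right _ _)
  have hNN0 : N0 ≤ N := by
    have : N0 + 1 ≤ T ^ (1/20:ℝ) := by
      have h := Real.rpow_le_rpow (by positivity) hT2 (by norm_num : (0:ℝ) ≤ 1/20)
      rw [← Real.rpow_natCast, ← Real.rpow_mul (by linarith)] at h
      norm_num at h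
      norm_num
      exact h
    linarith
  have hN2 : (2:ℝ) ≤ N := hN0p.trans hNN0
  have hN2' : 2 ≤ N := by exact_mod_cast hN2
  have hNpos : (0:ℝ) < N := by linarith
  have hl0 : lam0 ≤ Real.log N := by
    rw [Real.le_log_iff_exp_le hNpos]
    exact ((le_max_left _ _).trans (le_max_left _ _)).trans hNN0
  have hl1 : 16 * P * (60 * K) ^ 2 / c2 ≤ Real.log N := by
    rw [Real.le_log_iff_exp_le hNpos]
    exact ((le_max_right _ _).trans (le_max_left _ _)).trans hNN0
  have hN3 : 16 * C2 / c2 ≤ N := ((le_max_left _ _).trans (le_max_right _ _)).trans hNN0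
  have hlam : 1 ≤ Real.log N := hlam0.trans hl0
  have hlogT : Real.log T ≤ 40 * Real.log N := by
    have h := Real.log_le_log (by linarith) hTN
    rw [Real.log_pow, Real.log_mul (by norm_num) hNpos.ne'] at h
    have h5 : Real.log 2 ≤ 1 := by linarith [Real.log_two_lt_d9]
    push_cast at h
    linarith
  have hN4 : (N:ℝ) ^ 4 ≤ T := (pow_le_pow_right₀ (by linarith) (by norm_num)).trans hNT
  have hN10 : (N:ℝ) ^ 10 ≤ T := (pow_le_pow_right₀ (by linarith) (by norm_num)).trans hNT
  have hN6 : (N:ℝ) ^ 6 ≤ T := (pow_le_pow_right₀ (by linarith) (by norm_num)).trans hNT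
  obtain ⟨S, w, hS, hE⟩ := hint T (by linarith) N hN2' hN4
  refine ⟨S, hS, ?_⟩
  set lam := Real.log N with hlamd
  set p := 4 * Real.pi / lam with hp
  have hp0 : 0 < p := by positivity
  have hp16 : p ≤ 16 := by
    rw [hp, div_le_iff₀ (by linarith)]; nlinarith
  have hx2 : 2 ≤ T / (4 * p) := by
    rw [le_div_iff₀ (by positivity)]; linarith
  set J := ⌊T / (4 * p)⌋₊ - 1 with hJd
  have hf2 : 2 ≤ ⌊T / (4 * p)⌋₊ := Nat.le_floor (by exact_mod_cast hx2)
  have hJ1 : J + 1 = ⌊T / (4 * p)⌋₊ := by omega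
  have hJ0 : 0 < J := by omega
  have hJu : p * ((J:ℝ) + 1) ≤ T / 4 := by
    have h := Nat.floor_le (by linarith : 0 ≤ T / (4 * p))
    rw [← hJ1, le_div_iff₀ (by positivity)] at h
    push_cast at h
    linarith
  have hJl : T / 4 < p * ((J:ℝ) + 2) := by
    have h := Nat.lt_floor_add_one (T / (4 * p))
    rw [← hJ1, div_lt_iff₀ (by positivity)] at h
    push_cast at h
    linarith
  set Y := p * (J:ℝ) with hY
  have hYl : T / 8 ≤ Y := by nlinarith
  have hY0 : 0 ≤ Y := by linarith
  have hI := integrated N J hJ0 hlam (aa χ₁ χ₂) (T/4) T K B (by linarith) hK hB0 rfl hJu hlogT S w hE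
  have hI2 := h2 N hl0 (T/4) (T/4 + Y) (by linarith)
  have hI4 := h4 N hlam (T/4) (T/4 + Y) (by linarith)
  have hI4' := h4 N hlam (T/4 + 2 * Real.pi / lam) (T/4 + Y + 2 * Real.pi / lam) (by linarith)
  have hl4 : 1 ≤ lam ^ 4 := one_le_pow₀ hlam
  have hl2 : 1 ≤ lam ^ 2 := one_le_pow₀ hlam
  have hYl4 : Y ≤ Y * lam ^ 4 := le_mul_of_one_le_right hY0 hl4
  have hYl2 : Y ≤ Y * lam ^ 2 := le_mul_of_one_le_right hY0 hl2
  have hres := numerics lam Y S.card _ _ _ c2 (C2 * N ^ 5) C4 (60 * K) A B P hlam hY0 hc2 hC4 hA0 hP0 hB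
    (by rw [add_sub_cancel_left] at hI2; exact hI2) ?_
    (hI4.trans (mul_le_mul_of_nonneg_left (by rw [add_sub_cancel_left]; linarith) hC4))
    (hI4'.trans (mul_le_mul_of_nonneg_left (by rw [show T/4 + Y + 2 * Real.pi / lam - (T/4 + 2 * Real.pi / lam) = Y by ring]; linarith) hC4))
    (by rw [div_le_iff₀ hc2] at hl1; linarith) (hI.trans (le_of_eq ?_))
  · have hlY : T * Real.log T ≤ 8 * Y * (40 * lam) := by
      have : 0 ≤ Real.log T := Real.log_nonneg (by linarith)
      gcongr
      linarith
    rw [div_mul_eq_mul_div, div_le_iff₀ (by positivity)]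
    have h9 := mul_le_mul_of_nonneg_left hlY hc2.le
    linarith
  · rw [div_le_iff₀ hc2] at hN3
    have h5 : 16 * C2 * (N:ℝ) ^ 5 ≤ c2 * T := by
      calc 16 * C2 * (N:ℝ) ^ 5 ≤ (N * c2) * (N:ℝ) ^ 5 := by gcongr
        _ = c2 * (N:ℝ) ^ 6 := by ring
        _ ≤ c2 * T := by gcongr
    have h6 := mul_le_mul_of_nonneg_left (hYl.trans hYl2) hc2.le
    linarith
  · have : p * (2 * ((60 * K) ^ 2 * J) + B * lam ^ 4 * S.card) = 2 * (60 * K) ^ 2 * Y + 4 * Real.pi * B * lam ^ 3 * S.card := by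
      rw [hY, hp]; field_simp
    rw [this]

end DZ

namespace DZ
open Complex

theorem LF_near_one (x : Σ n : ℕ, DirichletCharacter ℂ n) (h : x.1 ≠ 0) : ∀ᶠ s in 𝓝[≠] (1:ℂ), LF x h s ≠ 0 := by
  haveI : NeZero x.1 := ⟨h⟩
  change ∀ᶠ s in 𝓝[≠] (1:ℂ), x.2.LFunction s ≠ 0
  by_cases h1 : x.2 = 1
  · rw [h1]
    have hr := DirichletCharacter.LFunctionTrivChar_residue_one (N := x.1)
    have hne : (∏ p ∈ x.1.primeFactors, (1 - (p:ℂ)⁻¹)) ≠ 0 := by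
      refine Finset.prod_ne_zero_iff.2 fun p hp => ?_
      have hp' := (Nat.prime_of_mem_primeFactors hp).one_lt
      rw [sub_ne_zero]
      intro he
      have : (p:ℂ) = 1 := by rw [eq_comm, inv_eq_one] at he; exact he
      have : p = 1 := by exact_mod_cast this
      omega
    filter_upwards [hr.eventually_ne hne] with s hs h0
    exact hs (by
      change (s - 1) * DirichletCharacter.LFunction 1 s = 0
      rw [h0, mul_zero])
  · have h2 := DirichletCharacter.LFunction_apply_one_ne_zero h1
    have hc := (DirichletCharacter.differentiable_LFunction h1).continuous.continuousAt (x := (1:ℂ))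
    exact (hc.eventually_ne h2).filter_mono nhdsWithin_le_nhds

theorem zeros_fin {m : ℕ} (χ : Fin m → Σ n : ℕ, DirichletCharacter ℂ n) (hmod : ∀ i, (χ i).1 ≠ 0) (T : ℝ) :
    {σ : ℂ | 0 < σ.re ∧ σ.re < 1 ∧ 0 < σ.im ∧ σ.im < T ∧ Lp χ hmod σ = 0}.Finite := by
  by_contra hinf
  have hK : IsCompact ((Set.Icc (0:ℝ) 1) ×ℂ (Set.Icc 0 T)) := isCompact_Icc.reProdIm isCompact_Icc
  obtain ⟨z, hz, hacc⟩ := Set.Infinite.exists_accPt_of_subset_isCompact hinf hK (by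
    rintro s ⟨a, b, c, d, _⟩
    exact ⟨⟨a.le, b.le⟩, ⟨c.le, d.le⟩⟩)
  rw [accPt_iff_frequently_nhdsNE] at hacc
  have hfr : ∃ᶠ s in 𝓝[≠] z, Lp χ hmod s = 0 := hacc.mono fun s hs => hs.2.2.2.2
  by_cases hz1 : z = 1
  · subst hz1
    have : ∀ᶠ s in 𝓝[≠] (1:ℂ), Lp χ hmod s ≠ 0 := by
      have h := eventually_all.2 fun i => LF_near_one (χ i) (hmod i)
      filter_upwards [h] with s hs
      exact (Lp_ne_iff χ hmod).2 hs
    exact hfr (by filter_upwards [this] with s hs using hs)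
  · have ha : AnalyticOnNhd ℂ (Lp χ hmod) {1}ᶜ :=
      DifferentiableOn.analyticOnNhd (fun s hs => (Lp_diff χ hmod hs).differentiableWithinAt) isOpen_compl_singleton
    have hpre : IsPreconnected ({1}ᶜ : Set ℂ) := (isConnected_compl_singleton_of_one_lt_rank (by simp [Complex.rank_real_complex]) 1).isPreconnected
    have h0 := ha.eqOn_zero_of_preconnected_of_frequently_eq_zero hpre (show z ∈ ({1}ᶜ : Set ℂ) from hz1) hfr
    have h2 := h0 (show (2:ℂ) ∈ ({1}ᶜ : Set ℂ) by simp)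
    exact (Lp_ne_iff χ hmod).2 (fun i => LF_ne (χ i) (hmod i) (by norm_num) (by norm_num)) h2

theorem final (m : ℕ) (hm : 1 ≤ m)
    (χ₁ χ₂ : Fin m → Σ n : ℕ, DirichletCharacter ℂ n)
    (hmod₁ : ∀ i, (χ₁ i).1 ≠ 0) (hmod₂ : ∀ i, (χ₂ i).1 ≠ 0)
    (hprim₁ : ∀ i, (χ₁ i).2.IsPrimitive) (hprim₂ : ∀ i, (χ₂ i).2.IsPrimitive)
    (hne : ∀ i j, χ₁ i ≠ χ₂ j)
    (L₁ L₂ : ℂ → ℂ)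
    (hL₁ : L₁ = Lp χ₁ hmod₁)
    (hL₂ : L₂ = Lp χ₂ hmod₂)
    (m₁ m₂ : ℂ → ℕ)
    (hm₁ : ∀ σ : ℂ, 0 < σ.re → σ.re < 1 → 0 < σ.im → ∃ c : ℂ, c ≠ 0 ∧
      Tendsto (fun s : ℂ => L₁ s / (s - σ) ^ (m₁ σ)) (𝓝[≠] σ) (𝓝 c))
    (hm₂ : ∀ σ : ℂ, 0 < σ.re → σ.re < 1 → 0 < σ.im → ∃ c : ℂ, c ≠ 0 ∧
      Tendsto (fun s : ℂ => L₂ s / (s - σ) ^ (m₂ σ)) (𝓝[≠] σ) (𝓝 c)) :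
    ∃ C : ℝ, 0 < C ∧ ∃ T₀ : ℝ, ∀ T : ℝ, T₀ ≤ T →
      C * (T / (2 * Real.pi)) * Real.log T <
        ∑' σ : {σ : ℂ // 0 < σ.re ∧ σ.re < 1 ∧ 0 < σ.im ∧ σ.im < T ∧ L₁ σ * L₂ σ = 0},
          |(m₁ σ.1 : ℝ) - (m₂ σ.1 : ℝ)| := by
  classical
  subst hL₁ hL₂
  obtain ⟨c, hc, T₀, hT₀, h⟩ := final_count hm χ₁ χ₂ hmod₁ hmod₂ hprim₁ hprim₂ hne m₁ m₂ hm₁ hm₂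
  refine ⟨c, hc, T₀, fun T hT => ?_⟩
  obtain ⟨S, hS, hcard⟩ := h T hT
  have hT1 : 100 ≤ T := hT₀.trans hT
  have hlog : 0 < Real.log T := Real.log_pos (by linarith)
  set p : ℂ → Prop := fun σ => 0 < σ.re ∧ σ.re < 1 ∧ 0 < σ.im ∧ σ.im < T ∧ Lp χ₁ hmod₁ σ * Lp χ₂ hmod₂ σ = 0 with hp
  haveI hfin : Finite {σ : ℂ // p σ} := by
    have h1 := (zeros_fin χ₁ hmod₁ T).union (zeros_fin χ₂ hmod₂ T)
    refine (h1.subset ?_).to_subtype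
    rintro s ⟨a, b, c, d, e⟩
    rcases mul_eq_zero.1 e with e | e
    · exact Or.inl ⟨a, b, c, d, e⟩
    · exact Or.inr ⟨a, b, c, d, e⟩
  have hsum : Summable (fun σ : {σ : ℂ // p σ} => |(m₁ σ.1 : ℝ) - (m₂ σ.1 : ℝ)|) := summable_of_finite_support (Set.toFinite _)
  have h1 := hsum.sum_le_tsum (S.subtype p) (fun _ _ => abs_nonneg _)
  rw [Finset.sum_subtype_of_mem (fun σ : ℂ => |(m₁ σ : ℝ) - (m₂ σ : ℝ)|) (fun ρ hρ => ⟨(hS ρ hρ).1, (hS ρ hρ).2.1, (hS ρ hρ).2.2.1, (hS ρ hρ).2.2.2.1, (hS ρ hρ).2.2.2.2.1⟩)] at h1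
  have h2 : (S.card : ℝ) ≤ ∑ ρ ∈ S, |(m₁ ρ : ℝ) - (m₂ ρ : ℝ)| := by
    rw [Finset.card_eq_sum_ones, Nat.cast_sum, Nat.cast_one]
    refine Finset.sum_le_sum fun ρ hρ => ?_
    have h3 : (m₁ ρ : ℤ) - m₂ ρ ≠ 0 := by have := (hS ρ hρ).2.2.2.2.2; omega
    have := Int.one_le_abs h3
    exact_mod_cast this
  refine lt_of_lt_of_le ?_ (h2.trans h1)
  refine lt_of_lt_of_le ?_ hcard
  rw [mul_assoc]
  apply mul_lt_mul_of_pos_left _ hc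
  apply mul_lt_mul_of_pos_right _ hlog
  exact div_lt_self (by linarith) (by linarith [Real.pi_gt_three])

end DZ

/-- (Fujii, Bombieri–Perelli) Let `χ⁽¹⁾₁, …, χ⁽¹⁾_m` and `χ⁽²⁾₁, …, χ⁽²⁾_m` be primitive
Dirichlet characters with `χ⁽¹⁾ᵢ ≠ χ⁽²⁾ⱼ` for all `i, j`, and put
`L₁ = ∏ᵢ L(·, χ⁽¹⁾ᵢ)`, `L₂ = ∏ᵢ L(·, χ⁽²⁾ᵢ)`.  Then there is `C > 0` such that for all
sufficiently large `T`, `∑ |m₁(σ) - m₂(σ)| > C (T/2π) log T`, the sum over the zeros `σ` of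
`L₁·L₂` with `0 < Re σ < 1`, `0 < Im σ < T`, where `mⱼ(σ)` is the multiplicity of `σ` as a
zero of `Lⱼ`. -/
theorem distinct_zeros_of_products_of_L_functions (m : ℕ) (hm : 1 ≤ m)
    (χ₁ χ₂ : Fin m → Σ n : ℕ, DirichletCharacter ℂ n)
    (hmod₁ : ∀ i, (χ₁ i).1 ≠ 0) (hmod₂ : ∀ i, (χ₂ i).1 ≠ 0)
    (hprim₁ : ∀ i, (χ₁ i).2.IsPrimitive) (hprim₂ : ∀ i, (χ₂ i).2.IsPrimitive)
    (hne : ∀ i j, χ₁ i ≠ χ₂ j)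
    (L₁ L₂ : ℂ → ℂ)
    (hL₁ : ∀ s : ℂ, L₁ s = ∏ i, haveI : NeZero (χ₁ i).1 := ⟨hmod₁ i⟩
      (χ₁ i).2.LFunction s)
    (hL₂ : ∀ s : ℂ, L₂ s = ∏ i, haveI : NeZero (χ₂ i).1 := ⟨hmod₂ i⟩
      (χ₂ i).2.LFunction s)
    (m₁ m₂ : ℂ → ℕ)
    (hm₁ : ∀ σ : ℂ, 0 < σ.re → σ.re < 1 → 0 < σ.im → ∃ c : ℂ, c ≠ 0 ∧
      Tendsto (fun s : ℂ => L₁ s / (s - σ) ^ (m₁ σ)) (𝓝[≠] σ) (𝓝 c))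
    (hm₂ : ∀ σ : ℂ, 0 < σ.re → σ.re < 1 → 0 < σ.im → ∃ c : ℂ, c ≠ 0 ∧
      Tendsto (fun s : ℂ => L₂ s / (s - σ) ^ (m₂ σ)) (𝓝[≠] σ) (𝓝 c)) :
    ∃ C : ℝ, 0 < C ∧ ∃ T₀ : ℝ, ∀ T : ℝ, T₀ ≤ T →
      C * (T / (2 * Real.pi)) * Real.log T <
        ∑' σ : {σ : ℂ // 0 < σ.re ∧ σ.re < 1 ∧ 0 < σ.im ∧ σ.im < T ∧ L₁ σ * L₂ σ = 0},
          |(m₁ σ.1 : ℝ) - (m₂ σ.1 : ℝ)| := by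
  exact DZ.final m hm χ₁ χ₂ hmod₁ hmod₂ hprim₁ hprim₂ hne L₁ L₂ (funext hL₁) (funext hL₂) m₁ m₂ hm₁ hm₂
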